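/- Kernel-form product formula for two Gegenbauer functions of the first kind in the trigonometric context. Let λ, α ∈ ℂ with Re(λ+2α) > 0 and Re λ < 4, and let x₁, x₂ be real numbers in (−1,1). For x₃ ∈ ((x₁+x₂)/(1+x₁x₂), 1) set B := (2 − x₁² − x₂² − x₃² + x₁² x₂² x₃²)/(2 √((1−x₁²)(1−x₂²)(1−x₃²))) (note B ≥ 1 on this range). Assume that the function x₃ ↦ 𝖢_λ^α(x₃) · (1−x₃²)^{α/2−5/4} · P_{λ+α−1/2}(B) is absolutely integrable on ((x₁+x₂)/(1+x₁x₂), 1). Then 𝖢_λ^α(x₁) · 𝖢_λ^α(x₂) = [−2^λ √π Γ(λ/2+α+1/2)] / [Γ(λ) Γ(α) Γ(1−λ/2) (1−x₁²)^{α/2−1/4} (1−x₂²)^{α/2−1/4}] × ∫_{(x₁+x₂)/(1+x₁x₂)}^1 𝖢_λ^α(x₃) · (1−x₃²)^{α/2−5/4} · P_{λ+α−1/2}(B) dx₃. -/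

import Mathlib

open MeasureTheory Set

/-- The regularized Gauss hypergeometric function `₂F̃₁(a,b;c;z)`. -/
noncomputable def hyp2F1reg (a b c z : ℂ) : ℂ :=
  ∑' n : ℕ, (ascPochhammer ℂ n).eval a * (ascPochhammer ℂ n).eval b /
      (Complex.Gamma (c + n) * (n.factorial : ℂ)) * z ^ n

/-- The Jacobi function of the second kind `Q_γ^{(α,β)}(z)` for real `z > 1`. -/
noncomputable def jacobiQ (α β γ : ℂ) (z : ℝ) : ℂ :=
  (2 : ℂ) ^ (α + β + γ) * Complex.Gamma (α + γ + 1) * Complex.Gamma (β + γ + 1) *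
    ((z : ℂ) - 1) ^ (-α) * ((z : ℂ) + 1) ^ (-β - γ - 1) *
    hyp2F1reg (γ + 1) (β + γ + 1) (α + β + 2 * γ + 2) (2 / (1 + (z : ℂ)))

/-- The Jacobi function of the first kind `P_γ^{(α,β)}(z)` for real `z > 1`. -/
noncomputable def jacobiP (α β γ : ℂ) (z : ℝ) : ℂ :=
  Complex.Gamma (α + γ + 1) / Complex.Gamma (γ + 1) * (((z : ℂ) + 1) / 2) ^ γ *
    hyp2F1reg (-γ) (-β - γ) (α + 1) (((z : ℂ) - 1) / ((z : ℂ) + 1))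

/-- The Jacobi function of the first kind on the cut `𝖯_γ^{(α,β)}(x)`, `x ∈ (−1,1)`. -/
noncomputable def jacobiPcut (α β γ : ℂ) (x : ℝ) : ℂ :=
  Complex.Gamma (α + γ + 1) / Complex.Gamma (γ + 1) *
    hyp2F1reg (-γ) (α + β + γ + 1) (α + 1) ((1 - (x : ℂ)) / 2)

/-- The Gegenbauer function of the first kind `C_λ^α(z)` for real `z > 1`. -/
noncomputable def gegenbauerC (lam α : ℂ) (z : ℝ) : ℂ :=
  (Real.sqrt Real.pi : ℂ) * Complex.Gamma (lam + 2 * α) /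
      ((2 : ℂ) ^ (2 * α - 1) * Complex.Gamma α * Complex.Gamma (lam + 1)) *
    (((z : ℂ) + 1) / 2) ^ lam *
    hyp2F1reg (-lam) (1 / 2 - α - lam) (α + 1 / 2) (((z : ℂ) - 1) / ((z : ℂ) + 1))

/-- The Gegenbauer function of the first kind on the cut `𝖢_λ^α(x)`, `x ∈ (−1,1)`. -/
noncomputable def gegenbauerCcut (lam α : ℂ) (x : ℝ) : ℂ :=
  (Real.sqrt Real.pi : ℂ) * Complex.Gamma (lam + 2 * α) /
      ((2 : ℂ) ^ (2 * α - 1) * Complex.Gamma α * Complex.Gamma (lam + 1)) *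
    hyp2F1reg (-lam) (lam + 2 * α) (α + 1 / 2) ((1 - (x : ℂ)) / 2)

/-- The Gegenbauer function of the second kind `D_λ^α(z)` for real `z > 1`. -/
noncomputable def gegenbauerD (lam α : ℂ) (z : ℝ) : ℂ :=
  Complex.exp ((Real.pi : ℂ) * Complex.I * α) * (Complex.Gamma (lam + 2 * α) / Complex.Gamma α) *
    (2 * (z : ℂ)) ^ (-lam - 2 * α) *
    hyp2F1reg (lam / 2 + α) (lam / 2 + α + 1 / 2) (lam + α + 1) (1 / (z : ℂ) ^ 2)

/-- The associated Legendre function of the second kind `Q_ν^μ(z)` for real `z > 1`. -/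
noncomputable def legendreQ (ν μ : ℂ) (z : ℝ) : ℂ :=
  (Real.sqrt Real.pi : ℂ) * Complex.exp ((Real.pi : ℂ) * Complex.I * μ) *
    Complex.Gamma (ν + μ + 1) * ((z : ℂ) ^ 2 - 1) ^ (μ / 2) * (2 : ℂ) ^ (-ν - 1) *
    (z : ℂ) ^ (-ν - μ - 1) *
    hyp2F1reg ((ν + μ + 1) / 2) ((ν + μ + 2) / 2) (ν + 3 / 2) (1 / (z : ℂ) ^ 2)

/-- The Legendre function of the first kind `P_ν(z)` for real `z ≥ 1`. -/
noncomputable def legendreP (ν : ℂ) (z : ℝ) : ℂ :=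
  (((z : ℂ) + 1) / 2) ^ ν * hyp2F1reg (-ν) (-ν) 1 (((z : ℂ) - 1) / ((z : ℂ) + 1))

/-- The associated Legendre function of the first kind of order `−μ`, `P_ν^{−μ}(z)`, `z > 1`. -/
noncomputable def legendrePa (ν μ : ℂ) (z : ℝ) : ℂ :=
  (((z : ℂ) - 1) / ((z : ℂ) + 1)) ^ (μ / 2) * (((z : ℂ) + 1) / 2) ^ ν *
    hyp2F1reg (-ν) (μ - ν) (μ + 1) (((z : ℂ) - 1) / ((z : ℂ) + 1))

/-- The Ferrers function of the first kind of order `−μ`, `𝖯_ν^{−μ}(x)`, `x ∈ (−1,1)`. -/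
noncomputable def ferrersP (ν μ : ℂ) (x : ℝ) : ℂ :=
  ((1 - (x : ℂ)) / (1 + (x : ℂ))) ^ (μ / 2) * hyp2F1reg (-ν) (ν + 1) (1 + μ) ((1 - (x : ℂ)) / 2)

/-- The Ferrers function of the second kind of order `−μ`, `𝖰_ν^{−μ}(x)`, `x ∈ (−1,1)`. -/
noncomputable def ferrersQ (ν μ : ℂ) (x : ℝ) : ℂ :=
  -((Real.pi : ℂ) / (2 * Complex.sin ((Real.pi : ℂ) * μ))) *
    (Complex.cos ((Real.pi : ℂ) * (ν - μ)) *
        (Complex.Gamma (ν - μ + 1) / Complex.Gamma (ν + μ + 1)) *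
        ((1 + (x : ℂ)) / (1 - (x : ℂ))) ^ (-μ / 2) *
        hyp2F1reg (-ν) (ν + 1) (1 - μ) ((1 + (x : ℂ)) / 2) -
      Complex.cos ((Real.pi : ℂ) * ν) * ((1 - (x : ℂ)) / (1 + (x : ℂ))) ^ (-μ / 2) *
        hyp2F1reg (-ν) (ν + 1) (1 + μ) ((1 + (x : ℂ)) / 2))

/-- Coefficient sequences with radius of convergence at least one. -/
def RS (e : ℕ → ℂ) : Prop := ∀ r : ℝ, 0 ≤ r → r < 1 → Summable (fun n => ‖e n‖ * r ^ n)

/-- The sum of a power series. -/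
noncomputable def ps (e : ℕ → ℂ) (z : ℂ) : ℂ := ∑' n, e n * z ^ n

/-- Coefficients of the derivative. -/
def dsh (e : ℕ → ℂ) : ℕ → ℂ := fun n => ((n : ℂ) + 1) * e (n + 1)

lemma RS.summable {e : ℕ → ℂ} (he : RS e) {z : ℂ} (hz : ‖z‖ < 1) :
    Summable (fun n => e n * z ^ n) := by
  apply Summable.of_norm
  simpa [norm_mul, norm_pow] using he ‖z‖ (norm_nonneg _) hz

lemma RS.dsh {e : ℕ → ℂ} (he : RS e) : RS (dsh e) := by
  intro r hr0 hr1
  obtain ⟨s, hrs, hs1⟩ := exists_between hr1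
  have hs0 : 0 < s := lt_of_le_of_lt hr0 hrs
  have h1 := he s hs0.le hs1
  have h2 : Summable (fun n => ‖e (n + 1)‖ * s ^ (n + 1)) := (summable_nat_add_iff 1).2 h1
  have h3 : Filter.Tendsto (fun n : ℕ => (n : ℝ) * (r / s) ^ n) Filter.atTop (nhds 0) :=
    tendsto_self_mul_const_pow_of_lt_one (by positivity) ((div_lt_one hs0).2 hrs)
  have h4 : Filter.Tendsto (fun n : ℕ => (r / s) ^ n) Filter.atTop (nhds 0) :=
    tendsto_pow_atTop_nhds_zero_of_lt_one (by positivity) ((div_lt_one hs0).2 hrs)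
  have h5 := h3.add h4
  simp only [add_zero] at h5
  have h6 : ∀ᶠ n : ℕ in Filter.atTop, (n : ℝ) * (r / s) ^ n + (r / s) ^ n < s :=
    h5.eventually_lt_const hs0
  refine Summable.of_norm_bounded_eventually_nat h2 ?_
  filter_upwards [h6] with n hn
  have e1 : ‖_root_.dsh e n‖ = ((n : ℝ) + 1) * ‖e (n + 1)‖ := by
    unfold _root_.dsh
    rw [norm_mul]
    congr 1
    have : ((n : ℂ) + 1) = ((n + 1 : ℕ) : ℂ) := by push_cast; ring
    rw [this, Complex.norm_natCast]; push_cast; ring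
  rw [Real.norm_of_nonneg (by positivity), e1]
  have e2 : ((n : ℝ) + 1) * r ^ n ≤ s ^ (n + 1) := by
    have : ((n : ℝ) + 1) * r ^ n = ((n : ℝ) * (r / s) ^ n + (r / s) ^ n) * s ^ n := by
      rw [div_pow]; field_simp
    rw [this, pow_succ, mul_comm (s ^ n)]
    gcongr
  calc ((n : ℝ) + 1) * ‖e (n + 1)‖ * r ^ n = ‖e (n + 1)‖ * (((n : ℝ) + 1) * r ^ n) := by ring
    _ ≤ _ := by gcongr

lemma hasDerivAt_ps {e : ℕ → ℂ} (he : RS e) {z : ℂ} (hz : ‖z‖ < 1) :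
    HasDerivAt (ps e) (ps (dsh e) z) z := by
  obtain ⟨r, hzr, hr1⟩ := exists_between hz
  have hr0 : 0 ≤ r := (norm_nonneg z).trans hzr.le
  have hsum := he.dsh r hr0 hr1
  have key : HasDerivAt (fun y => ∑' n, e n * y ^ n) (∑' n, e n * ((n : ℂ) * z ^ (n - 1))) z := by
    refine hasDerivAt_tsum_of_isPreconnected (u := fun n => ‖e n‖ * ((n : ℝ) * r ^ (n - 1)))
      (g := fun n y => e n * y ^ n) (g' := fun n y => e n * ((n : ℂ) * y ^ (n - 1)))
      (t := Metric.ball 0 r) (y₀ := 0) ?_ Metric.isOpen_ball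
      (convex_ball _ _).isPreconnected ?_ ?_ (Metric.mem_ball_self (lt_of_le_of_lt (norm_nonneg z) hzr)) ?_ (by simpa using hzr)
    · rw [← summable_nat_add_iff 1]
      refine hsum.congr fun n => ?_
      unfold dsh
      rw [norm_mul]
      have : ((n : ℂ) + 1) = ((n + 1 : ℕ) : ℂ) := by push_cast; ring
      rw [this, Complex.norm_natCast]; push_cast; ring
    · intro n y _
      simpa using (hasDerivAt_pow n y).const_mul (e n)
    · intro n y hy
      rw [norm_mul, norm_mul, norm_pow, Complex.norm_natCast]
      have : ‖y‖ ≤ r := by simpa using (Metric.mem_ball.1 hy).le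
      gcongr
    · exact he.summable (by simp)
  have hs : Summable (fun n => e n * ((n : ℂ) * z ^ (n - 1))) := by
    rw [← summable_nat_add_iff 1]
    refine (he.dsh.summable hz).congr fun n => ?_
    unfold dsh; push_cast; ring
  have hd : ps (dsh e) z = ∑' n, e n * ((n : ℂ) * z ^ (n - 1)) := by
    rw [hs.tsum_eq_zero_add]
    simp only [CharP.cast_eq_zero, zero_mul, mul_zero, zero_add]
    refine tsum_congr fun n => ?_
    unfold dsh; push_cast; ring
  rw [hd]
  exact key

lemma continuousOn_ps {e : ℕ → ℂ} (he : RS e) : ContinuousOn (ps e) (Metric.ball 0 1) :=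
  fun z hz => (hasDerivAt_ps he (by simpa using hz)).continuousAt.continuousWithinAt

/-- the shifted sequence -/
def ush (e : ℕ → ℂ) : ℕ → ℂ := fun n => Nat.casesOn n 0 e

lemma hasSum_ps {e : ℕ → ℂ} (he : RS e) {z : ℂ} (hz : ‖z‖ < 1) :
    HasSum (fun n => e n * z ^ n) (ps e z) := (he.summable hz).hasSum

lemma hasSum_ush {e : ℕ → ℂ} {z s : ℂ} (h : HasSum (fun n => e n * z ^ n) s) :
    HasSum (fun n => ush e n * z ^ n) (z * s) := by
  rw [← hasSum_nat_add_iff' 1]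
  simp only [Finset.range_one, Finset.sum_singleton]
  have : ush e 0 * z ^ 0 = 0 := by simp [ush]
  rw [this, sub_zero]
  refine (h.mul_left z).congr_fun ?_
  intro n
  simp only [ush]; ring

lemma ps_ode {e : ℕ → ℂ} (he : RS e) {a b c : ℂ}
    (h : ∀ n : ℕ, ((n : ℂ) + 1) * (c + n) * e (n + 1) = (a + n) * (b + n) * e n)
    {z : ℂ} (hz : ‖z‖ < 1) :
    z * (1 - z) * ps (dsh (dsh e)) z + (c - (a + b + 1) * z) * ps (dsh e) z = a * b * ps e z := by
  have h0 := hasSum_ps he hz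
  have h1 := hasSum_ps he.dsh hz
  have h2 := hasSum_ps he.dsh.dsh hz
  have h3 := hasSum_ush h1
  have h4 := hasSum_ush h2
  have h5 := hasSum_ush h4
  have H := (((h4.sub h5).add (h1.mul_left c)).sub (h3.mul_left (a + b + 1))).sub (h0.mul_left (a * b))
  have Z : HasSum (fun _ : ℕ => (0 : ℂ)) 0 := hasSum_zero
  have E := H.unique (Z.congr_fun ?_)
  · linear_combination E
  · intro n
    rcases n with _ | _ | n
    · have := h 0
      simp [ush, dsh] at this ⊢
      linear_combination this
    · have := h 1
      simp [ush, dsh] at this ⊢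
      linear_combination z * this
    · have := h (n + 2)
      simp only [ush, dsh] at this ⊢
      push_cast at this ⊢
      linear_combination z ^ (n + 2) * this

lemma RS_of_rec {e : ℕ → ℂ} {a b c : ℂ}
    (h : ∀ n : ℕ, ((n : ℂ) + 1) * (c + n) * e (n + 1) = (a + n) * (b + n) * e n) : RS e := by
  intro r hr0 hr1
  obtain ⟨s, hrs, hs1⟩ := exists_between hr1
  have hs0 : 0 < s := lt_of_le_of_lt hr0 hrs
  refine summable_of_ratio_norm_eventually_le hs1 ?_
  have lim : ∀ x y : ℂ, Filter.Tendsto (fun n : ℕ => (x + n) / (y + n)) Filter.atTop (nhds 1) := by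
    intro x y
    have hx : Filter.Tendsto (fun n : ℕ => x / (n : ℂ)) Filter.atTop (nhds 0) := by
      exact tendsto_const_div_atTop_nhds_zero_nat x
    have hy : Filter.Tendsto (fun n : ℕ => y / (n : ℂ)) Filter.atTop (nhds 0) := by
      exact tendsto_const_div_atTop_nhds_zero_nat y
    have := (hx.add_const 1).div (hy.add_const 1) (by simp)
    simp only [zero_add, div_one] at this
    refine this.congr' ?_
    filter_upwards [Filter.eventually_gt_atTop 0] with n hn
    have hn' : (n : ℂ) ≠ 0 := by exact_mod_cast hn.ne'
    simp only [Pi.div_apply]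
    rw [div_add_one hn', div_add_one hn', div_div_div_cancel_right₀ hn']
  have L := ((lim a 1).mul (lim b c)).norm.mul_const r
  simp only [mul_one, norm_one, one_mul] at L
  have ev := L.eventually_lt_const hrs
  have evc : ∀ᶠ n : ℕ in Filter.atTop, c + n ≠ 0 := by
    filter_upwards [Filter.eventually_gt_atTop ⌈‖c‖⌉₊] with n hn hc
    have : ‖(n : ℂ)‖ = ‖c‖ := by
      rw [← norm_neg c]; congr 1; linear_combination hc
    rw [Complex.norm_natCast] at this
    have := Nat.lt_of_ceil_lt hn
    linarith
  filter_upwards [ev, evc] with n hn hc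
  have h1n : (1 : ℂ) + n ≠ 0 := by
    have : ((n + 1 : ℕ) : ℂ) ≠ 0 := by exact_mod_cast Nat.succ_ne_zero n
    push_cast at this; rwa [add_comm]
  have ee : e (n + 1) = (a + n) / (1 + n) * ((b + n) / (c + n)) * e n := by
    field_simp
    linear_combination h n
  rw [ee]
  simp only [norm_mul, norm_norm, norm_pow, Real.norm_of_nonneg hr0] at hn ⊢
  calc _ = (‖(a + n) / (1 + n)‖ * ‖(b + n) / (c + n)‖ * r) * (‖e n‖ * r ^ n) := by ring
    _ ≤ _ := by gcongr

/-- hypergeometric coefficients -/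
noncomputable def hco (a b c : ℂ) : ℕ → ℂ := fun n =>
  (ascPochhammer ℂ n).eval a * (ascPochhammer ℂ n).eval b /
      (Complex.Gamma (c + n) * (n.factorial : ℂ))

lemma hyp_eq_ps (a b c : ℂ) : hyp2F1reg a b c = ps (hco a b c) := rfl

lemma hco_rec (a b c : ℂ) (n : ℕ) :
    ((n : ℂ) + 1) * (c + n) * hco a b c (n + 1) = (a + n) * (b + n) * hco a b c n := by
  unfold hco
  rw [ascPochhammer_succ_eval, ascPochhammer_succ_eval, Nat.factorial_succ]
  have hn : ((n : ℂ) + 1) ≠ 0 := by exact_mod_cast Nat.succ_ne_zero n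
  have hf : (n.factorial : ℂ) ≠ 0 := by exact_mod_cast n.factorial_ne_zero
  have hg := Complex.one_div_Gamma_eq_self_mul_one_div_Gamma_add_one (c + n)
  push_cast
  rw [← add_assoc]
  simp only [div_eq_mul_inv, mul_inv] at hg ⊢
  rw [hg]
  field_simp

lemma hco_RS (a b c : ℂ) : RS (hco a b c) := RS_of_rec (hco_rec a b c)

/-- coefficients of the Legendre series -/
noncomputable def lco (ν : ℂ) : ℕ → ℂ := hco (-ν) (-ν) 1

lemma lco_RS (ν : ℂ) : RS (lco ν) := hco_RS _ _ _

lemma lco_rec (ν : ℂ) (n : ℕ) :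
    ((n : ℂ) + 1) * (1 + n) * lco ν (n + 1) = (-ν + n) * (-ν + n) * lco ν n := hco_rec _ _ _ n

lemma lco_zero (ν : ℂ) : lco ν 0 = 1 := by simp [lco, hco]

/-- first derivative of the Legendre function -/
noncomputable def legP1 (ν : ℂ) (z : ℝ) : ℂ :=
  (((z : ℂ) + 1) / 2) ^ ν * (ν / ((z : ℂ) + 1) * ps (lco ν) (((z : ℂ) - 1) / ((z : ℂ) + 1)) +
    2 / ((z : ℂ) + 1) ^ 2 * ps (dsh (lco ν)) (((z : ℂ) - 1) / ((z : ℂ) + 1)))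

/-- second derivative of the Legendre function -/
noncomputable def legP2 (ν : ℂ) (z : ℝ) : ℂ :=
  (((z : ℂ) + 1) / 2) ^ ν * (ν * (ν - 1) / ((z : ℂ) + 1) ^ 2 *
      ps (lco ν) (((z : ℂ) - 1) / ((z : ℂ) + 1)) +
    (4 * ν - 4) / ((z : ℂ) + 1) ^ 3 * ps (dsh (lco ν)) (((z : ℂ) - 1) / ((z : ℂ) + 1)) +
    4 / ((z : ℂ) + 1) ^ 4 * ps (dsh (dsh (lco ν))) (((z : ℂ) - 1) / ((z : ℂ) + 1)))

lemma legP_eq (ν : ℂ) (z : ℝ) : legendreP ν z =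
    (((z : ℂ) + 1) / 2) ^ ν * ps (lco ν) (((z : ℂ) - 1) / ((z : ℂ) + 1)) := rfl

lemma zp1_ne {z : ℝ} (hz : 0 < z) : (z : ℂ) + 1 ≠ 0 := by
  have : ((z + 1 : ℝ) : ℂ) ≠ 0 := by exact_mod_cast (by linarith : z + 1 ≠ 0)
  simpa using this

lemma w_norm {z : ℝ} (hz : 0 < z) : ‖((z : ℂ) - 1) / ((z : ℂ) + 1)‖ < 1 := by
  have : ((z : ℂ) - 1) / ((z : ℂ) + 1) = (((z - 1) / (z + 1) : ℝ) : ℂ) := by push_cast; rfl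
  rw [this, Complex.norm_real, Real.norm_eq_abs, abs_lt]
  constructor
  · rw [lt_div_iff₀ (by linarith)]; linarith
  · rw [div_lt_one (by linarith)]; linarith

lemma w_deriv {z : ℝ} (hz : 0 < z) :
    HasDerivAt (fun z : ℝ => ((z : ℂ) - 1) / ((z : ℂ) + 1)) (2 / ((z : ℂ) + 1) ^ 2) z := by
  have h1 : HasDerivAt (fun z : ℝ => (z : ℂ)) 1 z := Complex.ofRealCLM.hasDerivAt
  have := (h1.sub_const 1).div (h1.add_const 1) (zp1_ne hz)
  refine this.congr_deriv ?_
  have := zp1_ne hz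
  field_simp; ring

lemma g_deriv (ν : ℂ) {z : ℝ} (hz : 0 < z) :
    HasDerivAt (fun z : ℝ => (((z : ℂ) + 1) / 2) ^ ν)
      ((((z : ℂ) + 1) / 2) ^ ν * (ν / ((z : ℂ) + 1))) z := by
  have h1 : HasDerivAt (fun z : ℝ => ((z : ℂ) + 1) / 2) (1 / 2) z :=
    ((Complex.ofRealCLM.hasDerivAt).add_const 1).div_const 2
  have hs : ((z : ℂ) + 1) / 2 ∈ Complex.slitPlane := by
    left
    have : ((z : ℂ) + 1) / 2 = (((z + 1) / 2 : ℝ) : ℂ) := by push_cast; rfl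
    rw [this, Complex.ofReal_re]; linarith
  have h2 : HasDerivAt (fun x : ℂ => x ^ ν) (ν * (((z : ℂ) + 1) / 2) ^ (ν - 1)) (((z : ℂ) + 1) / 2) := by
    simpa using (hasDerivAt_id (((z : ℂ) + 1) / 2)).cpow_const (c := ν) hs
  have := h2.comp z h1
  refine this.congr_deriv ?_
  have h0 : ((z : ℂ) + 1) / 2 ≠ 0 := div_ne_zero (zp1_ne hz) two_ne_zero
  have := zp1_ne hz
  rw [Complex.cpow_sub _ _ h0, Complex.cpow_one]
  field_simp

lemma ps_w_deriv {e : ℕ → ℂ} (he : RS e) {z : ℝ} (hz : 0 < z) :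
    HasDerivAt (fun z : ℝ => ps e (((z : ℂ) - 1) / ((z : ℂ) + 1)))
      (ps (dsh e) (((z : ℂ) - 1) / ((z : ℂ) + 1)) * (2 / ((z : ℂ) + 1) ^ 2)) z := by
  have h1 := hasDerivAt_ps he (w_norm hz)
  have := h1.comp z (w_deriv hz)
  exact this

lemma legP_deriv (ν : ℂ) {z : ℝ} (hz : 0 < z) : HasDerivAt (legendreP ν) (legP1 ν z) z := by
  have := (g_deriv ν hz).mul (ps_w_deriv (lco_RS ν) hz)
  refine this.congr_deriv ?_
  unfold legP1; ring

lemma legP1_deriv (ν : ℂ) {z : ℝ} (hz : 0 < z) : HasDerivAt (legP1 ν) (legP2 ν z) z := by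
  have hne := zp1_ne hz
  have h1 : HasDerivAt (fun z : ℝ => (z : ℂ) + 1) 1 z :=
    ((Complex.ofRealCLM.hasDerivAt).add_const 1)
  have hA := (hasDerivAt_const z ν).div h1 hne
  have hB := (hasDerivAt_const z (2 : ℂ)).div (h1.pow 2) (pow_ne_zero 2 hne)
  have := (g_deriv ν hz).mul ((hA.mul (ps_w_deriv (lco_RS ν) hz)).add
    (hB.mul (ps_w_deriv (lco_RS ν).dsh hz)))
  refine this.congr_deriv ?_
  unfold legP2
  simp only [Pi.div_apply, Pi.mul_apply, Pi.add_apply, Pi.pow_apply]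
  field_simp
  push_cast
  ring

lemma legP_ode (ν : ℂ) {z : ℝ} (hz : 0 < z) :
    ((z : ℂ) ^ 2 - 1) * legP2 ν z + 2 * z * legP1 ν z = ν * (ν + 1) * legendreP ν z := by
  have hne := zp1_ne hz
  have h := ps_ode (lco_RS ν) (lco_rec ν) (w_norm hz)
  rw [legP_eq]
  unfold legP1 legP2
  set f0 := ps (lco ν) (((z : ℂ) - 1) / ((z : ℂ) + 1))
  set f1 := ps (dsh (lco ν)) (((z : ℂ) - 1) / ((z : ℂ) + 1))
  set f2 := ps (dsh (dsh (lco ν))) (((z : ℂ) - 1) / ((z : ℂ) + 1))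
  set g := (((z : ℂ) + 1) / 2) ^ ν
  have h' : f2 * (z - 1) * 2 + (2 + 2 * ν * (z - 1)) * (z + 1) * f1 = ν ^ 2 * f0 * (z + 1) ^ 2 := by
    field_simp at h
    linear_combination h
  field_simp
  linear_combination (2 * g * (z + 1)) * h'

lemma legP_one (ν : ℂ) : legendreP ν 1 = 1 := by
  rw [legP_eq]
  simp only [Complex.ofReal_one, sub_self, zero_div]
  have : ps (lco ν) 0 = 1 := by
    unfold ps
    rw [tsum_eq_single 0]
    · simp [lco_zero]
    · intro n hn; simp [hn]
  rw [this]; norm_num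

lemma legP2_continuousOn (ν : ℂ) : ContinuousOn (legP2 ν) (Ioi 0) := by
  have hne : ∀ z ∈ Ioi (0 : ℝ), (z : ℂ) + 1 ≠ 0 := fun z hz => zp1_ne hz
  have hc : ∀ {e : ℕ → ℂ}, RS e →
      ContinuousOn (fun z : ℝ => ps e (((z : ℂ) - 1) / ((z : ℂ) + 1))) (Ioi 0) :=
    fun he z hz => (ps_w_deriv he hz).continuousAt.continuousWithinAt
  have hg : ContinuousOn (fun z : ℝ => (((z : ℂ) + 1) / 2) ^ ν) (Ioi 0) :=
    fun z hz => (g_deriv ν hz).continuousAt.continuousWithinAt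
  have hz1 : ContinuousOn (fun z : ℝ => (z : ℂ) + 1) (Ioi 0) := by fun_prop
  unfold legP2
  refine hg.mul (((ContinuousOn.mul ?_ (hc (lco_RS ν))).add (ContinuousOn.mul ?_ (hc (lco_RS ν).dsh))).add
    (ContinuousOn.mul ?_ (hc (lco_RS ν).dsh.dsh)))
  · exact continuousOn_const.div (hz1.pow 2) fun z hz => pow_ne_zero _ (hne z hz)
  · exact continuousOn_const.div (hz1.pow 3) fun z hz => pow_ne_zero _ (hne z hz)
  · exact continuousOn_const.div (hz1.pow 4) fun z hz => pow_ne_zero _ (hne z hz)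

/-- binomial coefficients -/
noncomputable def bco (s : ℝ) (n : ℕ) : ℝ := (ascPochhammer ℝ n).eval s / n.factorial

lemma bco_rec (s : ℝ) (n : ℕ) : ((n : ℝ) + 1) * bco s (n + 1) = (s + n) * bco s n := by
  unfold bco
  rw [ascPochhammer_succ_eval, Nat.factorial_succ]
  have hf : (n.factorial : ℝ) ≠ 0 := by exact_mod_cast n.factorial_ne_zero
  have hn : (n : ℝ) + 1 ≠ 0 := by positivity
  push_cast
  field_simp

lemma bco_pos {s : ℝ} (hs : 0 < s) (n : ℕ) : 0 < bco s n := by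
  unfold bco
  have := ascPochhammer_pos n s hs
  positivity

lemma bco_hasSum (s : ℝ) {w : ℝ} (h0 : 0 ≤ w) (h1 : w < 1) :
    HasSum (fun n => bco s n * w ^ n) ((1 - w) ^ (-s)) := by
  have H := (Complex.one_div_one_sub_cpow_hasFPowerSeriesOnBall_zero (s : ℂ)).hasSum (y := (w : ℂ)) (by
    simp [enorm, ← NNReal.coe_lt_coe, abs_of_nonneg h0, h1])
  rw [← Complex.hasSum_ofReal]
  have hval : (((1 - w) ^ (-s) : ℝ) : ℂ) = 1 / (1 - (0 + (w : ℂ))) ^ (s : ℂ) := by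
    have : (1 - (0 + (w : ℂ))) = ((1 - w : ℝ) : ℂ) := by push_cast; ring
    rw [this, Complex.ofReal_cpow (by linarith), one_div, ← Complex.cpow_neg]
    push_cast; rfl
  rw [hval]
  refine H.congr_fun ?_
  intro n
  simp only [FormalMultilinearSeries.ofScalars_apply_eq, smul_eq_mul, Complex.ofReal_mul, Complex.ofReal_pow]
  congr 1
  have : Ring.choose ((s : ℂ) + n - 1) n = Ring.multichoose (s : ℂ) n := by
    rw [Ring.choose]; congr 1; ring
  rw [this]
  have h2 := Ring.factorial_nsmul_multichoose_eq_ascPochhammer (s : ℂ) n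
  have hf : (n.factorial : ℂ) ≠ 0 := by exact_mod_cast n.factorial_ne_zero
  unfold bco
  push_cast
  rw [div_eq_iff hf, mul_comm, ← nsmul_eq_mul, h2, Polynomial.ascPochhammer_smeval_eq_eval]
  rw [ascPochhammer_eval₂ (Complex.ofRealHom)]
  exact (Polynomial.eval₂_at_apply Complex.ofRealHom s).symm

lemma rpow_comp {x y M ρ : ℝ} (hx : 0 < x) (hy : 0 < y) (hM : 1 ≤ M) (h1 : x ≤ M * y)
    (h2 : y ≤ M * x) : x ^ ρ ≤ M ^ |ρ| * y ^ ρ := by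
  have hM0 : 0 < M := by linarith
  rcases le_or_gt 0 ρ with h | h
  · rw [abs_of_nonneg h, ← Real.mul_rpow hM0.le hy.le]
    exact Real.rpow_le_rpow hx.le h1 h
  · rw [abs_of_neg h]
    have : y ^ ρ = M ^ ρ * (y / M) ^ ρ := by
      rw [← Real.mul_rpow hM0.le (by positivity)]; congr 1; field_simp
    rw [this, ← mul_assoc, ← Real.rpow_add hM0, neg_add_cancel, Real.rpow_zero, one_mul]
    apply Real.rpow_le_rpow_of_nonpos (by positivity) _ h.le
    rw [div_le_iff₀ hM0]; linarith

lemma bdd_of_antitone_tail {r : ℕ → ℝ} {n0 : ℕ} (h : ∀ n ≥ n0, r (n + 1) ≤ r n) :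
    ∃ C, 0 ≤ C ∧ ∀ n, r n ≤ C := by
  have h1 : ∀ n ≥ n0, r n ≤ r n0 := by
    intro n hn
    induction n, hn using Nat.le_induction with
    | base => exact le_rfl
    | succ n hn ih => exact (h n hn).trans ih
  refine ⟨∑ k ∈ Finset.range (n0 + 1), |r k|, Finset.sum_nonneg fun _ _ => abs_nonneg _, fun n => ?_⟩
  have h2 : ∀ k ≤ n0, r k ≤ ∑ k ∈ Finset.range (n0 + 1), |r k| := fun k hk =>
    (le_abs_self _).trans (Finset.single_le_sum (f := fun k => |r k|) (fun _ _ => abs_nonneg _)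
      (Finset.mem_range.2 (by omega)))
  rcases le_total n n0 with hn | hn
  · exact h2 n hn
  · exact (h1 n hn).trans (h2 n0 le_rfl)

lemma lco_norm_rec (ν : ℂ) (n : ℕ) :
    ((n : ℝ) + 1) ^ 2 * ‖lco ν (n + 1)‖ = ((n - ν.re) ^ 2 + ν.im ^ 2) * ‖lco ν n‖ := by
  have h := congrArg norm (lco_rec ν n)
  simp only [norm_mul] at h
  have e1 : ‖(n : ℂ) + 1‖ = (n : ℝ) + 1 := by
    have : ((n : ℂ) + 1) = ((n + 1 : ℕ) : ℂ) := by push_cast; ring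
    rw [this, Complex.norm_natCast]; push_cast; ring
  have e2 : ‖(1 : ℂ) + n‖ = (n : ℝ) + 1 := by rw [add_comm, e1]
  have e3 : ‖-ν + n‖ * ‖-ν + n‖ = (n - ν.re) ^ 2 + ν.im ^ 2 := by
    rw [← sq, ← Complex.normSq_eq_norm_sq, Complex.normSq_apply]
    simp; ring
  rw [e1, e2, e3] at h
  linarith

lemma lco_bound (ν : ℂ) {s : ℝ} (hs : 0 < s) (h : 0 < 1 + s + 2 * ν.re) :
    ∃ C, 0 ≤ C ∧ ∀ n, ‖lco ν n‖ ≤ C * bco s n := by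
  obtain ⟨n0, hn0⟩ := exists_nat_gt ((ν.re ^ 2 + ν.im ^ 2) / (1 + s + 2 * ν.re))
  rw [div_lt_iff₀ h] at hn0
  obtain ⟨C, hC, hb⟩ := bdd_of_antitone_tail (r := fun n => ‖lco ν n‖ / bco s n) (n0 := n0) (by
    intro n hn
    have hn' : (n0 : ℝ) ≤ n := by exact_mod_cast hn
    have b0 := bco_pos hs n
    have b1 := bco_pos hs (n + 1)
    rw [div_le_div_iff₀ b1 b0]
    have r1 := lco_norm_rec ν n
    have r2 := bco_rec s n
    have hn1 : (0 : ℝ) < (n : ℝ) + 1 := by positivity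
    have key : (n - ν.re) ^ 2 + ν.im ^ 2 ≤ (n + 1) * (s + n) := by
      have : (n0 : ℝ) * (1 + s + 2 * ν.re) ≤ n * (1 + s + 2 * ν.re) := by gcongr
      nlinarith
    have : ((n : ℝ) + 1) ^ 2 * (‖lco ν (n + 1)‖ * bco s n) ≤
        ((n : ℝ) + 1) ^ 2 * (‖lco ν n‖ * bco s (n + 1)) := by
      calc _ = ((n - ν.re) ^ 2 + ν.im ^ 2) * (‖lco ν n‖ * bco s n) := by
            rw [← mul_assoc, r1]; ring
        _ ≤ ((n + 1) * (s + n)) * (‖lco ν n‖ * bco s n) := by gcongr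
        _ = (n + 1) * ‖lco ν n‖ * ((s + n) * bco s n) := by ring
        _ = _ := by rw [← r2]; ring
    exact le_of_mul_le_mul_left this (by positivity))
  refine ⟨C, hC, fun n => ?_⟩
  have := hb n
  rwa [div_le_iff₀ (bco_pos hs n)] at this

lemma g_norm (ν : ℂ) {z : ℝ} (hz : 0 < z) : ‖(((z : ℂ) + 1) / 2) ^ ν‖ = ((z + 1) / 2) ^ ν.re := by
  have : ((z : ℂ) + 1) / 2 = (((z + 1) / 2 : ℝ) : ℂ) := by push_cast; rfl
  rw [this, Complex.norm_cpow_eq_rpow_re_of_pos (by linarith)]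

lemma legP_bound0 (ν : ℂ) {ρ : ℝ} (h1 : ν.re < ρ) (h2 : -1 - ν.re < ρ) :
    ∃ C, 0 ≤ C ∧ ∀ z : ℝ, 1 ≤ z → ‖legendreP ν z‖ ≤ C * z ^ ρ := by
  obtain ⟨C, hC, hb⟩ := lco_bound ν (s := ρ - ν.re) (by linarith) (by linarith)
  refine ⟨C * 2 ^ |ρ|, by positivity, fun z hz => ?_⟩
  have hz0 : 0 < z := by linarith
  set w := (z - 1) / (z + 1) with hw
  have hw0 : 0 ≤ w := div_nonneg (by linarith) (by linarith)
  have hw1 : w < 1 := by rw [hw, div_lt_one (by linarith)]; linarith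
  have hwc : ((z : ℂ) - 1) / ((z : ℂ) + 1) = (w : ℂ) := by rw [hw]; push_cast; rfl
  have h1w : 1 - w = ((z + 1) / 2)⁻¹ := by rw [hw]; field_simp; ring
  have hS := (bco_hasSum (ρ - ν.re) hw0 hw1).mul_left C
  have hps : ‖ps (lco ν) (w : ℂ)‖ ≤ C * (1 - w) ^ (-(ρ - ν.re)) := by
    unfold ps
    refine tsum_of_norm_bounded hS fun n => ?_
    rw [norm_mul, norm_pow, Complex.norm_real, Real.norm_of_nonneg hw0, ← mul_assoc]
    gcongr
    exact hb n
  rw [legP_eq, norm_mul, g_norm ν hz0, hwc]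
  have hp : 0 < (z + 1) / 2 := by linarith
  calc _ ≤ ((z + 1) / 2) ^ ν.re * (C * (1 - w) ^ (-(ρ - ν.re))) := by gcongr
    _ = C * ((z + 1) / 2) ^ ρ := by
      rw [h1w, Real.inv_rpow hp.le, ← Real.rpow_neg hp.le, neg_neg, mul_left_comm, ← Real.rpow_add hp]
      congr 2; ring
    _ ≤ C * (2 ^ |ρ| * z ^ ρ) := by
      gcongr
      exact rpow_comp hp hz0 (by norm_num) (by linarith) (by linarith)
    _ = _ := by ring

lemma legP1_continuousOn (ν : ℂ) : ContinuousOn (legP1 ν) (Ioi 0) :=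
  fun z hz => (legP1_deriv ν hz).continuousAt.continuousWithinAt
lemma legP_continuousOn (ν : ℂ) : ContinuousOn (legendreP ν) (Ioi 0) :=
  fun z hz => (legP_deriv ν hz).continuousAt.continuousWithinAt

lemma legP1_bound0 (ν : ℂ) {ρ : ℝ} (h1 : ν.re < ρ) (h2 : -1 - ν.re < ρ) :
    ∃ C, 0 ≤ C ∧ ∀ z : ℝ, 2 ≤ z → ‖legP1 ν z‖ ≤ C * z ^ (ρ - 1) := by
  obtain ⟨C, hC, hb⟩ := legP_bound0 ν h1 h2
  have hρ : 0 < ρ + 1 := by linarith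
  set N := ‖ν * (ν + 1)‖
  have hN : 0 ≤ N := norm_nonneg _
  have main : ∀ z : ℝ, 1 ≤ z → ‖((z : ℂ) ^ 2 - 1) * legP1 ν z‖ ≤ N * C * z ^ (ρ + 1) / (ρ + 1) := by
    intro z hz
    have hd : ∀ x : ℝ, 0 < x → HasDerivAt (fun z : ℝ => ((z : ℂ) ^ 2 - 1) * legP1 ν z)
        (ν * (ν + 1) * legendreP ν x) x := by
      intro x hx
      have h1 : HasDerivAt (fun z : ℝ => (z : ℂ)) 1 x := Complex.ofRealCLM.hasDerivAt
      refine (((h1.pow 2).sub_const 1).mul (legP1_deriv ν hx)).congr_deriv ?_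
      rw [← legP_ode ν hx]
      simp only [Pi.pow_apply]
      push_cast; ring
    refine image_norm_le_of_norm_deriv_right_le_deriv_boundary' (a := 1) (b := z)
      (f := fun z : ℝ => ((z : ℂ) ^ 2 - 1) * legP1 ν z)
      (f' := fun x => ν * (ν + 1) * legendreP ν x) (B := fun z => N * C * z ^ (ρ + 1) / (ρ + 1))
      (B' := fun z => N * C * z ^ ρ) ?_ ?_ ?_ ?_ ?_ ?_ ⟨hz, le_rfl⟩
    · intro x hx
      exact (hd x (by linarith [hx.1])).continuousAt.continuousWithinAt
    · intro x hx
      exact (hd x (by linarith [hx.1])).hasDerivWithinAt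
    · simp only [Complex.ofReal_one, one_pow, sub_self, zero_mul, norm_zero]
      positivity
    · intro x hx
      have : 0 < x := by linarith [hx.1]
      exact ((continuousAt_const.mul (Real.continuousAt_rpow_const x _ (Or.inl this.ne'))).div_const _).continuousWithinAt
    · intro x hx
      have hx0 : 0 < x := by linarith [hx.1]
      have := (((Real.hasDerivAt_rpow_const (x := x) (p := ρ + 1) (Or.inl hx0.ne')).const_mul (N * C)).div_const (ρ + 1))
      refine (this.congr_deriv ?_).hasDerivWithinAt
      rw [add_sub_cancel_right]; field_simp
    · intro x hx
      rw [norm_mul, mul_assoc]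
      exact mul_le_mul_of_nonneg_left (hb x hx.1) hN
  refine ⟨4 / 3 * (N * C / (ρ + 1)), by positivity, fun z hz => ?_⟩
  have hz0 : 0 < z := by linarith
  have h3 := main z (by linarith)
  have e : ((z : ℂ) ^ 2 - 1) = ((z ^ 2 - 1 : ℝ) : ℂ) := by push_cast; rfl
  rw [norm_mul, e, Complex.norm_real, Real.norm_of_nonneg (by nlinarith)] at h3
  have e2 : z ^ (ρ + 1) = z ^ 2 * z ^ (ρ - 1) := by
    rw [← Real.rpow_natCast, ← Real.rpow_add hz0]; congr 1; push_cast; ring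
  have h4 : 3 / 4 * z ^ 2 * ‖legP1 ν z‖ ≤ N * C * (z ^ 2 * z ^ (ρ - 1)) / (ρ + 1) := by
    rw [← e2]
    refine le_trans ?_ h3
    gcongr
    nlinarith
  have hz2 : 0 < z ^ 2 := by positivity
  refine le_of_mul_le_mul_left ?_ hz2
  calc z ^ 2 * ‖legP1 ν z‖ = 4 / 3 * (3 / 4 * z ^ 2 * ‖legP1 ν z‖) := by ring
    _ ≤ 4 / 3 * (N * C * (z ^ 2 * z ^ (ρ - 1)) / (ρ + 1)) := by gcongr
    _ = _ := by ring

lemma legP2_bound0 (ν : ℂ) {ρ : ℝ} (h1 : ν.re < ρ) (h2 : -1 - ν.re < ρ) :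
    ∃ C, 0 ≤ C ∧ ∀ z : ℝ, 2 ≤ z → ‖legP2 ν z‖ ≤ C * z ^ (ρ - 2) := by
  obtain ⟨C, hC, hb⟩ := legP_bound0 ν h1 h2
  obtain ⟨C1, hC1, hb1⟩ := legP1_bound0 ν h1 h2
  set N := ‖ν * (ν + 1)‖ with hNd
  have hN : 0 ≤ N := norm_nonneg _
  refine ⟨4 / 3 * (N * C + 2 * C1), by positivity, fun z hz => ?_⟩
  have hz0 : 0 < z := by linarith
  have h3 : ((z : ℂ) ^ 2 - 1) * legP2 ν z = ν * (ν + 1) * legendreP ν z - 2 * z * legP1 ν z := by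
    rw [← legP_ode ν hz0]; ring
  have e : ((z : ℂ) ^ 2 - 1) = ((z ^ 2 - 1 : ℝ) : ℂ) := by push_cast; rfl
  have h4 := congrArg norm h3
  rw [norm_mul, e, Complex.norm_real, Real.norm_of_nonneg (by nlinarith)] at h4
  have e2 : z ^ ρ = z ^ 2 * z ^ (ρ - 2) := by
    rw [← Real.rpow_natCast, ← Real.rpow_add hz0]; congr 1; push_cast; ring
  have e3 : z * z ^ (ρ - 1) = z ^ 2 * z ^ (ρ - 2) := by
    rw [← e2]; nth_rw 1 [← Real.rpow_one z]; rw [← Real.rpow_add hz0]; congr 1; ring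
  have h5 : (z ^ 2 - 1) * ‖legP2 ν z‖ ≤ (N * C + 2 * C1) * (z ^ 2 * z ^ (ρ - 2)) := by
    rw [h4]
    refine (norm_sub_le _ _).trans ?_
    rw [norm_mul, ← hNd, norm_mul, norm_mul, Complex.norm_real, Real.norm_of_nonneg hz0.le]
    have a1 := hb z (by linarith)
    have a2 := hb1 z hz
    calc _ ≤ N * (C * z ^ ρ) + ‖(2 : ℂ)‖ * z * (C1 * z ^ (ρ - 1)) := by gcongr
      _ = N * C * z ^ ρ + 2 * C1 * (z * z ^ (ρ - 1)) := by rw [Complex.norm_ofNat]; ring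
      _ = _ := by rw [e3, e2]; ring
  have h6 : 3 / 4 * z ^ 2 * ‖legP2 ν z‖ ≤ (z ^ 2 - 1) * ‖legP2 ν z‖ := by
    gcongr; nlinarith
  have hz2 : 0 < z ^ 2 := by positivity
  refine le_of_mul_le_mul_left ?_ hz2
  linarith

lemma cpt_bound {f : ℝ → ℂ} (hf : ContinuousOn f (Ioi 0)) {ρ C : ℝ} (hC : 0 ≤ C)
    (hb : ∀ z : ℝ, 2 ≤ z → ‖f z‖ ≤ C * z ^ ρ) {z0 : ℝ} (hz0 : 0 < z0) :
    ∃ C', 0 ≤ C' ∧ ∀ z : ℝ, z0 ≤ z → ‖f z‖ ≤ C' * z ^ ρ := by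
  have hc : ContinuousOn (fun z : ℝ => ‖f z‖ / z ^ ρ) (Icc z0 2) := by
    refine ContinuousOn.div (hf.norm.mono fun z hz => lt_of_lt_of_le hz0 hz.1) ?_ ?_
    · intro z hz
      exact (Real.continuousAt_rpow_const z _ (Or.inl (lt_of_lt_of_le hz0 hz.1).ne')).continuousWithinAt
    · intro z hz
      exact (Real.rpow_pos_of_pos (lt_of_lt_of_le hz0 hz.1) _).ne'
  obtain ⟨K, hK⟩ := isCompact_Icc.bddAbove_image hc
  refine ⟨max C K, le_max_of_le_left hC, fun z hz => ?_⟩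
  have hp := Real.rpow_pos_of_pos (lt_of_lt_of_le hz0 hz) ρ
  rcases le_total 2 z with h | h
  · exact (hb z h).trans (by gcongr; exact le_max_left _ _)
  · have := hK ⟨z, ⟨hz, h⟩, rfl⟩
    rw [div_le_iff₀ hp] at this
    exact this.trans (by gcongr; exact le_max_right _ _)

lemma legP_bounds (ν : ℂ) {ρ : ℝ} (h1 : ν.re < ρ) (h2 : -1 - ν.re < ρ) {z0 : ℝ} (hz0 : 0 < z0) :
    ∃ C, 0 < C ∧ ∀ z : ℝ, z0 ≤ z → ‖legendreP ν z‖ ≤ C * z ^ ρ ∧ ‖legP1 ν z‖ ≤ C * z ^ (ρ - 1) ∧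
      ‖legP2 ν z‖ ≤ C * z ^ (ρ - 2) := by
  obtain ⟨A, hA, a⟩ := legP_bound0 ν h1 h2
  obtain ⟨A1, hA1, a1⟩ := legP1_bound0 ν h1 h2
  obtain ⟨A2, hA2, a2⟩ := legP2_bound0 ν h1 h2
  obtain ⟨B, hB, b⟩ := cpt_bound (legP_continuousOn ν) hA (fun z hz => a z (by linarith)) hz0
  obtain ⟨B1, hB1, b1⟩ := cpt_bound (legP1_continuousOn ν) hA1 a1 hz0
  obtain ⟨B2, hB2, b2⟩ := cpt_bound (legP2_continuousOn ν) hA2 a2 hz0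
  refine ⟨B + B1 + B2 + 1, by positivity, fun z hz => ?_⟩
  have hp : 0 < z := lt_of_lt_of_le hz0 hz
  refine ⟨(b z hz).trans ?_, (b1 z hz).trans ?_, (b2 z hz).trans ?_⟩ <;> gcongr <;> linarith

lemma cexp_deriv (c : ℂ) (τ : ℝ) :
    HasDerivAt (fun τ : ℝ => Complex.exp (c * τ)) (c * Complex.exp (c * τ)) τ := by
  have h1 : HasDerivAt (fun z : ℝ => (z : ℂ)) 1 τ := Complex.ofRealCLM.hasDerivAt
  refine ((h1.const_mul c).cexp).congr_deriv ?_
  ring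

lemma cexp_norm (c : ℂ) (τ : ℝ) : ‖Complex.exp (c * τ)‖ = Real.exp (c.re * τ) := by
  rw [Complex.norm_exp]; simp

lemma intble_exp {f : ℝ → ℂ} (hf : ContinuousOn f (Ioi 0)) {C δ : ℝ} (hδ : 0 < δ)
    (hb : ∀ τ > 0, ‖f τ‖ ≤ C * Real.exp (-δ * τ)) : IntegrableOn f (Ioi 0) := by
  refine Integrable.mono' ((exp_neg_integrableOn_Ioi 0 hδ).const_mul C)
    (hf.aestronglyMeasurable measurableSet_Ioi) ?_
  exact (ae_restrict_iff' measurableSet_Ioi).2 (Filter.Eventually.of_forall fun τ hτ => hb τ hτ)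

/-- Legendre function in exponential variable -/
noncomputable def pe (ν : ℂ) (τ : ℝ) : ℂ := legendreP ν (Real.exp τ)
/-- its derivative -/
noncomputable def pe1 (ν : ℂ) (τ : ℝ) : ℂ := (Real.exp τ : ℂ) * legP1 ν (Real.exp τ)
/-- its second derivative -/
noncomputable def pe2 (ν : ℂ) (τ : ℝ) : ℂ := (Real.exp τ : ℂ) * legP1 ν (Real.exp τ) +
  (Real.exp τ : ℂ) ^ 2 * legP2 ν (Real.exp τ)

lemma pe_deriv (ν : ℂ) (τ : ℝ) : HasDerivAt (pe ν) (pe1 ν τ) τ := by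
  have := (legP_deriv ν (Real.exp_pos τ)).scomp τ (Real.hasDerivAt_exp τ)
  refine this.congr_deriv ?_
  rw [Complex.real_smul]; rfl

lemma pe1_deriv (ν : ℂ) (τ : ℝ) : HasDerivAt (pe1 ν) (pe2 ν τ) τ := by
  have := (legP1_deriv ν (Real.exp_pos τ)).scomp τ (Real.hasDerivAt_exp τ)
  have h2 := (Real.hasDerivAt_exp τ).ofReal_comp.mul this
  refine h2.congr_deriv ?_
  rw [Complex.real_smul, pe2]
  simp only [Function.comp]; ring

lemma pe_cont (ν : ℂ) : Continuous (pe ν) :=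
  continuous_iff_continuousAt.2 fun τ => (pe_deriv ν τ).continuousAt
lemma pe1_cont (ν : ℂ) : Continuous (pe1 ν) :=
  continuous_iff_continuousAt.2 fun τ => (pe1_deriv ν τ).continuousAt

lemma pe_ode (ν : ℂ) (τ : ℝ) : (1 - Complex.exp (-2 * τ)) * (pe2 ν τ - pe1 ν τ) + 2 * pe1 ν τ =
    ν * (ν + 1) * pe ν τ := by
  have h := legP_ode ν (Real.exp_pos τ)
  have e : Complex.exp (-2 * τ) * (Real.exp τ : ℂ) ^ 2 = 1 := by
    rw [Complex.ofReal_exp, ← Complex.exp_nat_mul, ← Complex.exp_add]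
    push_cast
    rw [show (-2 * (τ : ℂ) + 2 * τ) = 0 by ring, Complex.exp_zero]
  unfold pe pe1 pe2
  rw [← h]
  linear_combination (-legP2 ν (Real.exp τ)) * e

lemma pe_bound (ν : ℂ) {ρ : ℝ} (h1 : ν.re < ρ) (h2 : -1 - ν.re < ρ) :
    ∃ C, 0 < C ∧ ∀ τ : ℝ, 0 ≤ τ → ‖pe ν τ‖ ≤ C * Real.exp (ρ * τ) ∧
      ‖pe1 ν τ‖ ≤ C * Real.exp (ρ * τ) := by
  obtain ⟨C, hC, hb⟩ := legP_bounds ν h1 h2 (z0 := 1) one_pos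
  refine ⟨C, hC, fun τ hτ => ?_⟩
  obtain ⟨a, b, -⟩ := hb (Real.exp τ) (Real.one_le_exp hτ)
  rw [← Real.exp_mul, mul_comm τ] at a
  refine ⟨a, ?_⟩
  unfold pe1
  rw [norm_mul, Complex.norm_real, Real.norm_of_nonneg (Real.exp_pos _).le]
  calc _ ≤ Real.exp τ * (C * Real.exp τ ^ (ρ - 1)) := by gcongr
    _ = C * (Real.exp τ * Real.exp (τ * (ρ - 1))) := by rw [← Real.exp_mul]; ring
    _ = _ := by rw [← Real.exp_add]; congr 2; ring

/-- The Mellin type transform -/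
noncomputable def Mel (ν s : ℂ) : ℂ := ∫ τ in Ioi (0 : ℝ), Complex.exp (-s * τ) * pe ν τ

lemma pe_bound' (ν : ℂ) {s : ℂ} (h1 : ν.re < s.re) (h2 : -1 - ν.re < s.re) :
    ∃ C δ, 0 < C ∧ 0 < δ ∧ ∀ τ : ℝ, 0 ≤ τ → ‖Complex.exp (-s * τ) * pe ν τ‖ ≤ C * Real.exp (-δ * τ) ∧
      ‖Complex.exp (-s * τ) * pe1 ν τ‖ ≤ C * Real.exp (-δ * τ) := by
  obtain ⟨ρ, hρ1, hρ2⟩ := exists_between (max_lt h1 h2)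
  obtain ⟨C, hC, hb⟩ := pe_bound ν (lt_of_le_of_lt (le_max_left _ _) hρ1)
    (lt_of_le_of_lt (le_max_right _ _) hρ1)
  refine ⟨C, s.re - ρ, hC, by linarith, fun τ hτ => ?_⟩
  have e : Real.exp (-(s.re - ρ) * τ) = Real.exp ((-s).re * τ) * Real.exp (ρ * τ) := by
    rw [← Real.exp_add, Complex.neg_re]; congr 1; ring
  obtain ⟨a, b⟩ := hb τ hτ
  rw [norm_mul, norm_mul, cexp_norm, e, mul_left_comm]
  constructor <;> gcongr

lemma Mel_int (ν : ℂ) {s : ℂ} (h1 : ν.re < s.re) (h2 : -1 - ν.re < s.re) :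
    IntegrableOn (fun τ : ℝ => Complex.exp (-s * τ) * pe ν τ) (Ioi 0) ∧
    IntegrableOn (fun τ : ℝ => Complex.exp (-s * τ) * pe1 ν τ) (Ioi 0) := by
  obtain ⟨C, δ, hC, hδ, hb⟩ := pe_bound' ν h1 h2
  have c := pe_cont ν
  have c1 := pe1_cont ν
  constructor
  · exact intble_exp (by fun_prop) hδ fun τ hτ => (hb τ (le_of_lt hτ)).1
  · exact intble_exp (by fun_prop) hδ fun τ hτ => (hb τ (le_of_lt hτ)).2

lemma exp_neg_tendsto {δ : ℝ} (hδ : 0 < δ) (C : ℝ) :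
    Filter.Tendsto (fun τ : ℝ => C * Real.exp (-δ * τ)) Filter.atTop (nhds 0) := by
  have : Filter.Tendsto (fun τ : ℝ => Real.exp (-δ * τ)) Filter.atTop (nhds 0) :=
    Real.tendsto_exp_atBot.comp (Filter.tendsto_id.const_mul_atTop_of_neg (by linarith))
  simpa using this.const_mul C

lemma Mel_tendsto (ν : ℂ) {s : ℂ} (h1 : ν.re < s.re) (h2 : -1 - ν.re < s.re) :
    Filter.Tendsto (fun τ : ℝ => Complex.exp (-s * τ) * pe ν τ) Filter.atTop (nhds 0) ∧
    Filter.Tendsto (fun τ : ℝ => Complex.exp (-s * τ) * pe1 ν τ) Filter.atTop (nhds 0) := by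
  obtain ⟨C, δ, hC, hδ, hb⟩ := pe_bound' ν h1 h2
  constructor
  · refine squeeze_zero_norm' ?_ (exp_neg_tendsto hδ C)
    filter_upwards [Filter.eventually_ge_atTop 0] with τ hτ using (hb τ hτ).1
  · refine squeeze_zero_norm' ?_ (exp_neg_tendsto hδ C)
    filter_upwards [Filter.eventually_ge_atTop 0] with τ hτ using (hb τ hτ).2

/-- auxiliary function -/
noncomputable def MG (ν s : ℂ) (τ : ℝ) : ℂ :=
  (1 - Complex.exp (-2 * τ)) * (Complex.exp (-s * τ) * pe1 ν τ + (s + 1) * (Complex.exp (-s * τ) * pe ν τ))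

lemma MG_deriv (ν s : ℂ) (τ : ℝ) : HasDerivAt (MG ν s)
    ((ν - s) * (ν + s + 1) * (Complex.exp (-s * τ) * pe ν τ) +
      (s + 1) * (s + 2) * (Complex.exp (-(s + 2) * τ) * pe ν τ)) τ := by
  have h := ((cexp_deriv (-2) τ).const_sub 1).mul (((cexp_deriv (-s) τ).mul (pe1_deriv ν τ)).add
    (((cexp_deriv (-s) τ).mul (pe_deriv ν τ)).const_mul (s + 1)))
  refine h.congr_deriv ?_
  have e : Complex.exp (-(s + 2) * τ) = Complex.exp (-2 * τ) * Complex.exp (-s * τ) := by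
    rw [← Complex.exp_add]; congr 1; ring
  rw [e]
  simp only [Pi.mul_apply, Pi.add_apply]
  linear_combination (Complex.exp (-s * τ)) * pe_ode ν τ

lemma exp2_tendsto : Filter.Tendsto (fun τ : ℝ => (1 - Complex.exp (-2 * τ))) Filter.atTop (nhds 1) := by
  have : Filter.Tendsto (fun τ : ℝ => Complex.exp (-2 * τ)) Filter.atTop (nhds 0) := by
    refine squeeze_zero_norm (fun τ => ?_) (exp_neg_tendsto (δ := 2) two_pos 1)
    rw [cexp_norm]; simp
  simpa using this.const_sub 1

lemma Mel_rec (ν : ℂ) {s : ℂ} (h1 : ν.re < s.re) (h2 : -1 - ν.re < s.re) :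
    (s - ν) * (s + ν + 1) * Mel ν s = (s + 1) * (s + 2) * Mel ν (s + 2) := by
  have i1 := (Mel_int ν h1 h2).1
  have i2 := (Mel_int ν (s := s + 2) (by simp; linarith) (by simp; linarith)).1
  have t := Mel_tendsto ν h1 h2
  have T : Filter.Tendsto (MG ν s) Filter.atTop (nhds 0) := by
    have := exp2_tendsto.mul (t.2.add (t.1.const_mul (s + 1)))
    rw [mul_zero, add_zero, mul_zero] at this
    exact this
  have H := integral_Ioi_of_hasDerivAt_of_tendsto' (a := (0 : ℝ)) (fun τ _ => MG_deriv ν s τ)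
    ((i1.const_mul _).add (i2.const_mul _)) T
  rw [integral_add (i1.const_mul _) (i2.const_mul _), integral_const_mul, integral_const_mul] at H
  have e0 : MG ν s 0 = 0 := by simp [MG]
  rw [e0] at H
  unfold Mel
  linear_combination -H

lemma Mel_s (ν : ℂ) {s : ℂ} (h1 : ν.re < s.re) (h2 : -1 - ν.re < s.re) :
    s * Mel ν s = 1 + ∫ τ in Ioi (0 : ℝ), Complex.exp (-s * τ) * pe1 ν τ := by
  have i := (Mel_int ν h1 h2)
  have t := Mel_tendsto ν h1 h2
  have hd : ∀ τ : ℝ, HasDerivAt (fun τ : ℝ => Complex.exp (-s * τ) * pe ν τ)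
      ((-s) * (Complex.exp (-s * τ) * pe ν τ) + Complex.exp (-s * τ) * pe1 ν τ) τ := by
    intro τ
    refine ((cexp_deriv (-s) τ).mul (pe_deriv ν τ)).congr_deriv ?_
    ring
  have H := integral_Ioi_of_hasDerivAt_of_tendsto' (a := (0 : ℝ)) (fun τ _ => hd τ)
    ((i.1.const_mul _).add i.2) t.1
  rw [integral_add (i.1.const_mul _) i.2, integral_const_mul] at H
  have : pe ν 0 = 1 := by simp [pe, legP_one]
  simp only [this, Complex.ofReal_zero, mul_zero, Complex.exp_zero, mul_one] at H
  unfold Mel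
  linear_combination -H

lemma Mel_lim (ν : ℂ) {s : ℂ} (h1 : ν.re < s.re) (h2 : -1 - ν.re < s.re) :
    Filter.Tendsto (fun n : ℕ => (s + 2 * n) * Mel ν (s + 2 * n)) Filter.atTop (nhds 1) := by
  have h3 : ∀ n : ℕ, (s + 2 * n) * Mel ν (s + 2 * n) =
      1 + ∫ τ in Ioi (0 : ℝ), Complex.exp (-(s + 2 * n) * τ) * pe1 ν τ := by
    intro n
    have : (s + 2 * n).re = s.re + 2 * n := by simp
    have hn : (0 : ℝ) ≤ n := by positivity
    exact Mel_s ν (by rw [this]; linarith) (by rw [this]; linarith)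
  simp_rw [h3]
  suffices Filter.Tendsto (fun n : ℕ => ∫ τ in Ioi (0 : ℝ), Complex.exp (-(s + 2 * n) * τ) * pe1 ν τ)
      Filter.atTop (nhds (∫ τ in Ioi (0 : ℝ), (0 : ℂ))) by
    simpa using this.const_add 1
  have c1 := pe1_cont ν
  have e : ∀ (n : ℕ) (τ : ℝ), Complex.exp (-(s + 2 * n) * τ) =
      Complex.exp (-2 * τ) ^ n * Complex.exp (-s * τ) := by
    intro n τ
    rw [← Complex.exp_nat_mul, ← Complex.exp_add]; congr 1; ring
  refine tendsto_integral_of_dominated_convergence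
    (fun τ => ‖Complex.exp (-s * τ) * pe1 ν τ‖) ?_ (Mel_int ν h1 h2).2.norm ?_ ?_
  · intro n
    exact Continuous.aestronglyMeasurable (by fun_prop)
  · intro n
    refine (ae_restrict_iff' measurableSet_Ioi).2 (Filter.Eventually.of_forall fun τ hτ => ?_)
    have hτ' : (0 : ℝ) < τ := hτ
    rw [e, mul_assoc, norm_mul, norm_pow, cexp_norm]
    refine mul_le_of_le_one_left (norm_nonneg _) (pow_le_one₀ (Real.exp_pos _).le ?_)
    rw [Real.exp_le_one_iff]; simp; linarith
  · refine (ae_restrict_iff' measurableSet_Ioi).2 (Filter.Eventually.of_forall fun τ hτ => ?_)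
    have hτ' : (0 : ℝ) < τ := hτ
    simp_rw [e, mul_assoc]
    have : Filter.Tendsto (fun n : ℕ => Complex.exp (-2 * τ) ^ n) Filter.atTop (nhds 0) := by
      refine tendsto_pow_atTop_nhds_zero_of_norm_lt_one ?_
      rw [cexp_norm, Real.exp_lt_one_iff]; simp; linarith
    simpa using this.mul_const (Complex.exp (-s * τ) * pe1 ν τ)

lemma Mel_iter (ν : ℂ) {s : ℂ} (h1 : ν.re < s.re) (h2 : -1 - ν.re < s.re) (n : ℕ) :
    Mel ν s * ((∏ j ∈ Finset.range n, ((s - ν) / 2 + j)) * ∏ j ∈ Finset.range n, ((s + ν + 1) / 2 + j)) =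
    ((∏ j ∈ Finset.range n, ((s + 1) / 2 + j)) * ∏ j ∈ Finset.range n, ((s + 2) / 2 + j)) *
      Mel ν (s + 2 * n) := by
  induction n with
  | zero => simp
  | succ n ih =>
    simp only [Finset.prod_range_succ]
    have : (s + 2 * n).re = s.re + 2 * n := by simp
    have hn : (0 : ℝ) ≤ n := by positivity
    have r := Mel_rec ν (s := s + 2 * n) (by rw [this]; linarith) (by rw [this]; linarith)
    have e : s + 2 * ((n + 1 : ℕ) : ℂ) = s + 2 * n + 2 := by push_cast; ring
    rw [e]
    linear_combination ((s - ν) / 2 + n) * ((s + ν + 1) / 2 + n) * ih +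
      (1 / 4) * ((∏ j ∈ Finset.range n, ((s + 1) / 2 + (j : ℂ))) * ∏ j ∈ Finset.range n, ((s + 2) / 2 + (j : ℂ))) * r

lemma prod_ne {x : ℂ} (hx : 0 < x.re) (n : ℕ) : ∏ j ∈ Finset.range n, (x + (j : ℂ)) ≠ 0 := by
  refine Finset.prod_ne_zero_iff.2 fun j _ h => ?_
  have := congrArg Complex.re h
  simp at this
  have hj : (0 : ℝ) ≤ j := by positivity
  linarith

lemma Mel_gamma (ν : ℂ) {s : ℂ} (h1 : ν.re < s.re) (h2 : -1 - ν.re < s.re) :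
    Mel ν s = Complex.Gamma ((s - ν) / 2) * Complex.Gamma ((s + ν + 1) / 2) /
      (2 * (Complex.Gamma ((s + 1) / 2) * Complex.Gamma ((s + 2) / 2))) := by
  set a := (s - ν) / 2 with ha
  set b := (s + ν + 1) / 2 with hb
  set x := (s + 1) / 2 with hx
  set y := (s + 2) / 2 with hy
  have re2 : ∀ w : ℂ, (w / 2).re = w.re / 2 := fun w => by
    rw [show w / 2 = w / ((2 : ℝ) : ℂ) by push_cast; rfl, Complex.div_ofReal_re]
  have a0 : 0 < a.re := by rw [ha, re2]; simp; linarith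
  have b0 : 0 < b.re := by rw [hb, re2]; simp; linarith
  have x0 : 0 < x.re := by rw [hx, re2]; simp; linarith
  have y0 : 0 < y.re := by rw [hy, re2]; simp; linarith
  have L := (((Complex.GammaSeq_tendsto_Gamma a).mul (Complex.GammaSeq_tendsto_Gamma b)).div
    ((Complex.GammaSeq_tendsto_Gamma x).mul (Complex.GammaSeq_tendsto_Gamma y))
    (mul_ne_zero (Complex.Gamma_ne_zero_of_re_pos x0) (Complex.Gamma_ne_zero_of_re_pos y0)))
  have L2 : Filter.Tendsto (fun n : ℕ => (n : ℂ) * Mel ν (s + 2 * ((n + 1 : ℕ) : ℂ))) Filter.atTop (nhds (1 / 2)) := by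
    have l1 := (Filter.tendsto_add_atTop_iff_nat 1).2 (Mel_lim ν h1 h2)
    have l2 : Filter.Tendsto (fun n : ℕ => (n : ℂ) / (s + 2 * ((n + 1 : ℕ) : ℂ))) Filter.atTop (nhds (1 / 2)) := by
      have : Filter.Tendsto (fun n : ℕ => (s + 2) / (n : ℂ) + 2) Filter.atTop (nhds (0 + 2)) :=
        (tendsto_const_div_atTop_nhds_zero_nat (s + 2)).add_const 2
      have := this.inv₀ (by norm_num)
      rw [show (0 + 2 : ℂ)⁻¹ = 1 / 2 by norm_num] at this
      refine this.congr' ?_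
      filter_upwards [Filter.eventually_gt_atTop 0] with n hn
      have hn' : (n : ℂ) ≠ 0 := by exact_mod_cast hn.ne'
      rw [div_add' _ _ _ hn', inv_div]; congr 1; push_cast; ring
    have := l2.mul l1
    rw [mul_one] at this
    refine this.congr fun n => ?_
    have : s + 2 * ((n + 1 : ℕ) : ℂ) ≠ 0 := by
      intro h
      have := congrArg Complex.re h
      simp at this
      have hn : (0 : ℝ) ≤ n := by positivity
      linarith
    field_simp
  have L3 := L.mul L2
  have L4 : Filter.Tendsto (fun _ : ℕ => Mel ν s) Filter.atTop (nhds (Mel ν s)) := tendsto_const_nhds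
  have E := tendsto_nhds_unique (L4.congr' ?_) L3
  · rw [E]; field_simp
  filter_upwards [Filter.eventually_gt_atTop 0] with n hn
  have hn' : (n : ℂ) ≠ 0 := by exact_mod_cast hn.ne'
  have it := Mel_iter ν h1 h2 (n + 1)
  rw [← ha, ← hb, ← hx, ← hy] at it
  simp only [Pi.div_apply, Pi.mul_apply, Complex.GammaSeq]
  have pa := prod_ne a0 (n + 1)
  have pb := prod_ne b0 (n + 1)
  have px := prod_ne x0 (n + 1)
  have py := prod_ne y0 (n + 1)
  have hf : (n.factorial : ℂ) ≠ 0 := by exact_mod_cast n.factorial_ne_zero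
  have hp : (n : ℂ) ^ a * (n : ℂ) ^ b * n = (n : ℂ) ^ x * (n : ℂ) ^ y := by
    nth_rw 3 [← Complex.cpow_one (n : ℂ)]
    rw [← Complex.cpow_add _ _ hn', ← Complex.cpow_add _ _ hn', ← Complex.cpow_add _ _ hn']
    congr 1; rw [ha, hb, hx, hy]; ring
  have nx : (n : ℂ) ^ x ≠ 0 := by simp [Complex.cpow_eq_zero_iff, hn']
  have ny : (n : ℂ) ^ y ≠ 0 := by simp [Complex.cpow_eq_zero_iff, hn']
  set Pa := ∏ j ∈ Finset.range (n + 1), (a + (j : ℂ))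
  set Pb := ∏ j ∈ Finset.range (n + 1), (b + (j : ℂ))
  set Px := ∏ j ∈ Finset.range (n + 1), (x + (j : ℂ))
  set Py := ∏ j ∈ Finset.range (n + 1), (y + (j : ℂ))
  set m := Mel ν (s + 2 * ((n + 1 : ℕ) : ℂ))
  have : Mel ν s = Px * Py * m / (Pa * Pb) := by
    rw [eq_div_iff (mul_ne_zero pa pb), it]
  rw [this]
  set na := (n : ℂ) ^ a
  set nb := (n : ℂ) ^ b
  set nx' := (n : ℂ) ^ x
  set ny' := (n : ℂ) ^ y
  field_simp
  linear_combination (-m) * hp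

lemma Mel_ne_zero (ν : ℂ) {s : ℂ} (h1 : ν.re < s.re) (h2 : -1 - ν.re < s.re) : Mel ν s ≠ 0 := by
  have re2 : ∀ w : ℂ, (w / 2).re = w.re / 2 := fun w => by
    rw [show w / 2 = w / ((2 : ℝ) : ℂ) by push_cast; rfl, Complex.div_ofReal_re]
  rw [Mel_gamma ν h1 h2]
  refine div_ne_zero (mul_ne_zero ?_ ?_) (mul_ne_zero two_ne_zero (mul_ne_zero ?_ ?_)) <;>
  · apply Complex.Gamma_ne_zero_of_re_pos
    rw [re2]; simp; linarith

lemma Mel_dup (ν : ℂ) {s : ℂ} (h1 : ν.re < s.re) (h2 : -1 - ν.re < s.re) :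
    Mel ν s * (2 * Real.sqrt Real.pi * Complex.Gamma (s + 1)) =
      2 ^ s * Complex.Gamma ((s - ν) / 2) * Complex.Gamma ((s + ν + 1) / 2) := by
  have d := Complex.Gamma_mul_Gamma_add_half ((s + 1) / 2)
  rw [show (s + 1) / 2 + 1 / 2 = (s + 2) / 2 by ring, show 2 * ((s + 1) / 2) = s + 1 by ring,
    show 1 - (s + 1) = -s by ring] at d
  have hg : Complex.Gamma (s + 1) ≠ 0 := Complex.Gamma_ne_zero_of_re_pos (by simp; linarith)
  have hp : ((Real.sqrt Real.pi : ℝ) : ℂ) ≠ 0 := by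
    exact_mod_cast (Real.sqrt_pos.2 Real.pi_pos).ne'
  have h2s : (2 : ℂ) ^ s ≠ 0 := by simp [Complex.cpow_eq_zero_iff]
  rw [Mel_gamma ν h1 h2, d, Complex.cpow_neg]
  field_simp

lemma MG_lim (ν : ℂ) (hν : -1 / 2 < ν.re) : ∃ l : ℂ, l ≠ 0 ∧
    Filter.Tendsto (fun τ : ℝ => Complex.exp (-ν * τ) * pe1 ν τ + (ν + 1) * (Complex.exp (-ν * τ) * pe ν τ))
      Filter.atTop (nhds l) := by
  have re1 : (ν + 2).re = ν.re + 2 := by simp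
  have i2 := (Mel_int ν (s := ν + 2) (by rw [re1]; linarith) (by rw [re1]; linarith)).1
  have m0 := Mel_ne_zero ν (s := ν + 2) (by rw [re1]; linarith) (by rw [re1]; linarith)
  have n1 : ν + 1 ≠ 0 := fun h => by
    have := congrArg Complex.re h; simp at this; linarith
  have n2 : ν + 2 ≠ 0 := fun h => by
    have := congrArg Complex.re h; simp at this; linarith
  refine ⟨(ν + 1) * (ν + 2) * Mel ν (ν + 2), by positivity, ?_⟩
  have hd : ∀ τ : ℝ, HasDerivAt (MG ν ν) ((ν + 1) * (ν + 2) * (Complex.exp (-(ν + 2) * τ) * pe ν τ)) τ := by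
    intro τ
    refine (MG_deriv ν ν τ).congr_deriv ?_
    ring
  have hi : IntegrableOn (fun τ : ℝ => (ν + 1) * (ν + 2) * (Complex.exp (-(ν + 2) * τ) * pe ν τ)) (Ioi 0) :=
    i2.const_mul _
  have T := tendsto_limUnder_of_hasDerivAt_of_integrableOn_Ioi (a := (0 : ℝ)) (fun τ _ => hd τ) hi
  have H := integral_Ioi_of_hasDerivAt_of_tendsto' (a := (0 : ℝ)) (fun τ _ => hd τ) hi T
  have e0 : MG ν ν 0 = 0 := by simp [MG]
  rw [e0, sub_zero, integral_const_mul] at H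
  rw [← H] at T
  have T2 := (exp2_tendsto.inv₀ one_ne_zero).mul T
  rw [inv_one, one_mul] at T2
  refine T2.congr' ?_
  filter_upwards [Filter.eventually_gt_atTop 0] with τ hτ
  have : (1 - Complex.exp (-2 * τ)) ≠ 0 := by
    intro h
    have : ‖Complex.exp (-2 * τ)‖ = 1 := by rw [← sub_eq_zero.1 h]; simp
    rw [cexp_norm, Real.exp_eq_one_iff] at this
    simp at this; linarith
  unfold MG
  rw [← mul_assoc, inv_mul_cancel₀ this, one_mul]

lemma pe_asymp (ν : ℂ) (hν : -1 / 2 < ν.re) : ∃ S : ℂ, S ≠ 0 ∧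
    Filter.Tendsto (fun τ : ℝ => Complex.exp (-ν * τ) * pe ν τ) Filter.atTop (nhds S) := by
  obtain ⟨l, hl, T⟩ := MG_lim ν hν
  have hk : (2 * ν + 1) ≠ 0 := fun h => by
    have := congrArg Complex.re h; simp at this; linarith
  set k := (2 * ν + 1).re with hkd
  have hk0 : 0 < k := by rw [hkd]; simp; linarith
  refine ⟨l / (2 * ν + 1), div_ne_zero hl hk, ?_⟩
  set h : ℝ → ℂ := fun τ => Complex.exp ((ν + 1) * τ) * pe ν τ - l / (2 * ν + 1) * Complex.exp ((2 * ν + 1) * τ) with hh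
  set q : ℝ → ℂ := fun τ => Complex.exp (-ν * τ) * pe1 ν τ + (ν + 1) * (Complex.exp (-ν * τ) * pe ν τ) with hq
  have hd : ∀ τ : ℝ, HasDerivAt h (Complex.exp ((2 * ν + 1) * τ) * (q τ - l)) τ := by
    intro τ
    refine (((cexp_deriv (ν + 1) τ).mul (pe_deriv ν τ)).sub
      ((cexp_deriv (2 * ν + 1) τ).const_mul (l / (2 * ν + 1)))).congr_deriv ?_
    have e : Complex.exp ((ν + 1) * τ) = Complex.exp ((2 * ν + 1) * τ) * Complex.exp (-ν * τ) := by
      rw [← Complex.exp_add]; congr 1; ring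
    have e2 : ∀ E : ℂ, l / (2 * ν + 1) * ((2 * ν + 1) * E) = l * E := fun E => by field_simp
    rw [e2, e]
    simp only [hq]
    ring
  rw [tendsto_iff_norm_sub_tendsto_zero]
  have e : ∀ τ : ℝ, ‖Complex.exp (-ν * τ) * pe ν τ - l / (2 * ν + 1)‖ = Real.exp (-k * τ) * ‖h τ‖ := by
    intro τ
    have : Complex.exp (-ν * τ) * pe ν τ - l / (2 * ν + 1) = Complex.exp (-(2 * ν + 1) * τ) * h τ := by
      simp only [hh]
      rw [mul_sub, ← mul_assoc, ← Complex.exp_add, mul_left_comm, ← Complex.exp_add]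
      rw [show -(2 * ν + 1) * (τ : ℂ) + (ν + 1) * τ = -ν * τ by ring,
        show -(2 * ν + 1) * (τ : ℂ) + (2 * ν + 1) * τ = 0 by ring, Complex.exp_zero, mul_one]
    rw [this, norm_mul, cexp_norm, Complex.neg_re]
  simp_rw [e]
  rw [Metric.tendsto_atTop]
  intro ε hε
  have T' := (Metric.tendsto_atTop.1 T) (ε * k / 2) (by positivity)
  obtain ⟨T0, hT0⟩ := T'
  have bd : ∀ τ ≥ T0, ‖h τ‖ ≤ ‖h T0‖ + ε / 2 * Real.exp (k * τ) := by
    intro τ hτ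
    refine image_norm_le_of_norm_deriv_right_le_deriv_boundary' (a := T0) (b := τ) (f := h)
      (f' := fun τ => Complex.exp ((2 * ν + 1) * τ) * (q τ - l))
      (B := fun τ => ‖h T0‖ + ε / 2 * Real.exp (k * τ)) (B' := fun τ => ε / 2 * (k * Real.exp (k * τ)))
      ?_ ?_ ?_ ?_ ?_ ?_ ⟨hτ, le_rfl⟩
    · exact fun x _ => (hd x).continuousAt.continuousWithinAt
    · exact fun x _ => (hd x).hasDerivWithinAt
    · have := Real.exp_pos (k * T0)
      have : 0 ≤ ε / 2 * Real.exp (k * T0) := by positivity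
      linarith
    · exact Continuous.continuousOn (by fun_prop)
    · intro x _
      have := ((hasDerivAt_id x).const_mul k).exp
      refine (((this.const_mul (ε / 2)).const_add ‖h T0‖).congr_deriv ?_).hasDerivWithinAt
      simp only [id, mul_one]; ring
    · intro x hx
      have := hT0 x hx.1
      rw [dist_eq_norm] at this
      rw [norm_mul, cexp_norm, ← hkd]
      have : Real.exp (k * x) * ‖q x - l‖ ≤ Real.exp (k * x) * (ε * k / 2) := by gcongr
      linarith
  have T3 := exp_neg_tendsto hk0 ‖h T0‖
  obtain ⟨T1, hT1⟩ := (Metric.tendsto_atTop.1 T3) (ε / 2) (by positivity)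
  refine ⟨max T0 T1, fun τ hτ => ?_⟩
  have a := bd τ ((le_max_left _ _).trans hτ)
  have b := hT1 τ ((le_max_right _ _).trans hτ)
  rw [dist_zero_right, Real.norm_of_nonneg (by positivity)] at b ⊢
  have e2 : Real.exp (-k * τ) * Real.exp (k * τ) = 1 := by
    rw [← Real.exp_add]; simp
  calc _ ≤ Real.exp (-k * τ) * (‖h T0‖ + ε / 2 * Real.exp (k * τ)) := by gcongr
    _ = ‖h T0‖ * Real.exp (-k * τ) + ε / 2 * (Real.exp (-k * τ) * Real.exp (k * τ)) := by ring
    _ < _ := by rw [e2]; linarith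

lemma legP_lower (ν : ℂ) (hν : -1 / 2 < ν.re) : ∃ c Z : ℝ, 0 < c ∧ 0 < Z ∧ ∀ z ≥ Z,
    c * z ^ ν.re ≤ ‖legendreP ν z‖ := by
  obtain ⟨S, hS, T⟩ := pe_asymp ν hν
  have hS' : 0 < ‖S‖ := norm_pos_iff.2 hS
  have := T.norm.eventually_const_lt (half_lt_self hS')
  obtain ⟨T0, h0⟩ := Filter.eventually_atTop.1 this
  refine ⟨‖S‖ / 2, Real.exp T0, half_pos hS', Real.exp_pos _, fun z hz => ?_⟩
  have hz0 : 0 < z := (Real.exp_pos _).trans_le hz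
  have := h0 (Real.log z) ((Real.le_log_iff_exp_le hz0).2 hz)
  rw [norm_mul, cexp_norm, pe, Real.exp_log hz0] at this
  have e : z ^ ν.re = Real.exp (ν.re * Real.log z) := by
    rw [Real.rpow_def_of_pos hz0, mul_comm]
  have e2 : Real.exp ((-ν).re * Real.log z) * Real.exp (ν.re * Real.log z) = 1 := by
    rw [← Real.exp_add]; simp
  rw [e]
  calc _ ≤ (Real.exp ((-ν).re * Real.log z) * ‖legendreP ν z‖) * Real.exp (ν.re * Real.log z) := by gcongr
    _ = ‖legendreP ν z‖ * (Real.exp ((-ν).re * Real.log z) * Real.exp (ν.re * Real.log z)) := by ring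
    _ = _ := by rw [e2, mul_one]

/-- the kernel argument -/
noncomputable def bb (y p q : ℝ) : ℝ :=
  (Real.cosh p ^ 2 + Real.cosh q ^ 2 + Real.sinh y ^ 2) / (2 * Real.cosh y * Real.cosh p * Real.cosh q)
/-- first partial -/
noncomputable def bb1 (y p q : ℝ) : ℝ :=
  Real.sinh p * (Real.cosh p ^ 2 - Real.cosh q ^ 2 - Real.sinh y ^ 2) /
    (2 * Real.cosh y * Real.cosh p ^ 2 * Real.cosh q)
/-- second partial -/
noncomputable def bb11 (y p q : ℝ) : ℝ :=
  (Real.cosh p ^ 4 - (Real.cosh q ^ 2 + Real.sinh y ^ 2) * (Real.cosh p ^ 2 - 2 * Real.sinh p ^ 2)) /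
    (2 * Real.cosh y * Real.cosh p ^ 3 * Real.cosh q)
/-- mixed partial -/
noncomputable def bb13 (y p q : ℝ) : ℝ :=
  Real.sinh p * Real.sinh q * (Real.sinh y ^ 2 - Real.cosh p ^ 2 - Real.cosh q ^ 2) /
    (2 * Real.cosh y * Real.cosh p ^ 2 * Real.cosh q ^ 2)

lemma bb_symm (y p q : ℝ) : bb y p q = bb y q p := by unfold bb; congr 1 <;> ring
lemma bb13_symm (y p q : ℝ) : bb13 y p q = bb13 y q p := by unfold bb13; congr 1 <;> ring

lemma bb_deriv (y : ℝ) {p q : ℝ → ℝ} {e f r : ℝ} (hp : HasDerivAt p e r) (hq : HasDerivAt q f r) :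
    HasDerivAt (fun r => bb y (p r) (q r)) (bb1 y (p r) (q r) * e + bb1 y (q r) (p r) * f) r := by
  have c2 := Real.cosh_pos y
  have c1 := Real.cosh_pos (p r)
  have c3 := Real.cosh_pos (q r)
  have h := (((hp.cosh.pow 2).add (hq.cosh.pow 2)).add_const (Real.sinh y ^ 2)).div
    ((hp.cosh.const_mul (2 * Real.cosh y)).mul hq.cosh)
      (show (2 * Real.cosh y * Real.cosh (p r)) * Real.cosh (q r) ≠ 0 by positivity)
  refine h.congr_deriv ?_
  unfold bb1
  simp only [Pi.mul_apply, Pi.add_apply, Pi.pow_apply]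
  field_simp
  push_cast
  ring

lemma bb1_deriv (y : ℝ) {p q : ℝ → ℝ} {e f r : ℝ} (hp : HasDerivAt p e r) (hq : HasDerivAt q f r) :
    HasDerivAt (fun r => bb1 y (p r) (q r)) (bb11 y (p r) (q r) * e + bb13 y (p r) (q r) * f) r := by
  have c2 := Real.cosh_pos y
  have c1 := Real.cosh_pos (p r)
  have c3 := Real.cosh_pos (q r)
  have h := (hp.sinh.mul (((hp.cosh.pow 2).sub (hq.cosh.pow 2)).sub_const (Real.sinh y ^ 2))).div
    (((hp.cosh.pow 2).const_mul (2 * Real.cosh y)).mul hq.cosh)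
      (show (2 * Real.cosh y * Real.cosh (p r) ^ 2) * Real.cosh (q r) ≠ 0 by positivity)
  refine h.congr_deriv ?_
  unfold bb11 bb13
  simp only [Pi.mul_apply, Pi.sub_apply, Pi.pow_apply]
  field_simp
  push_cast
  ring

lemma bb_id1 (y p q : ℝ) : bb1 y p q ^ 2 - bb1 y q p ^ 2 =
    (1 / Real.cosh q ^ 2 - 1 / Real.cosh p ^ 2) * (bb y p q ^ 2 - 1) := by
  have c2 := Real.cosh_pos y
  have c1 := Real.cosh_pos p
  have c3 := Real.cosh_pos q
  unfold bb bb1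
  have h1 := Real.sinh_sq p
  have h2 := Real.sinh_sq q
  have h3 := Real.sinh_sq y
  simp only [div_pow, mul_pow]
  rw [h1, h2, h3]
  field_simp
  ring

lemma bb_id2 (y p q : ℝ) : bb11 y p q - bb11 y q p =
    2 * bb y p q * (1 / Real.cosh q ^ 2 - 1 / Real.cosh p ^ 2) := by
  have c2 := Real.cosh_pos y
  have c1 := Real.cosh_pos p
  have c3 := Real.cosh_pos q
  unfold bb bb11
  rw [Real.sinh_sq p, Real.sinh_sq q, Real.sinh_sq y]
  field_simp
  ring

lemma bb_pos (y p q : ℝ) : 0 < bb y p q := by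
  have c2 := Real.cosh_pos y
  have c1 := Real.cosh_pos p
  have c3 := Real.cosh_pos q
  unfold bb; positivity

lemma abs_sinh_le_cosh (x : ℝ) : |Real.sinh x| ≤ Real.cosh x := by
  rw [← Real.cosh_abs, Real.abs_sinh]; exact (Real.sinh_lt_cosh _).le

lemma bb1_le (y p q : ℝ) : |bb1 y p q| ≤ bb y p q := by
  have c2 := Real.cosh_pos y
  have c1 := Real.cosh_pos p
  have c3 := Real.cosh_pos q
  have e : bb y p q = Real.cosh p * (Real.cosh p ^ 2 + Real.cosh q ^ 2 + Real.sinh y ^ 2) /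
      (2 * Real.cosh y * Real.cosh p ^ 2 * Real.cosh q) := by
    unfold bb; field_simp
  rw [e]
  unfold bb1
  rw [abs_div, abs_of_pos (show 0 < 2 * Real.cosh y * Real.cosh p ^ 2 * Real.cosh q by positivity), abs_mul]
  gcongr
  · exact abs_sinh_le_cosh p
  · rw [abs_le]; constructor <;> nlinarith [sq_nonneg (Real.sinh y)]

lemma bb11_le (y p q : ℝ) : |bb11 y p q| ≤ 3 * bb y p q := by
  have c2 := Real.cosh_pos y
  have c1 := Real.cosh_pos p
  have c3 := Real.cosh_pos q
  have e : 3 * bb y p q = (3 * Real.cosh p ^ 2 * (Real.cosh p ^ 2 + Real.cosh q ^ 2 + Real.sinh y ^ 2)) /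
      (2 * Real.cosh y * Real.cosh p ^ 3 * Real.cosh q) := by
    unfold bb; field_simp
  rw [e]
  unfold bb11
  rw [abs_div, abs_of_pos (show 0 < 2 * Real.cosh y * Real.cosh p ^ 3 * Real.cosh q by positivity)]
  gcongr
  rw [Real.sinh_sq p]
  have k := sq_nonneg (Real.sinh y)
  have h1 : 0 ≤ (Real.cosh q ^ 2 + Real.sinh y ^ 2) := by positivity
  have h2 : 1 ≤ Real.cosh p ^ 2 := by nlinarith [Real.one_le_cosh p]
  rw [abs_le]; constructor <;> nlinarith [mul_nonneg h1 (sub_nonneg.2 h2), pow_nonneg c1.le 4]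

lemma bb13_le (y p q : ℝ) : |bb13 y p q| ≤ bb y p q := by
  have c2 := Real.cosh_pos y
  have c1 := Real.cosh_pos p
  have c3 := Real.cosh_pos q
  have e : bb y p q = Real.cosh p * Real.cosh q * (Real.cosh p ^ 2 + Real.cosh q ^ 2 + Real.sinh y ^ 2) /
      (2 * Real.cosh y * Real.cosh p ^ 2 * Real.cosh q ^ 2) := by
    unfold bb; field_simp
  rw [e]
  unfold bb13
  rw [abs_div, abs_of_pos (show 0 < 2 * Real.cosh y * Real.cosh p ^ 2 * Real.cosh q ^ 2 by positivity),
    abs_mul, abs_mul]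
  gcongr
  · exact abs_sinh_le_cosh p
  · exact abs_sinh_le_cosh q
  · rw [abs_le]; constructor <;> nlinarith [sq_nonneg (Real.sinh y)]

/-- derivative along the diagonal direction -/
noncomputable def dB (y p q : ℝ) : ℝ := bb1 y p q + bb1 y q p

lemma dB_eq (y p q : ℝ) : dB y p q = Real.sinh (p + q) * (Real.sinh (q - p + y) * Real.sinh (q - p - y)) /
    (2 * Real.cosh y * Real.cosh p ^ 2 * Real.cosh q ^ 2) := by
  have c2 := Real.cosh_pos y
  have c1 := Real.cosh_pos p
  have c3 := Real.cosh_pos q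
  have e : Real.sinh (q - p + y) * Real.sinh (q - p - y) = Real.sinh (q - p) ^ 2 - Real.sinh y ^ 2 := by
    rw [Real.sinh_add, Real.sinh_sub (q - p) y]
    have h1 := Real.cosh_sq (q - p)
    have h2 := Real.cosh_sq y
    linear_combination Real.sinh (q - p) ^ 2 * h2 - Real.sinh y ^ 2 * h1
  rw [e, Real.sinh_sub, Real.sinh_add]
  unfold dB bb1
  have h1 := Real.sinh_sq p
  have h2 := Real.sinh_sq q
  have e3 : (Real.sinh q * Real.cosh p - Real.cosh q * Real.sinh p) *
      (Real.sinh p * Real.cosh q + Real.cosh p * Real.sinh q) = Real.cosh q ^ 2 - Real.cosh p ^ 2 := by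
    linear_combination Real.cosh p ^ 2 * h2 - Real.cosh q ^ 2 * h1
  rw [div_add_div _ _ (by positivity) (by positivity), div_eq_div_iff (by positivity) (by positivity)]
  linear_combination (-4 * Real.cosh y ^ 2 * Real.cosh p ^ 3 * Real.cosh q ^ 3 *
    (Real.sinh q * Real.cosh p - Real.cosh q * Real.sinh p)) * e3

lemma bb_swap (y p q : ℝ) : bb y p q = bb p y q := by
  unfold bb
  rw [Real.sinh_sq, Real.sinh_sq]
  congr 1 <;> ring

lemma cosh_add_le (a b : ℝ) : Real.cosh (a + b) ≤ Real.cosh a * Real.exp |b| := by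
  have h1 := abs_sinh_le_cosh a
  have hc := Real.cosh_pos a
  have h2 : Real.sinh a * Real.sinh b ≤ Real.cosh a * Real.sinh |b| := by
    rw [← Real.abs_sinh]
    calc _ ≤ |Real.sinh a * Real.sinh b| := le_abs_self _
      _ = |Real.sinh a| * |Real.sinh b| := abs_mul _ _
      _ ≤ _ := by gcongr
  rw [Real.cosh_add, ← Real.cosh_add_sinh |b|, Real.cosh_abs, mul_add]
  linarith

lemma half_exp_le_cosh (x : ℝ) : Real.exp x / 2 ≤ Real.cosh x := by
  rw [Real.cosh_eq]; have := Real.exp_pos (-x); linarith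

lemma abs_sinh_le_exp {x z : ℝ} (h : |x| ≤ z) : |Real.sinh x| ≤ Real.exp z := by
  rw [Real.abs_sinh]
  refine le_trans ?_ (Real.exp_le_exp.2 h)
  rw [Real.sinh_eq]
  have := Real.exp_pos (-|x|)
  have := Real.exp_pos (|x|)
  linarith

lemma bb_split (y p q : ℝ) : bb y p q = (Real.cosh p / Real.cosh q + Real.cosh q / Real.cosh p +
    Real.sinh y ^ 2 / (Real.cosh p * Real.cosh q)) / (2 * Real.cosh y) := by
  have c2 := Real.cosh_pos y
  have c1 := Real.cosh_pos p
  have c3 := Real.cosh_pos q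
  unfold bb; field_simp

lemma bb_lower (y T : ℝ) : ∃ m, 0 < m ∧ ∀ t ≥ T, ∀ τ, Real.exp τ ≤ m * bb y t (t + y + τ) := by
  refine ⟨4 * Real.cosh y * Real.exp (-y) * ((1 + Real.exp (-2 * T)) / 2), ?_, fun t ht τ => ?_⟩
  · have c2 := Real.cosh_pos y
    positivity
  have c2 := Real.cosh_pos y
  have c1 := Real.cosh_pos t
  have c3 := Real.cosh_pos (t + y + τ)
  have h1 : Real.cosh t ≤ Real.exp t * ((1 + Real.exp (-2 * T)) / 2) := by
    have : Real.exp (-t) ≤ Real.exp t * Real.exp (-2 * T) := by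
      rw [← Real.exp_add]; apply Real.exp_le_exp.2; linarith
    rw [Real.cosh_eq]; linarith
  have h2 := half_exp_le_cosh (t + y + τ)
  have h3 : Real.cosh (t + y + τ) / Real.cosh t ≤ 2 * Real.cosh y * bb y t (t + y + τ) := by
    rw [bb_split, mul_div_cancel₀ _ (by positivity)]
    have : 0 ≤ Real.cosh t / Real.cosh (t + y + τ) := by positivity
    have : 0 ≤ Real.sinh y ^ 2 / (Real.cosh t * Real.cosh (t + y + τ)) := by positivity
    linarith
  set κ := (1 + Real.exp (-2 * T)) / 2
  have hκ : 0 < κ := by positivity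
  have h4 : Real.exp τ ≤ 2 * Real.exp (-y) * κ * (Real.cosh (t + y + τ) / Real.cosh t) := by
    rw [← mul_div_assoc, le_div_iff₀ c1]
    calc Real.exp τ * Real.cosh t ≤ Real.exp τ * (Real.exp t * κ) := by gcongr
      _ = 2 * Real.exp (-y) * κ * (Real.exp (t + y + τ) / 2) := by
        rw [Real.exp_add, Real.exp_add, Real.exp_neg]; field_simp
      _ ≤ _ := by gcongr
  calc _ ≤ _ := h4
    _ ≤ 2 * Real.exp (-y) * κ * (2 * Real.cosh y * bb y t (t + y + τ)) := by gcongr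
    _ = _ := by ring

lemma bb_upper (y : ℝ) : ∃ M, 0 < M ∧ ∀ t : ℝ, ∀ τ ≥ 0, bb y t (t + y + τ) ≤ M * Real.exp τ := by
  refine ⟨2 * Real.exp |y| + Real.sinh y ^ 2, by positivity, fun t τ hτ => ?_⟩
  have c2 := Real.one_le_cosh y
  have c1 := Real.one_le_cosh t
  have c3 := Real.one_le_cosh (t + y + τ)
  have hab : |y + τ| ≤ |y| + τ := (abs_add_le _ _).trans (by rw [abs_of_nonneg hτ])
  have e : Real.exp (|y| + τ) = Real.exp |y| * Real.exp τ := Real.exp_add _ _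
  have h1 : Real.cosh (t + y + τ) / Real.cosh t ≤ Real.exp |y| * Real.exp τ := by
    rw [div_le_iff₀ (by linarith), ← e, mul_comm, add_assoc]
    exact (cosh_add_le _ _).trans (by gcongr)
  have h2 : Real.cosh t / Real.cosh (t + y + τ) ≤ Real.exp |y| * Real.exp τ := by
    rw [div_le_iff₀ (by linarith), ← e, mul_comm]
    have := cosh_add_le (t + y + τ) (-(y + τ))
    rw [abs_neg, show t + y + τ + -(y + τ) = t by ring] at this
    exact this.trans (by gcongr)
  have hτ1 := Real.one_le_exp hτ
  have h3 : Real.sinh y ^ 2 / (Real.cosh t * Real.cosh (t + y + τ)) ≤ Real.sinh y ^ 2 * Real.exp τ := by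
    have : 1 ≤ Real.cosh t * Real.cosh (t + y + τ) := by nlinarith
    calc _ ≤ Real.sinh y ^ 2 := div_le_self (sq_nonneg _) this
      _ ≤ _ := le_mul_of_one_le_right (sq_nonneg _) hτ1
  rw [bb_split, div_le_iff₀ (by linarith)]
  have h4 : 0 ≤ (2 * Real.exp |y| + Real.sinh y ^ 2) * Real.exp τ := by positivity
  nlinarith

lemma dB_upper (y : ℝ) : ∃ M, 0 < M ∧ ∀ t : ℝ, ∀ τ ≥ 0,
    |dB y t (t + y + τ)| ≤ M * (Real.exp τ * Real.exp (-2 * t)) := by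
  refine ⟨4 * Real.exp (2 * |y| - y), by positivity, fun t τ hτ => ?_⟩
  have c2 := Real.one_le_cosh y
  have c1 := Real.cosh_pos t
  have c3 := Real.cosh_pos (t + y + τ)
  have h1 : |Real.sinh (t + (t + y + τ))| ≤ 2 * (Real.cosh t * Real.cosh (t + y + τ)) := by
    refine (abs_sinh_le_cosh _).trans ?_
    rw [Real.cosh_add]
    have a := abs_sinh_le_cosh t
    have b := abs_sinh_le_cosh (t + y + τ)
    have : Real.sinh t * Real.sinh (t + y + τ) ≤ Real.cosh t * Real.cosh (t + y + τ) := by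
      calc _ ≤ |Real.sinh t * Real.sinh (t + y + τ)| := le_abs_self _
        _ = |Real.sinh t| * |Real.sinh (t + y + τ)| := abs_mul _ _
        _ ≤ _ := by gcongr
    linarith
  have h2 : |Real.sinh (t + y + τ - t + y)| ≤ Real.exp (2 * |y| + τ) := by
    apply abs_sinh_le_exp
    rw [show t + y + τ - t + y = 2 * y + τ by ring]
    refine (abs_add_le _ _).trans ?_
    rw [abs_mul, abs_of_nonneg hτ]; simp
  have h3 : |Real.sinh (t + y + τ - t - y)| ≤ Real.exp τ := by
    apply abs_sinh_le_exp
    rw [show t + y + τ - t - y = τ by ring, abs_of_nonneg hτ]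
  rw [dB_eq, abs_div, abs_mul, abs_mul,
    abs_of_pos (show 0 < 2 * Real.cosh y * Real.cosh t ^ 2 * Real.cosh (t + y + τ) ^ 2 by positivity)]
  rw [div_le_iff₀ (by positivity)]
  have e1 := half_exp_le_cosh t
  have e2 := half_exp_le_cosh (t + y + τ)
  have h4 : Real.exp t / 2 * (Real.exp (t + y + τ) / 2) ≤ Real.cosh t * Real.cosh (t + y + τ) := by gcongr
  set cc := Real.cosh t * Real.cosh (t + y + τ) with hcc
  have hcc0 : 0 < cc := by positivity
  calc _ ≤ 2 * cc * (Real.exp (2 * |y| + τ) * Real.exp τ) := by gcongr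
    _ = 8 * Real.exp (2 * |y| - y) * (Real.exp τ * Real.exp (-2 * t)) * cc *
        (Real.exp t / 2 * (Real.exp (t + y + τ) / 2)) := by
      have : Real.exp (2 * |y| + τ) * Real.exp τ = Real.exp (2 * |y| - y) * (Real.exp τ * Real.exp (-2 * t)) *
         (Real.exp t * Real.exp (t + y + τ)) := by
        simp only [← Real.exp_add]; congr 1; ring
      rw [this]; ring
    _ ≤ 8 * Real.exp (2 * |y| - y) * (Real.exp τ * Real.exp (-2 * t)) * cc * (Real.cosh y * cc) := by
      refine mul_le_mul_of_nonneg_left (h4.trans (le_mul_of_one_le_left hcc0.le c2)) (by positivity)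
    _ = _ := by rw [hcc]; ring

/-- second derivative along the diagonal -/
noncomputable def d2B (y p q : ℝ) : ℝ := bb11 y p q + 2 * bb13 y p q + bb11 y q p

lemma d2B_le (y p q : ℝ) : |d2B y p q| ≤ 8 * bb y p q := by
  have h1 := abs_le.1 (bb11_le y p q)
  have h2 := abs_le.1 (bb13_le y p q)
  have h3 := abs_le.1 (bb11_le y q p)
  rw [← bb_symm y p q] at h3
  unfold d2B
  rw [abs_le]; constructor <;> linarith [h1.1, h1.2, h2.1, h2.2, h3.1, h3.2]

lemma dB_le (y p q : ℝ) : |dB y p q| ≤ 2 * bb y p q := by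
  have h1 := abs_le.1 (bb1_le y p q)
  have h3 := abs_le.1 (bb1_le y q p)
  rw [← bb_symm y p q] at h3
  unfold dB
  rw [abs_le]; constructor <;> linarith [h1.1, h1.2, h3.1, h3.2]

/-- the kernel -/
noncomputable def KK (ν : ℂ) (y t τ : ℝ) : ℂ := legendreP ν (bb y t (t + y + τ))
/-- its t derivative -/
noncomputable def KK1 (ν : ℂ) (y t τ : ℝ) : ℂ :=
  (dB y t (t + y + τ) : ℂ) * legP1 ν (bb y t (t + y + τ))
/-- its second t derivative -/
noncomputable def KK2 (ν : ℂ) (y t τ : ℝ) : ℂ :=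
  (dB y t (t + y + τ) : ℂ) ^ 2 * legP2 ν (bb y t (t + y + τ)) +
    (d2B y t (t + y + τ) : ℂ) * legP1 ν (bb y t (t + y + τ))
/-- its mixed derivative -/
noncomputable def KK1t (ν : ℂ) (y t τ : ℝ) : ℂ :=
  (dB y t (t + y + τ) : ℂ) * (bb1 y (t + y + τ) t : ℂ) * legP2 ν (bb y t (t + y + τ)) +
    ((bb13 y t (t + y + τ) + bb11 y (t + y + τ) t : ℝ) : ℂ) * legP1 ν (bb y t (t + y + τ))

lemma t3_dt (y τ t : ℝ) : HasDerivAt (fun t : ℝ => t + y + τ) 1 t :=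
  ((hasDerivAt_id t).add_const y).add_const τ
lemma t3_dτ (y τ t : ℝ) : HasDerivAt (fun τ : ℝ => t + y + τ) 1 τ :=
  (hasDerivAt_id τ).const_add (t + y)

lemma KK_dt (ν : ℂ) (y t τ : ℝ) : HasDerivAt (fun t => KK ν y t τ) (KK1 ν y t τ) t := by
  have h1 := bb_deriv y (hasDerivAt_id t) (t3_dt y τ t)
  have h2 := (legP_deriv ν (bb_pos y t (t + y + τ))).scomp t h1
  refine h2.congr_deriv ?_
  rw [Complex.real_smul]
  simp only [id, mul_one]
  rfl

lemma dB_dt (y t τ : ℝ) : HasDerivAt (fun t => dB y t (t + y + τ)) (d2B y t (t + y + τ)) t := by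
  refine ((bb1_deriv y (hasDerivAt_id t) (t3_dt y τ t)).add
    (bb1_deriv y (t3_dt y τ t) (hasDerivAt_id t))).congr_deriv ?_
  simp only [id, mul_one]
  unfold d2B
  rw [bb13_symm y (t + y + τ) t]; ring

lemma dB_dτ (y t τ : ℝ) : HasDerivAt (fun τ => dB y t (t + y + τ))
    (bb13 y t (t + y + τ) + bb11 y (t + y + τ) t) τ := by
  refine ((bb1_deriv y (hasDerivAt_const τ t) (t3_dτ y τ t)).add
    (bb1_deriv y (t3_dτ y τ t) (hasDerivAt_const τ t))).congr_deriv ?_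
  simp only [mul_one, mul_zero, zero_add, add_zero]

lemma KK1_dt (ν : ℂ) (y t τ : ℝ) : HasDerivAt (fun t => KK1 ν y t τ) (KK2 ν y t τ) t := by
  have h1 := bb_deriv y (hasDerivAt_id t) (t3_dt y τ t)
  have h2 := (legP1_deriv ν (bb_pos y t (t + y + τ))).scomp t h1
  refine ((dB_dt y t τ).ofReal_comp.mul h2).congr_deriv ?_
  rw [Complex.real_smul]
  simp only [id, mul_one, Function.comp]
  unfold KK2
  rw [show bb1 y t (t + y + τ) + bb1 y (t + y + τ) t = dB y t (t + y + τ) from rfl]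
  ring

lemma KK1_dτ (ν : ℂ) (y t τ : ℝ) : HasDerivAt (fun τ => KK1 ν y t τ) (KK1t ν y t τ) τ := by
  have h1 := bb_deriv y (hasDerivAt_const τ t) (t3_dτ y τ t)
  have h2 := (legP1_deriv ν (bb_pos y t (t + y + τ))).scomp τ h1
  refine ((dB_dτ y t τ).ofReal_comp.mul h2).congr_deriv ?_
  rw [Complex.real_smul]
  simp only [mul_one, mul_zero, zero_add, Function.comp]
  unfold KK1t
  ring

lemma KK_pde (ν : ℂ) (y t τ : ℝ) : KK2 ν y t τ - 2 * KK1t ν y t τ =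
    ν * (ν + 1) * (1 / Real.cosh (t + y + τ) ^ 2 - 1 / Real.cosh t ^ 2 : ℝ) * KK ν y t τ := by
  have h := legP_ode ν (bb_pos y t (t + y + τ))
  have i1 := congrArg (fun x : ℝ => (x : ℂ)) (bb_id1 y t (t + y + τ))
  have i2 := congrArg (fun x : ℝ => (x : ℂ)) (bb_id2 y t (t + y + τ))
  unfold KK2 KK1t KK dB d2B
  set q := t + y + τ
  simp only [Complex.ofReal_mul, Complex.ofReal_sub, Complex.ofReal_pow, Complex.ofReal_one,
    Complex.ofReal_add, Complex.ofReal_ofNat] at i1 i2 ⊢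
  linear_combination (legP2 ν (bb y t q)) * i1 + legP1 ν (bb y t q) * i2 +
    (((1 / Real.cosh q ^ 2 : ℝ) : ℂ) - ((1 / Real.cosh t ^ 2 : ℝ) : ℂ)) * h

lemma KK1_zero (ν : ℂ) (y t : ℝ) : KK1 ν y t 0 = 0 := by
  unfold KK1
  rw [dB_eq]
  simp

lemma KK_bounds (ν : ℂ) {ρ : ℝ} (h1 : ν.re < ρ) (h2 : -1 - ν.re < ρ) (y T : ℝ) :
    ∃ C, 0 < C ∧ ∀ t ≥ T, ∀ τ ≥ 0, ‖KK ν y t τ‖ ≤ C * Real.exp (ρ * τ) ∧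
      ‖KK1 ν y t τ‖ ≤ C * Real.exp (ρ * τ) * Real.exp (-2 * t) ∧
      ‖KK2 ν y t τ‖ ≤ C * Real.exp (ρ * τ) := by
  obtain ⟨m, hm, lo⟩ := bb_lower y T
  obtain ⟨M, hM, up⟩ := bb_upper y
  obtain ⟨D, hD, ud⟩ := dB_upper y
  obtain ⟨C, hC, hb⟩ := legP_bounds ν h1 h2 (z0 := 1 / m) (by positivity)
  set R := max 1 (max m M) with hR
  have R1 : 1 ≤ R := le_max_left _ _
  have Rm : m ≤ R := (le_max_left _ _).trans (le_max_right _ _)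
  have RM : M ≤ R := (le_max_right _ _).trans (le_max_right _ _)
  have hR0 : 0 < R := by linarith
  refine ⟨C * R ^ |ρ| * (1 + D * m + 12), by positivity, fun t ht τ hτ => ?_⟩
  have l := lo t ht τ
  have u := up t τ hτ
  have d := ud t τ hτ
  have b0 := bb_pos y t (t + y + τ)
  have bz : 1 / m ≤ bb y t (t + y + τ) := by
    rw [div_le_iff₀ hm]
    have := Real.one_le_exp hτ
    linarith
  obtain ⟨q0, q1, q2⟩ := hb _ bz
  have dle := dB_le y t (t + y + τ)
  have d2le := d2B_le y t (t + y + τ)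
  unfold KK KK1 KK2
  set b := bb y t (t + y + τ)
  have hτe := Real.exp_pos τ
  have te := Real.exp_pos (-2 * t)
  have cmp : b ^ ρ ≤ R ^ |ρ| * Real.exp (ρ * τ) := by
    rw [mul_comm ρ τ, Real.exp_mul]
    refine rpow_comp b0 hτe R1 (u.trans (by gcongr)) (l.trans (by gcongr))
  have e1 : b * b ^ (ρ - 1) = b ^ ρ := by
    nth_rw 1 [← Real.rpow_one b]; rw [← Real.rpow_add b0]; congr 1; ring
  have e2 : b ^ 2 * b ^ (ρ - 2) = b ^ ρ := by
    rw [← Real.rpow_natCast, ← Real.rpow_add b0]; congr 1; push_cast; ring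
  have Rp : 0 < R ^ |ρ| := by positivity
  have bp : 0 < b ^ ρ := Real.rpow_pos_of_pos b0 _
  have ep := Real.exp_pos (ρ * τ)
  refine ⟨?_, ?_, ?_⟩
  · calc _ ≤ C * b ^ ρ := q0
      _ ≤ C * (R ^ |ρ| * Real.exp (ρ * τ)) := by gcongr
      _ = C * R ^ |ρ| * 1 * Real.exp (ρ * τ) := by ring
      _ ≤ _ := by
        gcongr
        have : 0 < D * m := by positivity
        linarith
  · rw [norm_mul, Complex.norm_real, Real.norm_eq_abs]
    calc _ ≤ (D * (Real.exp τ * Real.exp (-2 * t))) * (C * b ^ (ρ - 1)) := by gcongr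
      _ ≤ (D * (m * b * Real.exp (-2 * t))) * (C * b ^ (ρ - 1)) := by gcongr
      _ = C * (D * m) * b ^ ρ * Real.exp (-2 * t) := by rw [← e1]; ring
      _ ≤ C * (D * m) * (R ^ |ρ| * Real.exp (ρ * τ)) * Real.exp (-2 * t) := by gcongr
      _ = C * R ^ |ρ| * (D * m) * Real.exp (ρ * τ) * Real.exp (-2 * t) := by ring
      _ ≤ _ := by gcongr; linarith
  · refine (norm_add_le _ _).trans ?_
    rw [norm_mul, norm_mul, norm_pow, Complex.norm_real, Complex.norm_real, Real.norm_eq_abs, Real.norm_eq_abs]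
    calc _ ≤ (2 * b) ^ 2 * (C * b ^ (ρ - 2)) + (8 * b) * (C * b ^ (ρ - 1)) := by gcongr
      _ = 4 * C * (b ^ 2 * b ^ (ρ - 2)) + 8 * C * (b * b ^ (ρ - 1)) := by ring
      _ = C * 12 * b ^ ρ := by rw [e1, e2]; ring
      _ ≤ C * 12 * (R ^ |ρ| * Real.exp (ρ * τ)) := by gcongr
      _ = C * R ^ |ρ| * 12 * Real.exp (ρ * τ) := by ring
      _ ≤ _ := by
        gcongr
        have : 0 < D * m := by positivity
        linarith

/-- second derivative of the solution -/
noncomputable def U2f (μ ν : ℂ) (U U1 : ℝ → ℂ) (t : ℝ) : ℂ :=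
  2 * μ * U1 t - ν * (ν + 1) * ((1 / Real.cosh t ^ 2 : ℝ) : ℂ) * U t

/-- solutions of the transformed Gegenbauer equation -/
structure USol (μ ν : ℂ) (U U1 : ℝ → ℂ) : Prop where
  h1 : ν.re < μ.re
  h2 : -1 - ν.re < μ.re
  d0 : ∀ t, HasDerivAt U (U1 t) t
  d1 : ∀ t, HasDerivAt U1 (U2f μ ν U U1 t) t
  bd : ∀ T : ℝ, ∃ C : ℝ, 0 < C ∧ ∀ t ≥ T, ‖U t‖ ≤ C ∧ ‖U1 t‖ ≤ C * Real.exp (-2 * t)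

/-- integrand -/
noncomputable def F0 (μ ν : ℂ) (U : ℝ → ℂ) (y t τ : ℝ) : ℂ :=
  Complex.exp (-μ * τ) * (U (t + y + τ) * KK ν y t τ)
/-- first derivative of the integrand -/
noncomputable def F1 (μ ν : ℂ) (U U1 : ℝ → ℂ) (y t τ : ℝ) : ℂ :=
  Complex.exp (-μ * τ) * (U1 (t + y + τ) * KK ν y t τ + U (t + y + τ) * KK1 ν y t τ)
/-- second derivative of the integrand -/
noncomputable def F2 (μ ν : ℂ) (U U1 : ℝ → ℂ) (y t τ : ℝ) : ℂ :=
  Complex.exp (-μ * τ) * (U2f μ ν U U1 (t + y + τ) * KK ν y t τ + 2 * (U1 (t + y + τ) * KK1 ν y t τ) +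
    U (t + y + τ) * KK2 ν y t τ)

lemma bb_cont (y t : ℝ) : Continuous fun τ => bb y t (t + y + τ) :=
  continuous_iff_continuousAt.2 fun τ => (bb_deriv y (hasDerivAt_const τ t) (t3_dτ y τ t)).continuousAt

lemma KK_cont (ν : ℂ) (y t : ℝ) : Continuous fun τ => KK ν y t τ :=
  (legP_continuousOn ν).comp_continuous (bb_cont y t) fun _ => bb_pos _ _ _

lemma dB_cont (y t : ℝ) : Continuous fun τ => dB y t (t + y + τ) :=
  continuous_iff_continuousAt.2 fun τ => (dB_dτ y t τ).continuousAt

lemma d2B_cont (y t : ℝ) : Continuous fun τ => d2B y t (t + y + τ) := by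
  have c2 := Real.cosh_pos y
  have c1 := Real.cosh_pos t
  unfold d2B bb11 bb13
  refine ((Continuous.div ?_ ?_ ?_).add (continuous_const.mul (Continuous.div ?_ ?_ ?_))).add
    (Continuous.div ?_ ?_ ?_)
  · fun_prop
  · fun_prop
  · intro τ; have := Real.cosh_pos (t + y + τ); positivity
  · fun_prop
  · fun_prop
  · intro τ; have := Real.cosh_pos (t + y + τ); positivity
  · fun_prop
  · fun_prop
  · intro τ; have := Real.cosh_pos (t + y + τ); positivity

lemma KK1_cont (ν : ℂ) (y t : ℝ) : Continuous fun τ => KK1 ν y t τ :=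
  (Complex.continuous_ofReal.comp (dB_cont y t)).mul
    ((legP1_continuousOn ν).comp_continuous (bb_cont y t) fun _ => bb_pos _ _ _)

lemma KK2_cont (ν : ℂ) (y t : ℝ) : Continuous fun τ => KK2 ν y t τ :=
  (((Complex.continuous_ofReal.comp (dB_cont y t)).pow 2).mul
    ((legP2_continuousOn ν).comp_continuous (bb_cont y t) fun _ => bb_pos _ _ _)).add
  ((Complex.continuous_ofReal.comp (d2B_cont y t)).mul
    ((legP1_continuousOn ν).comp_continuous (bb_cont y t) fun _ => bb_pos _ _ _))

section
variable {μ ν : ℂ} {U U1 : ℝ → ℂ}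

lemma USol.c0 (h : USol μ ν U U1) : Continuous U :=
  continuous_iff_continuousAt.2 fun t => (h.d0 t).continuousAt
lemma USol.c1 (h : USol μ ν U U1) : Continuous U1 :=
  continuous_iff_continuousAt.2 fun t => (h.d1 t).continuousAt
lemma USol.c2 (h : USol μ ν U U1) : Continuous (U2f μ ν U U1) := by
  have := h.c0
  have := h.c1
  have h3 : Continuous fun t : ℝ => ((1 / Real.cosh t ^ 2 : ℝ) : ℂ) :=
    Complex.continuous_ofReal.comp (continuous_const.div (by fun_prop) fun t => by
      have := Real.cosh_pos t; positivity)
  unfold U2f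
  fun_prop

lemma USol.F0c (h : USol μ ν U U1) (y t : ℝ) : Continuous (F0 μ ν U y t) := by
  have := h.c0
  have := KK_cont ν y t
  unfold F0
  fun_prop
lemma USol.F1c (h : USol μ ν U U1) (y t : ℝ) : Continuous (F1 μ ν U U1 y t) := by
  have := h.c0
  have := h.c1
  have := KK_cont ν y t
  have := KK1_cont ν y t
  unfold F1
  fun_prop
lemma USol.F2c (h : USol μ ν U U1) (y t : ℝ) : Continuous (F2 μ ν U U1 y t) := by
  have := h.c0
  have := h.c1
  have := h.c2
  have := KK_cont ν y t
  have := KK1_cont ν y t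
  have := KK2_cont ν y t
  unfold F2
  fun_prop

lemma sech_le (t : ℝ) : ‖((1 / Real.cosh t ^ 2 : ℝ) : ℂ)‖ ≤ 1 := by
  have := Real.one_le_cosh t
  rw [Complex.norm_real, Real.norm_of_nonneg (by positivity), div_le_one (by positivity)]
  nlinarith

lemma USol.Fbd (h : USol μ ν U U1) (y T : ℝ) : ∃ C δ : ℝ, 0 < C ∧ 0 < δ ∧ ∀ t ≥ T, ∀ τ ≥ 0,
    ‖F0 μ ν U y t τ‖ ≤ C * Real.exp (-δ * τ) ∧
    ‖F1 μ ν U U1 y t τ‖ ≤ C * Real.exp (-2 * t) * Real.exp (-δ * τ) ∧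
    ‖F2 μ ν U U1 y t τ‖ ≤ C * Real.exp (-δ * τ) ∧
    ‖Complex.exp (-μ * τ) * (U (t + y + τ) * KK1 ν y t τ)‖ ≤ C * Real.exp (-2 * t) * Real.exp (-δ * τ) := by
  obtain ⟨ρ, hρ1, hρ2⟩ := exists_between (max_lt h.h1 h.h2)
  obtain ⟨C, hC, hb⟩ := KK_bounds ν (lt_of_le_of_lt (le_max_left _ _) hρ1)
    (lt_of_le_of_lt (le_max_right _ _) hρ1) y T
  obtain ⟨A, hA, ha⟩ := h.bd (T + y)
  set Y := Real.exp (-2 * y) with hY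
  set Z := Real.exp (-2 * T) with hZ
  have Y0 : 0 < Y := Real.exp_pos _
  have Z0 : 0 < Z := Real.exp_pos _
  set N := ‖ν * (ν + 1)‖ with hN
  have N0 : 0 ≤ N := norm_nonneg _
  set m := ‖2 * μ‖ with hm
  have m0 : 0 ≤ m := norm_nonneg _
  -- constant
  set B1 := A * Y with hB1
  have B10 : 0 < B1 := by positivity
  set D := A + B1 + A + (m * (B1 * Z) + N * A + 2 * (B1 * Z * Z) + A) with hD
  refine ⟨C * D, μ.re - ρ, by positivity, by linarith, fun t ht τ hτ => ?_⟩
  obtain ⟨k0, k1, k2⟩ := hb t ht τ hτ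
  obtain ⟨u0, u1⟩ := ha (t + y + τ) (by linarith)
  have tz : Real.exp (-2 * t) ≤ Z := Real.exp_le_exp.2 (by linarith)
  have t0 := Real.exp_pos (-2 * t)
  have u1' : ‖U1 (t + y + τ)‖ ≤ B1 * Real.exp (-2 * t) := by
    refine u1.trans ?_
    have : Real.exp (-2 * (t + y + τ)) ≤ Y * Real.exp (-2 * t) := by
      rw [hY, ← Real.exp_add]; apply Real.exp_le_exp.2; linarith
    calc _ ≤ A * (Y * Real.exp (-2 * t)) := by gcongr
      _ = _ := by rw [hB1]; ring
  have u2 : ‖U2f μ ν U U1 (t + y + τ)‖ ≤ m * (B1 * Z) + N * A := by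
    unfold U2f
    refine (norm_sub_le _ _).trans ?_
    rw [norm_mul, norm_mul (ν * (ν + 1) * _), norm_mul (ν * (ν + 1)), ← hm, ← hN]
    have := sech_le (t + y + τ)
    calc _ ≤ m * (B1 * Real.exp (-2 * t)) + N * 1 * A := by gcongr
      _ ≤ m * (B1 * Z) + N * 1 * A := by gcongr
      _ = _ := by ring
  have e : Real.exp (-(μ.re - ρ) * τ) = Real.exp ((-μ).re * τ) * Real.exp (ρ * τ) := by
    rw [← Real.exp_add, Complex.neg_re]; congr 1; ring
  set E := Real.exp (ρ * τ) with hE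
  have E0 : 0 < E := Real.exp_pos _
  set G := Real.exp ((-μ).re * τ) with hG
  have G0 : 0 < G := Real.exp_pos _
  rw [e]
  set X := Real.exp (-2 * t) with hX
  have mB : 0 ≤ m * (B1 * Z) := by positivity
  have NA : 0 ≤ N * A := by positivity
  have BZ : 0 ≤ 2 * (B1 * Z * Z) := by positivity
  refine ⟨?_, ?_, ?_, ?_⟩
  · unfold F0
    rw [norm_mul, cexp_norm, norm_mul, ← hG]
    calc _ ≤ G * (A * (C * E)) := by gcongr
      _ = C * A * (G * E) := by ring
      _ ≤ _ := by gcongr; linarith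
  · unfold F1
    rw [norm_mul, cexp_norm, ← hG]
    have : ‖U1 (t + y + τ) * KK ν y t τ + U (t + y + τ) * KK1 ν y t τ‖ ≤ B1 * X * (C * E) + A * (C * E * X) := by
      refine (norm_add_le _ _).trans ?_
      rw [norm_mul, norm_mul]
      gcongr
    calc _ ≤ G * (B1 * X * (C * E) + A * (C * E * X)) := by gcongr
      _ = C * (B1 + A) * X * (G * E) := by ring
      _ ≤ _ := by gcongr; linarith
  · unfold F2
    rw [norm_mul, cexp_norm, ← hG]
    have : ‖U2f μ ν U U1 (t + y + τ) * KK ν y t τ + 2 * (U1 (t + y + τ) * KK1 ν y t τ) +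
        U (t + y + τ) * KK2 ν y t τ‖ ≤ (m * (B1 * Z) + N * A) * (C * E) + 2 * (B1 * Z * (C * E * Z)) + A * (C * E) := by
      refine (norm_add₃_le).trans ?_
      rw [norm_mul, norm_mul, norm_mul, norm_mul (U _), Complex.norm_ofNat]
      gcongr
      · exact u1'.trans (by gcongr)
      · exact k1.trans (by gcongr)
    calc _ ≤ G * ((m * (B1 * Z) + N * A) * (C * E) + 2 * (B1 * Z * (C * E * Z)) + A * (C * E)) := by gcongr
      _ = C * (m * (B1 * Z) + N * A + 2 * (B1 * Z * Z) + A) * (G * E) := by ring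
      _ ≤ _ := by gcongr; linarith
  · rw [norm_mul, cexp_norm, norm_mul, ← hG]
    calc _ ≤ G * (A * (C * E * X)) := by gcongr
      _ = C * A * X * (G * E) := by ring
      _ ≤ _ := by gcongr; linarith

lemma USol.F0_dt (h : USol μ ν U U1) (y t τ : ℝ) :
    HasDerivAt (fun t => F0 μ ν U y t τ) (F1 μ ν U U1 y t τ) t := by
  have hu := (h.d0 (t + y + τ)).scomp t (t3_dt y τ t)
  have := (hu.mul (KK_dt ν y t τ)).const_mul (Complex.exp (-μ * τ))
  refine this.congr_deriv ?_
  simp only [one_smul, F1, Function.comp]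

lemma USol.F1_dt (h : USol μ ν U U1) (y t τ : ℝ) :
    HasDerivAt (fun t => F1 μ ν U U1 y t τ) (F2 μ ν U U1 y t τ) t := by
  have hu := (h.d0 (t + y + τ)).scomp t (t3_dt y τ t)
  have hu1 := (h.d1 (t + y + τ)).scomp t (t3_dt y τ t)
  have := ((hu1.mul (KK_dt ν y t τ)).add (hu.mul (KK1_dt ν y t τ))).const_mul (Complex.exp (-μ * τ))
  refine this.congr_deriv ?_
  simp only [one_smul, F2, Function.comp]
  ring

/-- the integral -/
noncomputable def Phi (μ ν : ℂ) (U : ℝ → ℂ) (y t : ℝ) : ℂ := ∫ τ in Ioi (0 : ℝ), F0 μ ν U y t τ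
/-- its derivative -/
noncomputable def Phi1 (μ ν : ℂ) (U U1 : ℝ → ℂ) (y t : ℝ) : ℂ := ∫ τ in Ioi (0 : ℝ), F1 μ ν U U1 y t τ

lemma ae_Ioi {p : ℝ → Prop} (h : ∀ τ > 0, p τ) : ∀ᵐ τ ∂(volume.restrict (Ioi (0 : ℝ))), p τ :=
  (ae_restrict_iff' measurableSet_Ioi).2 (Filter.Eventually.of_forall fun τ hτ => h τ hτ)

lemma USol.F0i (h : USol μ ν U U1) (y t : ℝ) : IntegrableOn (F0 μ ν U y t) (Ioi 0) := by
  obtain ⟨C, δ, hC, hδ, hb⟩ := h.Fbd y t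
  exact intble_exp (h.F0c y t).continuousOn hδ fun τ hτ => (hb t le_rfl τ (le_of_lt hτ)).1
lemma USol.F1i (h : USol μ ν U U1) (y t : ℝ) : IntegrableOn (F1 μ ν U U1 y t) (Ioi 0) := by
  obtain ⟨C, δ, hC, hδ, hb⟩ := h.Fbd y t
  exact intble_exp (h.F1c y t).continuousOn hδ fun τ hτ => (hb t le_rfl τ (le_of_lt hτ)).2.1
lemma USol.F2i (h : USol μ ν U U1) (y t : ℝ) : IntegrableOn (F2 μ ν U U1 y t) (Ioi 0) := by
  obtain ⟨C, δ, hC, hδ, hb⟩ := h.Fbd y t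
  exact intble_exp (h.F2c y t).continuousOn hδ fun τ hτ => (hb t le_rfl τ (le_of_lt hτ)).2.2.1

lemma USol.Phi_deriv (h : USol μ ν U U1) (y t : ℝ) :
    HasDerivAt (Phi μ ν U y) (Phi1 μ ν U U1 y t) t := by
  obtain ⟨C, δ, hC, hδ, hb⟩ := h.Fbd y (t - 1)
  refine (hasDerivAt_integral_of_dominated_loc_of_deriv_le
    (bound := fun τ => C * Real.exp (-2 * (t - 1)) * Real.exp (-δ * τ)) (s := Ioi (t - 1))
    (Ioi_mem_nhds (by linarith)) ?_ (h.F0i y t) ?_ ?_ ?_ ?_).2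
  · exact Filter.Eventually.of_forall fun x => (h.F0c y x).aestronglyMeasurable
  · exact (h.F1c y t).aestronglyMeasurable
  · refine ae_Ioi fun τ hτ x hx => ((hb x (le_of_lt hx) τ (le_of_lt hτ)).2.1).trans ?_
    have : t - 1 < x := hx
    gcongr ?_ * Real.exp ?_ * ?_
    linarith
  · exact (exp_neg_integrableOn_Ioi 0 hδ).const_mul _
  · exact ae_Ioi fun τ hτ x hx => h.F0_dt y x τ

lemma USol.Phi1_deriv (h : USol μ ν U U1) (y t : ℝ) :
    HasDerivAt (Phi1 μ ν U U1 y) (∫ τ in Ioi (0 : ℝ), F2 μ ν U U1 y t τ) t := by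
  obtain ⟨C, δ, hC, hδ, hb⟩ := h.Fbd y (t - 1)
  refine (hasDerivAt_integral_of_dominated_loc_of_deriv_le
    (bound := fun τ => C * Real.exp (-δ * τ)) (s := Ioi (t - 1))
    (Ioi_mem_nhds (by linarith)) ?_ (h.F1i y t) ?_ ?_ ?_ ?_).2
  · exact Filter.Eventually.of_forall fun x => (h.F1c y x).aestronglyMeasurable
  · exact (h.F2c y t).aestronglyMeasurable
  · exact ae_Ioi fun τ hτ x hx => (hb x (le_of_lt hx) τ (le_of_lt hτ)).2.2.1
  · exact (exp_neg_integrableOn_Ioi 0 hδ).const_mul _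
  · exact ae_Ioi fun τ hτ x hx => h.F1_dt y x τ

lemma USol.Phi_ode (h : USol μ ν U U1) (y t : ℝ) :
    ∫ τ in Ioi (0 : ℝ), F2 μ ν U U1 y t τ = U2f μ ν (Phi μ ν U y) (Phi1 μ ν U U1 y) t := by
  obtain ⟨C, δ, hC, hδ, hb⟩ := h.Fbd y t
  have hd : ∀ τ : ℝ, HasDerivAt (fun τ : ℝ => Complex.exp (-μ * τ) * (U (t + y + τ) * KK1 ν y t τ))
      ((1 / 2) * F2 μ ν U U1 y t τ + ((-μ) * F1 μ ν U U1 y t τ +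
        (1 / 2) * (ν * (ν + 1) * ((1 / Real.cosh t ^ 2 : ℝ) : ℂ)) * F0 μ ν U y t τ)) τ := by
    intro τ
    have hu := (h.d0 (t + y + τ)).scomp τ (t3_dτ y τ t)
    refine ((cexp_deriv (-μ) τ).mul (hu.mul (KK1_dτ ν y t τ))).congr_deriv ?_
    have pde := KK_pde ν y t τ
    rw [Complex.ofReal_sub] at pde
    simp only [one_smul, Function.comp, Pi.mul_apply, F0, F1, F2, U2f]
    linear_combination (-(1 / 2) * Complex.exp (-μ * τ) * U (t + y + τ)) * pde
  have i0 := h.F0i y t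
  have i1 := h.F1i y t
  have i2 := h.F2i y t
  have T : Filter.Tendsto (fun τ : ℝ => Complex.exp (-μ * τ) * (U (t + y + τ) * KK1 ν y t τ))
      Filter.atTop (nhds 0) := by
    refine squeeze_zero_norm' ?_ (exp_neg_tendsto hδ (C * Real.exp (-2 * t)))
    filter_upwards [Filter.eventually_ge_atTop 0] with τ hτ using (hb t le_rfl τ hτ).2.2.2
  have H := integral_Ioi_of_hasDerivAt_of_tendsto' (a := (0 : ℝ)) (fun τ _ => hd τ)
    ((i2.const_mul _).add ((i1.const_mul _).add (i0.const_mul _))) T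
  have j : IntegrableOn (fun τ => (-μ) * F1 μ ν U U1 y t τ +
      (1 / 2) * (ν * (ν + 1) * ((1 / Real.cosh t ^ 2 : ℝ) : ℂ)) * F0 μ ν U y t τ) (Ioi 0) :=
    (i1.const_mul _).add (i0.const_mul _)
  rw [integral_add (i2.const_mul _) j,
    integral_add (i1.const_mul _) (i0.const_mul _), integral_const_mul, integral_const_mul,
    integral_const_mul, KK1_zero] at H
  unfold U2f Phi Phi1
  linear_combination 2 * H

lemma USol.Phi_bd (h : USol μ ν U U1) (y : ℝ) : ∃ C : ℝ, 0 < C ∧ ∀ t ≥ 0,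
    ‖Phi μ ν U y t‖ ≤ C ∧ ‖Phi1 μ ν U U1 y t‖ ≤ C * Real.exp (-2 * t) := by
  obtain ⟨C, δ, hC, hδ, hb⟩ := h.Fbd y 0
  set I := ∫ τ in Ioi (0 : ℝ), Real.exp (-δ * τ)
  have I0 : 0 ≤ I := integral_nonneg fun τ => (Real.exp_pos _).le
  refine ⟨C * I + 1, by positivity, fun t ht => ⟨?_, ?_⟩⟩
  · have : ‖Phi μ ν U y t‖ ≤ ∫ τ in Ioi (0 : ℝ), C * Real.exp (-δ * τ) :=
      norm_integral_le_of_norm_le ((exp_neg_integrableOn_Ioi 0 hδ).const_mul _)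
        (ae_Ioi fun τ hτ => (hb t ht τ (le_of_lt hτ)).1)
    rw [integral_const_mul] at this
    linarith
  · have : ‖Phi1 μ ν U U1 y t‖ ≤ ∫ τ in Ioi (0 : ℝ), C * Real.exp (-2 * t) * Real.exp (-δ * τ) :=
      norm_integral_le_of_norm_le ((exp_neg_integrableOn_Ioi 0 hδ).const_mul _)
        (ae_Ioi fun τ hτ => (hb t ht τ (le_of_lt hτ)).2.1)
    rw [integral_const_mul] at this
    have e := Real.exp_pos (-2 * t)
    nlinarith
end

section
variable {μ ν : ℂ} {U U1 : ℝ → ℂ}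

lemma USol.wr (h : USol μ ν U U1) (y t : ℝ) :
    U t * Phi1 μ ν U U1 y t - U1 t * Phi μ ν U y t = 0 := by
  set W : ℝ → ℂ := fun t => U t * Phi1 μ ν U U1 y t - U1 t * Phi μ ν U y t with hW
  have hd : ∀ t : ℝ, HasDerivAt (fun t : ℝ => Complex.exp (-2 * μ * t) * W t) 0 t := by
    intro t
    have d1 := h.Phi1_deriv y t
    rw [h.Phi_ode y t] at d1
    refine ((cexp_deriv (-2 * μ) t).mul (((h.d0 t).mul d1).sub ((h.d1 t).mul (h.Phi_deriv y t)))).congr_deriv ?_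
    simp only [Pi.mul_apply, Pi.sub_apply, U2f]
    ring
  have hc : ∀ t : ℝ, Complex.exp (-2 * μ * t) * W t = W 0 := by
    intro t
    have := is_const_of_deriv_eq_zero (fun t => (hd t).differentiableAt) (fun t => (hd t).deriv) t 0
    simpa using this
  obtain ⟨C, hC, hP⟩ := h.Phi_bd y
  obtain ⟨D, hD, hU⟩ := h.bd 0
  have hm : -1 / 2 < μ.re := by have := h.h1; have := h.h2; linarith
  have hb : ∀ t ≥ 0, ‖W 0‖ ≤ 2 * C * D * Real.exp (-1 * t) := by
    intro t ht
    rw [← hc t, norm_mul, cexp_norm]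
    have : ‖W t‖ ≤ 2 * C * D * Real.exp (-2 * t) := by
      refine (norm_sub_le _ _).trans ?_
      rw [norm_mul, norm_mul]
      obtain ⟨a, b⟩ := hP t ht
      obtain ⟨a', b'⟩ := hU t ht
      calc _ ≤ D * (C * Real.exp (-2 * t)) + D * Real.exp (-2 * t) * C := by gcongr
        _ = _ := by ring
    calc _ ≤ Real.exp ((-2 * μ).re * t) * (2 * C * D * Real.exp (-2 * t)) := by gcongr
      _ = 2 * C * D * (Real.exp ((-2 * μ).re * t + -2 * t)) := by rw [Real.exp_add]; ring
      _ ≤ _ := by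
        gcongr
        simp
        nlinarith
  have h0 : ‖W 0‖ ≤ 0 := by
    refine ge_of_tendsto (exp_neg_tendsto one_pos (2 * C * D)) ?_
    filter_upwards [Filter.eventually_ge_atTop 0] with t ht using hb t ht
  have h0' : W 0 = 0 := norm_le_zero_iff.1 h0
  have := hc t
  rw [h0'] at this
  exact (mul_eq_zero.1 this).resolve_left (Complex.exp_ne_zero _)

lemma USol.prop (h : USol μ ν U U1) (y t0 : ℝ) (h0 : U t0 ≠ 0) (t : ℝ) :
    Phi μ ν U y t = Phi μ ν U y t0 / U t0 * U t := by
  set k := Phi μ ν U y t0 / U t0 with hk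
  set N := ν * (ν + 1) with hN
  let v : ℝ → ℂ × ℂ → ℂ × ℂ := fun t p => (p.2, 2 * μ * p.2 - N * ((1 / Real.cosh t ^ 2 : ℝ) : ℂ) * p.1)
  have hL : ∀ t : ℝ, LipschitzOnWith (Real.toNNReal (1 + ‖2 * μ‖ + ‖N‖)) (v t) Set.univ := by
    intro t
    refine LipschitzWith.lipschitzOnWith (LipschitzWith.of_dist_le_mul fun p q => ?_)
    rw [Real.coe_toNNReal _ (by positivity), dist_eq_norm, dist_eq_norm]
    have e : v t p - v t q = v t (p - q) := by
      refine Prod.ext rfl ?_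
      simp only [v, Prod.fst_sub, Prod.snd_sub]
      ring
    rw [e]
    set w := p - q
    have w1 : ‖w.1‖ ≤ ‖w‖ := norm_fst_le w
    have w2 : ‖w.2‖ ≤ ‖w‖ := norm_snd_le w
    have w0 := norm_nonneg w
    have m0 := norm_nonneg (2 * μ)
    have N0 := norm_nonneg N
    rw [Prod.norm_def]
    refine max_le ?_ ?_
    · change ‖w.2‖ ≤ _
      nlinarith
    · change ‖2 * μ * w.2 - N * ((1 / Real.cosh t ^ 2 : ℝ) : ℂ) * w.1‖ ≤ _
      refine (norm_sub_le _ _).trans ?_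
      rw [norm_mul, norm_mul (N * _), norm_mul N]
      have s := sech_le t
      calc _ ≤ ‖2 * μ‖ * ‖w‖ + ‖N‖ * 1 * ‖w‖ := by gcongr
        _ ≤ _ := by nlinarith
  have wr := h.wr y t0
  have := ODE_solution_unique_univ (v := v) (s := fun _ => Set.univ) (t₀ := t0)
    (f := fun t => (Phi μ ν U y t, Phi1 μ ν U U1 y t)) (g := fun t => (k * U t, k * U1 t)) hL
    (fun t => ⟨by
      have d1 := h.Phi1_deriv y t
      rw [h.Phi_ode y t] at d1
      exact (h.Phi_deriv y t).prodMk d1, trivial⟩)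
    (fun t => ⟨by
      refine (((h.d0 t).const_mul k).prodMk ((h.d1 t).const_mul k)).congr_deriv ?_
      simp only [v, U2f, Prod.ext_iff]
      exact ⟨trivial, by ring⟩, trivial⟩)
    (by
      simp only [Prod.ext_iff, hk]
      constructor
      · field_simp
      · field_simp
        linear_combination wr)
  exact congrArg Prod.fst (congrFun this t)

lemma Phi_symm (μ ν : ℂ) (U : ℝ → ℂ) (y t : ℝ) : Phi μ ν U y t = Phi μ ν U t y := by
  unfold Phi F0 KK
  congr 1
  ext τ
  rw [bb_swap, add_comm t y]

lemma bb_diag_bd {t τ : ℝ} (ht : 0 ≤ t) (hτ : 0 ≤ τ) :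
    Real.exp τ / 4 ≤ bb t t (t + t + τ) ∧ bb t t (t + t + τ) ≤ 3 * Real.exp τ := by
  set q := t + t + τ with hq
  have c1 := Real.one_le_cosh t
  have c3 := Real.one_le_cosh q
  have ct : Real.cosh t ≤ Real.exp t := by
    rw [Real.cosh_eq]
    have : Real.exp (-t) ≤ Real.exp t := Real.exp_le_exp.2 (by linarith)
    linarith
  have cq : Real.cosh q ≤ Real.exp q := by
    rw [Real.cosh_eq]
    have : Real.exp (-q) ≤ Real.exp q := Real.exp_le_exp.2 (by linarith)
    linarith
  have ct' := half_exp_le_cosh t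
  have cq' := half_exp_le_cosh q
  have eq : Real.exp q = Real.exp t * Real.exp t * Real.exp τ := by rw [hq, Real.exp_add, Real.exp_add]
  have et := Real.exp_pos t
  have eτ := Real.one_le_exp hτ
  unfold bb
  rw [Real.sinh_sq]
  constructor
  · rw [le_div_iff₀ (by positivity)]
    have : Real.exp τ * (Real.cosh t * Real.cosh t) ≤ 2 * Real.cosh q := by
      calc _ ≤ Real.exp τ * (Real.exp t * Real.exp t) := by gcongr
        _ = Real.exp q := by rw [eq]; ring
        _ ≤ _ := by linarith
    nlinarith
  · rw [div_le_iff₀ (by positivity)]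
    have : Real.cosh q ≤ 4 * Real.exp τ * (Real.cosh t * Real.cosh t) := by
      calc _ ≤ Real.exp q := cq
        _ = 4 * Real.exp τ * (Real.exp t / 2 * (Real.exp t / 2)) := by rw [eq]; ring
        _ ≤ _ := by gcongr
    have a1 : Real.cosh q ^ 2 ≤ 4 * Real.exp τ * (Real.cosh t * Real.cosh t) * Real.cosh q := by nlinarith
    have a2 : Real.cosh t ^ 2 ≤ Real.exp τ * (Real.cosh t * Real.cosh t) * Real.cosh q := by
      have : 1 ≤ Real.exp τ * Real.cosh q := by nlinarith
      have : 0 ≤ Real.cosh t ^ 2 * (Real.exp τ * Real.cosh q - 1) := by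
        apply mul_nonneg (by positivity); linarith
      nlinarith
    nlinarith

lemma bb_diag_tendsto (τ : ℝ) :
    Filter.Tendsto (fun t : ℝ => bb t t (t + t + τ)) Filter.atTop (nhds (Real.exp τ)) := by
  set e := Real.exp (-τ) with he
  have e0 : 0 < e := Real.exp_pos _
  let g : ℝ → ℝ := fun a => (2 * a ^ 2 * e ^ 2 * (1 + a ^ 2) ^ 2 - 4 * a ^ 4 * e ^ 2 + (1 + a ^ 4 * e ^ 2) ^ 2) /
    (e * (1 + a ^ 2) ^ 2 * (1 + a ^ 4 * e ^ 2))
  have hg : ContinuousAt g 0 := by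
    refine ContinuousAt.div (by fun_prop) (by fun_prop) ?_
    positivity
  have g0 : g 0 = Real.exp τ := by
    simp [g, he, Real.exp_neg]
  have eq : ∀ t : ℝ, bb t t (t + t + τ) = g (Real.exp (-t)) := by
    intro t
    set a := Real.exp (-t) with ha
    have a0 : 0 < a := Real.exp_pos _
    have et : Real.exp t = a⁻¹ := by rw [ha, Real.exp_neg, inv_inv]
    have eτ : Real.exp τ = e⁻¹ := by rw [he, Real.exp_neg, inv_inv]
    have ct : Real.cosh t = (1 + a ^ 2) / (2 * a) := by
      rw [Real.cosh_eq, ← ha, et]; field_simp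
    have cq : Real.cosh (t + t + τ) = (1 + a ^ 4 * e ^ 2) / (2 * a ^ 2 * e) := by
      rw [Real.cosh_eq, Real.exp_neg, Real.exp_add, Real.exp_add, et, eτ]; field_simp
    unfold bb
    rw [Real.sinh_sq, ct, cq]
    simp only [g]
    field_simp
    ring
  rw [show (fun t : ℝ => bb t t (t + t + τ)) = fun t => g (Real.exp (-t)) from funext eq, ← g0]
  exact hg.tendsto.comp (Real.tendsto_exp_atBot.comp Filter.tendsto_neg_atTop_atBot)

lemma USol.lim (h : USol μ ν U U1) {A : ℂ} (hA : Filter.Tendsto U Filter.atTop (nhds A)) :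
    Filter.Tendsto (fun t => Phi μ ν U t t) Filter.atTop (nhds (A * Mel ν μ)) := by
  obtain ⟨ρ, hρ1, hρ2⟩ := exists_between (max_lt h.h1 h.h2)
  obtain ⟨C, hC, hb⟩ := legP_bounds ν (lt_of_le_of_lt (le_max_left _ _) hρ1)
    (lt_of_le_of_lt (le_max_right _ _) hρ1) (z0 := 1 / 4) (by norm_num)
  obtain ⟨D, hD, hU⟩ := h.bd 0
  have e : A * Mel ν μ = ∫ τ in Ioi (0 : ℝ), A * (Complex.exp (-μ * τ) * pe ν τ) := by
    rw [integral_const_mul]; rfl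
  rw [e]
  unfold Phi
  refine tendsto_integral_filter_of_dominated_convergence
    (fun τ => (D * (C * 4 ^ |ρ|)) * Real.exp (-(μ.re - ρ) * τ)) ?_ ?_ ?_ ?_
  · exact Filter.Eventually.of_forall fun t => (h.F0c t t).aestronglyMeasurable
  · filter_upwards [Filter.eventually_ge_atTop 0] with t ht
    refine ae_Ioi fun τ hτ => ?_
    obtain ⟨l, u⟩ := bb_diag_bd ht (le_of_lt hτ)
    have eτ := Real.one_le_exp (le_of_lt hτ)
    have k := (hb (bb t t (t + t + τ)) (by linarith)).1
    have k2 := rpow_comp (ρ := ρ) (M := 4) (bb_pos t t (t + t + τ)) (Real.exp_pos τ) (by norm_num)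
      (by linarith) (by linarith)
    have u0 := (hU (t + t + τ) (by linarith)).1
    rw [← Real.exp_mul] at k2
    unfold F0 KK
    rw [norm_mul, norm_mul, cexp_norm]
    calc _ ≤ Real.exp ((-μ).re * τ) * (D * (C * (4 ^ |ρ| * Real.exp (τ * ρ)))) := by
          gcongr; exact k.trans (by gcongr)
      _ = D * (C * 4 ^ |ρ|) * (Real.exp ((-μ).re * τ) * Real.exp (τ * ρ)) := by ring
      _ = _ := by rw [← Real.exp_add]; congr 2; simp; ring
  · exact (exp_neg_integrableOn_Ioi 0 (by linarith)).const_mul _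
  · refine ae_Ioi fun τ hτ => ?_
    have t1 : Filter.Tendsto (fun t : ℝ => U (t + t + τ)) Filter.atTop (nhds A) :=
      hA.comp (Filter.tendsto_atTop_add_const_right _ _
        (Filter.tendsto_id.atTop_add_atTop Filter.tendsto_id))
    have t2 : Filter.Tendsto (fun t : ℝ => KK ν t t τ) Filter.atTop (nhds (pe ν τ)) :=
      ((legP_continuousOn ν).continuousAt (Ioi_mem_nhds (Real.exp_pos τ))).tendsto.comp (bb_diag_tendsto τ)
    have := (t1.mul t2).const_mul (Complex.exp (-μ * τ))
    refine this.congr' ?_ |>.trans ?_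
    · exact Filter.Eventually.of_forall fun t => rfl
    · rw [show Complex.exp (-μ * τ) * (A * pe ν τ) = A * (Complex.exp (-μ * τ) * pe ν τ) by ring]

/-- abstract product formula -/
theorem USol.main (h : USol μ ν U U1) {A : ℂ} (hA : Filter.Tendsto U Filter.atTop (nhds A)) (hA0 : A ≠ 0)
    (y t : ℝ) : Phi μ ν U y t * A = Mel ν μ * (U y * U t) := by
  obtain ⟨t0, h0⟩ : ∃ t0, U t0 ≠ 0 := (hA.eventually_ne hA0).exists
  set k := Phi μ ν U t0 t0 / U t0 / U t0 with hk
  have key : ∀ y t, Phi μ ν U y t = k * (U y * U t) := by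
    intro y t
    rw [h.prop y t0 h0 t, Phi_symm μ ν U y t0, h.prop t0 t0 h0 y, hk]
    field_simp
  have l1 := h.lim hA
  have l2 : Filter.Tendsto (fun t => Phi μ ν U t t) Filter.atTop (nhds (k * (A * A))) := by
    simp only [key]
    exact (hA.mul hA).const_mul k
  have := tendsto_nhds_unique l1 l2
  have h3 : k * A = Mel ν μ := by
    apply mul_left_cancel₀ hA0
    rw [this]; ring
  rw [key, ← h3]; ring

/-- non-integrability -/
lemma nonint {μ ν : ℂ} {U : ℝ → ℂ} (h2 : -1 - ν.re < μ.re)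
    {A : ℂ} (hA : Filter.Tendsto U Filter.atTop (nhds A)) (hA0 : A ≠ 0) (y t : ℝ)
    (hi : IntegrableOn (F0 μ ν U y t) (Ioi 0)) : ν.re < μ.re := by
  by_contra hlt
  push Not at hlt
  have hν : -1 / 2 < ν.re := by linarith
  obtain ⟨c, Z, hc, hZ, hl⟩ := legP_lower ν hν
  obtain ⟨m, hm, hbb⟩ := bb_lower y t
  obtain ⟨M, hM, hbu⟩ := bb_upper y
  have A0 : 0 < ‖A‖ := norm_pos_iff.2 hA0
  have ev1 : ∀ᶠ τ : ℝ in Filter.atTop, ‖A‖ / 2 < ‖U (t + y + τ)‖ :=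
    (hA.norm.comp (Filter.tendsto_atTop_add_const_left _ (t + y) Filter.tendsto_id)).eventually
      (lt_mem_nhds (by linarith))
  have ev2 : ∀ᶠ τ : ℝ in Filter.atTop, m * Z ≤ Real.exp τ :=
    Real.tendsto_exp_atTop.eventually_ge_atTop _
  obtain ⟨T, hT⟩ := Filter.eventually_atTop.1 ((ev1.and ev2).and (Filter.eventually_ge_atTop 0))
  set Q := max m (max M 1) with hQ
  have Q1 : 1 ≤ Q := (le_max_right _ _).trans (le_max_right _ _)
  have Qm : m ≤ Q := le_max_left _ _
  have QM : M ≤ Q := (le_max_left _ _).trans (le_max_right _ _)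
  have Qp : 0 < Q ^ |ν.re| := by positivity
  set κ := ‖A‖ / 2 * (c / Q ^ |ν.re|) with hκ
  have κ0 : 0 < κ := by positivity
  have lb : ∀ τ > max T 0, κ ≤ ‖F0 μ ν U y t τ‖ := by
    intro τ hτ
    obtain ⟨⟨a, b⟩, τ0⟩ := hT τ (le_of_lt (lt_of_le_of_lt (le_max_left _ _) hτ))
    have b1 := hbb t le_rfl τ
    have b2 := hbu t τ τ0
    set z := bb y t (t + y + τ) with hz
    have z0 : 0 < z := bb_pos _ _ _
    have e0 := Real.exp_pos τ
    have zZ : Z ≤ z := by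
      by_contra hh; push Not at hh
      nlinarith
    have l := hl z zZ
    have r := rpow_comp (ρ := ν.re) e0 z0 Q1 (b1.trans (by gcongr)) (b2.trans (by gcongr))
    rw [← Real.exp_mul] at r
    unfold F0 KK
    rw [norm_mul, norm_mul, cexp_norm, ← hz]
    have s1 : c / Q ^ |ν.re| * Real.exp (τ * ν.re) ≤ ‖legendreP ν z‖ := by
      refine le_trans ?_ l
      rw [div_mul_eq_mul_div, div_le_iff₀ Qp]
      calc _ ≤ c * (Q ^ |ν.re| * z ^ ν.re) := by gcongr
        _ = _ := by ring
    have s2 : 1 ≤ Real.exp ((-μ).re * τ) * Real.exp (τ * ν.re) := by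
      rw [← Real.exp_add]
      apply Real.one_le_exp
      simp
      nlinarith
    calc κ ≤ κ * (Real.exp ((-μ).re * τ) * Real.exp (τ * ν.re)) := le_mul_of_one_le_right κ0.le s2
      _ = Real.exp ((-μ).re * τ) * (‖A‖ / 2 * (c / Q ^ |ν.re| * Real.exp (τ * ν.re))) := by rw [hκ]; ring
      _ ≤ _ := by gcongr
  have hi2 : IntegrableOn (F0 μ ν U y t) (Ioi (max T 0)) := hi.mono_set (Ioi_subset_Ioi (le_max_right _ _))
  have : IntegrableOn (fun _ : ℝ => κ) (Ioi (max T 0)) := by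
    refine Integrable.mono hi2 aestronglyMeasurable_const ?_
    refine (ae_restrict_iff' measurableSet_Ioi).2 (Filter.Eventually.of_forall fun τ hτ => ?_)
    rw [Real.norm_of_nonneg κ0.le]
    exact lb τ hτ
  rw [integrableOn_const_iff] at this
  simp [κ0.ne'] at this
end

/-- the variable (1 - tanh t)/2 -/
noncomputable def zz (t : ℝ) : ℝ := 1 / (1 + Real.exp (2 * t))

lemma zz_pos (t : ℝ) : 0 < zz t := by unfold zz; positivity
lemma zz_lt (t : ℝ) : zz t < 1 := by
  unfold zz
  rw [div_lt_one (by positivity)]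
  have := Real.exp_pos (2 * t); linarith
lemma zz_le (t : ℝ) : zz t ≤ Real.exp (-2 * t) := by
  unfold zz
  rw [div_le_iff₀ (by positivity), mul_add, ← Real.exp_add]
  have := Real.exp_pos (-2 * t)
  have e : -2 * t + 2 * t = 0 := by ring
  rw [e, Real.exp_zero]
  linarith
lemma zz_anti {T t : ℝ} (h : T ≤ t) : zz t ≤ zz T := by
  unfold zz
  gcongr
lemma zz_deriv (t : ℝ) : HasDerivAt zz (-2 * zz t * (1 - zz t)) t := by
  have h : HasDerivAt (fun t : ℝ => 1 + Real.exp (2 * t)) (Real.exp (2 * t) * 2) t := by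
    have := ((Real.hasDerivAt_exp (2 * t)).comp t ((hasDerivAt_id t).const_mul 2)).const_add 1
    simpa using this
  have h2 := (hasDerivAt_const t (1 : ℝ)).div h (by positivity)
  refine h2.congr_deriv ?_
  unfold zz
  field_simp
  ring
lemma zz_sech (t : ℝ) : 1 / Real.cosh t ^ 2 = 4 * zz t * (1 - zz t) := by
  unfold zz
  rw [Real.cosh_eq, Real.exp_neg, show 2 * t = t + t by ring, Real.exp_add]
  have := Real.exp_pos t
  field_simp
  ring
lemma zz_tanh (t : ℝ) : zz t = (1 - Real.tanh t) / 2 := by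
  unfold zz
  rw [Real.tanh_eq_sinh_div_cosh, Real.sinh_eq, Real.cosh_eq, Real.exp_neg, show 2 * t = t + t by ring, Real.exp_add]
  have := Real.exp_pos t
  field_simp
  ring
lemma zz_tendsto : Filter.Tendsto zz Filter.atTop (nhds 0) := by
  have := exp_neg_tendsto (two_pos) 1
  simp only [one_mul] at this
  exact squeeze_zero (fun t => (zz_pos t).le) zz_le this

lemma zzc_deriv (t : ℝ) : HasDerivAt (fun t => (zz t : ℂ)) (-2 * zz t * (1 - zz t)) t :=
  (zz_deriv t).ofReal_comp.congr_deriv (by push_cast; rfl)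

lemma zzc_norm (t : ℝ) : ‖(zz t : ℂ)‖ < 1 := by
  rw [Complex.norm_real, Real.norm_of_nonneg (zz_pos t).le]; exact zz_lt t

lemma one_sub_zz_slit (t : ℝ) : (1 - (zz t : ℂ)) ∈ Complex.slitPlane := by
  left; simp; exact zz_lt t

/-- power prefactor -/
noncomputable def PP (σ : ℂ) (t : ℝ) : ℂ := (1 - (zz t : ℂ)) ^ σ

lemma PP_deriv (σ : ℂ) (t : ℝ) : HasDerivAt (PP σ) (2 * σ * zz t * PP σ t) t := by
  have h := (hasDerivAt_id (1 - (zz t : ℂ))).cpow_const (c := σ) (one_sub_zz_slit t)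
  have := h.comp t ((zzc_deriv t).const_sub 1)
  refine this.congr_deriv ?_
  have h0 : (1 - (zz t : ℂ)) ≠ 0 := Complex.slitPlane_ne_zero (one_sub_zz_slit t)
  unfold PP
  simp only [id]
  rw [Complex.cpow_sub _ _ h0, Complex.cpow_one]
  field_simp

/-- the concrete solution -/
noncomputable def Uc (σ : ℂ) (e : ℕ → ℂ) (t : ℝ) : ℂ := PP σ t * ps e (zz t)
/-- its derivative -/
noncomputable def Uc1 (σ : ℂ) (e : ℕ → ℂ) (t : ℝ) : ℂ :=
  PP σ t * (zz t * (2 * σ * ps e (zz t) - 2 * (1 - zz t) * ps (dsh e) (zz t)))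

lemma ps_zz_deriv {e : ℕ → ℂ} (he : RS e) (t : ℝ) :
    HasDerivAt (fun t : ℝ => ps e (zz t)) (ps (dsh e) (zz t) * (-2 * zz t * (1 - zz t))) t :=
  HasDerivAt.comp (h₂ := ps e) (h := fun t : ℝ => (zz t : ℂ)) t (hasDerivAt_ps he (zzc_norm t)) (zzc_deriv t)

lemma Uc_deriv (σ : ℂ) {e : ℕ → ℂ} (he : RS e) (t : ℝ) : HasDerivAt (Uc σ e) (Uc1 σ e t) t := by
  refine ((PP_deriv σ t).mul (ps_zz_deriv he t)).congr_deriv ?_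
  unfold Uc1; ring

lemma Uc1_deriv {σ μ ν : ℂ} (hσ : σ * (σ - μ) = 0) (t : ℝ) :
    HasDerivAt (Uc1 σ (hco (σ - ν) (σ + ν + 1) (μ + 1)))
      (U2f μ ν (Uc σ (hco (σ - ν) (σ + ν + 1) (μ + 1))) (Uc1 σ (hco (σ - ν) (σ + ν + 1) (μ + 1))) t) t := by
  set e := hco (σ - ν) (σ + ν + 1) (μ + 1) with hhe
  have he : RS e := hco_RS _ _ _
  have ode := ps_ode he (hco_rec _ _ _) (zzc_norm t)
  have := (PP_deriv σ t).mul ((zzc_deriv t).mul (((ps_zz_deriv he t).const_mul (2 * σ)).sub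
    ((((zzc_deriv t).const_sub 1).const_mul 2).mul (ps_zz_deriv he.dsh t))))
  refine this.congr_deriv ?_
  simp only [Pi.mul_apply, Pi.sub_apply]
  unfold U2f Uc1 Uc
  rw [zz_sech]
  push_cast
  set z : ℂ := (zz t : ℂ)
  set P := PP σ t
  set H := ps e z
  set H1 := ps (dsh e) z
  set H2 := ps (dsh (dsh e)) z
  linear_combination 4 * P * z * (1 - z) * ode + (4 * P * z * H) * hσ

lemma Uc_cont (σ : ℂ) {e : ℕ → ℂ} (he : RS e) (T : ℝ) : ∃ C : ℝ, ∀ x ∈ Icc 0 (zz T),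
    ‖(1 - (x : ℂ)) ^ σ * ps e x‖ ≤ C ∧
    ‖(1 - (x : ℂ)) ^ σ * (2 * σ * ps e x - 2 * (1 - x) * ps (dsh e) x)‖ ≤ C := by
  have cx : Continuous fun x : ℝ => (x : ℂ) := Complex.continuous_ofReal
  have hin : MapsTo (fun x : ℝ => (x : ℂ)) (Icc 0 (zz T)) (Metric.ball 0 1) := by
    intro x hx
    have : ‖(x : ℂ)‖ < 1 := by
      rw [Complex.norm_real, Real.norm_of_nonneg hx.1]; exact lt_of_le_of_lt hx.2 (zz_lt T)
    simpa using this
  have c1 : ContinuousOn (fun x : ℝ => (1 - (x : ℂ)) ^ σ) (Icc 0 (zz T)) := by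
    refine ContinuousOn.cpow_const (by fun_prop) fun x hx => ?_
    left
    have := lt_of_le_of_lt hx.2 (zz_lt T)
    simpa using this
  have c2 : ContinuousOn (fun x : ℝ => ps e (x : ℂ)) (Icc 0 (zz T)) :=
    (continuousOn_ps he).comp cx.continuousOn hin
  have c3 : ContinuousOn (fun x : ℝ => ps (dsh e) (x : ℂ)) (Icc 0 (zz T)) :=
    (continuousOn_ps he.dsh).comp cx.continuousOn hin
  obtain ⟨C1, h1⟩ := isCompact_Icc.exists_bound_of_continuousOn (c1.mul c2)
  obtain ⟨C2, h2⟩ := isCompact_Icc.exists_bound_of_continuousOn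
    (c1.mul ((c2.const_mul (2 * σ)).sub (ContinuousOn.mul
      (show ContinuousOn (fun x : ℝ => 2 * (1 - (x : ℂ))) (Icc 0 (zz T)) by fun_prop) c3)))
  exact ⟨max C1 C2, fun x hx => ⟨(h1 x hx).trans (le_max_left _ _), (h2 x hx).trans (le_max_right _ _)⟩⟩

lemma Uc_USol {σ μ ν : ℂ} (h1 : ν.re < μ.re) (h2 : -1 - ν.re < μ.re) (hσ : σ * (σ - μ) = 0) :
    USol μ ν (Uc σ (hco (σ - ν) (σ + ν + 1) (μ + 1))) (Uc1 σ (hco (σ - ν) (σ + ν + 1) (μ + 1))) := by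
  refine ⟨h1, h2, Uc_deriv σ (hco_RS _ _ _), Uc1_deriv hσ, fun T => ?_⟩
  obtain ⟨C, hC⟩ := Uc_cont σ (hco_RS (σ - ν) (σ + ν + 1) (μ + 1)) T
  refine ⟨max C 1, by positivity, fun t ht => ?_⟩
  obtain ⟨a, b⟩ := hC (zz t) ⟨(zz_pos t).le, zz_anti ht⟩
  refine ⟨a.trans (le_max_left _ _), ?_⟩
  unfold Uc1 PP
  rw [mul_left_comm, norm_mul, mul_comm, Complex.norm_real, Real.norm_of_nonneg (zz_pos t).le]
  have := zz_le t
  have := zz_pos t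
  have := b.trans (le_max_left _ 1)
  gcongr

lemma Uc_lim (σ : ℂ) {e : ℕ → ℂ} (he : RS e) : Filter.Tendsto (Uc σ e) Filter.atTop (nhds (e 0)) := by
  have hz : Filter.Tendsto (fun t => (zz t : ℂ)) Filter.atTop (nhds 0) := by
    have := (Complex.continuous_ofReal.tendsto 0).comp zz_tendsto
    rw [Complex.ofReal_zero] at this
    exact this
  have t1 : Filter.Tendsto (fun t => ps e (zz t)) Filter.atTop (nhds (ps e 0)) :=
    ((hasDerivAt_ps he (z := 0) (by simp)).continuousAt.tendsto).comp hz
  have t2 : Filter.Tendsto (PP σ) Filter.atTop (nhds ((1 - 0) ^ σ)) := by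
    have : ContinuousAt (fun x : ℂ => (1 - x) ^ σ) 0 :=
      ContinuousAt.cpow (by fun_prop) continuousAt_const (by simp)
    exact this.tendsto.comp hz
  have e0 : ps e 0 = e 0 := by
    unfold ps
    rw [tsum_eq_single 0]
    · simp
    · intro n hn; simp [hn]
  have := t2.mul t1
  rw [e0, sub_zero, Complex.one_cpow, one_mul] at this
  exact this

lemma one_sub_tanh_sq (t : ℝ) : 1 - Real.tanh t ^ 2 = 1 / Real.cosh t ^ 2 := by
  have := Real.cosh_pos t
  have h := Real.cosh_sq t
  rw [Real.tanh_eq_sinh_div_cosh]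
  field_simp
  linarith

lemma tanh_deriv (t : ℝ) : HasDerivAt Real.tanh (1 / Real.cosh t ^ 2) t := by
  have e : Real.tanh = fun t => Real.sinh t / Real.cosh t := funext Real.tanh_eq_sinh_div_cosh
  rw [e]
  have := Real.cosh_pos t
  refine ((Real.hasDerivAt_sinh t).div (Real.hasDerivAt_cosh t) this.ne').congr_deriv ?_
  congr 1
  have h := Real.cosh_sq t
  linarith

lemma tanh_add' (a b : ℝ) : Real.tanh (a + b) =
    (Real.tanh a + Real.tanh b) / (1 + Real.tanh a * Real.tanh b) := by
  have ha := Real.cosh_pos a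
  have hb := Real.cosh_pos b
  have hab := Real.cosh_pos (a + b)
  rw [Real.tanh_eq_sinh_div_cosh, Real.tanh_eq_sinh_div_cosh, Real.tanh_eq_sinh_div_cosh]
  rw [Real.cosh_add] at hab
  rw [Real.sinh_add, Real.cosh_add]
  have e1 : Real.sinh a / Real.cosh a + Real.sinh b / Real.cosh b =
    (Real.sinh a * Real.cosh b + Real.cosh a * Real.sinh b) / (Real.cosh a * Real.cosh b) := by
    field_simp
  have e2 : 1 + Real.sinh a / Real.cosh a * (Real.sinh b / Real.cosh b) =
    (Real.cosh a * Real.cosh b + Real.sinh a * Real.sinh b) / (Real.cosh a * Real.cosh b) := by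
    field_simp
  rw [e1, e2, div_div_div_cancel_right₀ (by positivity)]

lemma tanh_image (s : ℝ) : (fun τ => Real.tanh (s + τ)) '' Ioi 0 = Ioo (Real.tanh s) 1 := by
  ext x
  constructor
  · rintro ⟨τ, hτ, rfl⟩
    refine ⟨?_, Real.tanh_lt_one _⟩
    have hτ : (0 : ℝ) < τ := hτ
    rw [← Real.artanh_lt_artanh_iff ⟨Real.neg_one_lt_tanh _, Real.tanh_lt_one _⟩
      ⟨Real.neg_one_lt_tanh _, Real.tanh_lt_one _⟩, Real.artanh_tanh, Real.artanh_tanh]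
    linarith
  · rintro ⟨h1, h2⟩
    have hx : x ∈ Ioo (-1) 1 := ⟨(Real.neg_one_lt_tanh s).trans h1, h2⟩
    refine ⟨Real.artanh x - s, ?_, ?_⟩
    · have := Real.artanh_lt_artanh (Real.neg_one_lt_tanh s) h2 h1
      rw [Real.artanh_tanh] at this
      exact mem_Ioi.2 (by linarith)
    · simp only [add_sub_cancel]
      exact Real.tanh_artanh hx

lemma tanh_cov (s : ℝ) (g : ℝ → ℂ) :
    (IntegrableOn g (Ioo (Real.tanh s) 1) ↔
      IntegrableOn (fun τ => ((1 / Real.cosh (s + τ) ^ 2 : ℝ) : ℂ) * g (Real.tanh (s + τ))) (Ioi 0)) ∧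
    ∫ x in Ioo (Real.tanh s) 1, g x =
      ∫ τ in Ioi (0 : ℝ), ((1 / Real.cosh (s + τ) ^ 2 : ℝ) : ℂ) * g (Real.tanh (s + τ)) := by
  have hd : ∀ τ ∈ Ioi (0 : ℝ), HasDerivWithinAt (fun τ => Real.tanh (s + τ))
      (1 / Real.cosh (s + τ) ^ 2) (Ioi 0) τ := by
    intro τ _
    have := (tanh_deriv (s + τ)).comp τ ((hasDerivAt_id τ).const_add s)
    rw [mul_one] at this
    exact this.hasDerivWithinAt
  have hi : InjOn (fun τ => Real.tanh (s + τ)) (Ioi 0) := by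
    intro a _ b _ h
    have := congrArg Real.artanh h
    simpa [Real.artanh_tanh] using this
  have e : ∀ τ : ℝ, |1 / Real.cosh (s + τ) ^ 2| • g (Real.tanh (s + τ)) =
      ((1 / Real.cosh (s + τ) ^ 2 : ℝ) : ℂ) * g (Real.tanh (s + τ)) := by
    intro τ
    rw [abs_of_nonneg (by positivity), Complex.real_smul]
  rw [← tanh_image s, integrableOn_image_iff_integrableOn_abs_deriv_smul measurableSet_Ioi hd hi,
    integral_image_eq_integral_abs_deriv_smul measurableSet_Ioi hd hi]
  simp only [e]
  exact ⟨trivial, trivial⟩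

lemma bb_tanh (p y q : ℝ) :
    (2 - Real.tanh p ^ 2 - Real.tanh y ^ 2 - Real.tanh q ^ 2 +
      Real.tanh p ^ 2 * Real.tanh y ^ 2 * Real.tanh q ^ 2) /
        (2 * Real.sqrt ((1 - Real.tanh p ^ 2) * (1 - Real.tanh y ^ 2) * (1 - Real.tanh q ^ 2))) = bb y p q := by
  have h1 := one_sub_tanh_sq p
  have h2 := one_sub_tanh_sq y
  have h3 := one_sub_tanh_sq q
  have c1 := Real.cosh_pos p
  have c2 := Real.cosh_pos y
  have c3 := Real.cosh_pos q
  have hs : Real.sqrt ((1 - Real.tanh p ^ 2) * (1 - Real.tanh y ^ 2) * (1 - Real.tanh q ^ 2)) =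
      1 / (Real.cosh p * Real.cosh y * Real.cosh q) := by
    rw [h1, h2, h3]
    rw [show 1 / Real.cosh p ^ 2 * (1 / Real.cosh y ^ 2) * (1 / Real.cosh q ^ 2) =
      (1 / (Real.cosh p * Real.cosh y * Real.cosh q)) ^ 2 by field_simp]
    exact Real.sqrt_sq (by positivity)
  rw [hs]
  unfold bb
  rw [Real.sinh_sq, show Real.tanh p ^ 2 = 1 - 1 / Real.cosh p ^ 2 by linarith,
    show Real.tanh y ^ 2 = 1 - 1 / Real.cosh y ^ 2 by linarith,
    show Real.tanh q ^ 2 = 1 - 1 / Real.cosh q ^ 2 by linarith]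
  field_simp
  ring

lemma sech_cpow (t : ℝ) (s : ℂ) :
    ((1 - Real.tanh t ^ 2 : ℝ) : ℂ) ^ s = (Real.cosh t : ℂ) ^ (-2 * s) := by
  have c := Real.cosh_pos t
  have h0 : ((1 / Real.cosh t ^ 2 : ℝ) : ℂ) ≠ 0 := by
    rw [Complex.ofReal_ne_zero]; positivity
  rw [one_sub_tanh_sq, Complex.cpow_def_of_ne_zero h0,
    Complex.cpow_def_of_ne_zero (Complex.ofReal_ne_zero.2 c.ne'), ← Complex.ofReal_log (by positivity),
    ← Complex.ofReal_log c.le, one_div, Real.log_inv, Real.log_pow]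
  push_cast
  congr 1; ring

/-- constants -/
noncomputable def Kc (lam α : ℂ) : ℂ := (Real.sqrt Real.pi : ℂ) * Complex.Gamma (lam + 2 * α) /
      ((2 : ℂ) ^ (2 * α - 1) * Complex.Gamma α * Complex.Gamma (lam + 1))
/-- constants -/
noncomputable def Cf (lam α : ℂ) : ℂ :=
  -(2 : ℂ) ^ lam * (Real.sqrt Real.pi : ℂ) * Complex.Gamma (lam / 2 + α + 1 / 2) /
        (Complex.Gamma lam * Complex.Gamma α * Complex.Gamma (1 - lam / 2))

lemma core {lam α μ' D A : ℂ} {U : ℝ → ℂ} (hK : Kc lam α ≠ 0) (hD : D ≠ 0)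
    (hA : Filter.Tendsto U Filter.atTop (nhds A)) (hA0 : A ≠ 0)
    (h2 : -1 - (lam + α - 1 / 2).re < μ'.re)
    (hsol : (lam + α - 1 / 2).re < μ'.re → ∃ U1, USol μ' (lam + α - 1 / 2) U U1)
    (hC : (lam + α - 1 / 2).re < μ'.re →
      Kc lam α * 2 ^ (α - 1 / 2) * D * A = Cf lam α * Mel (lam + α - 1 / 2) μ')
    (hrep : ∀ t : ℝ, hyp2F1reg (-lam) (lam + 2 * α) (α + 1 / 2) ((1 - (Real.tanh t : ℂ)) / 2) =
      D * 2 ^ (α - 1 / 2) * (Real.cosh t : ℂ) ^ (α - 1 / 2) * Complex.exp (-μ' * t) * U t)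
    (p y : ℝ) (F : ℝ → ℂ)
    (hF : ∀ q, F (Real.tanh q) = gegenbauerCcut lam α (Real.tanh q) *
        ((1 - Real.tanh q ^ 2 : ℝ) : ℂ) ^ (α / 2 - 5 / 4) * legendreP (lam + α - 1 / 2) (bb y p q))
    (hint : IntegrableOn F (Ioo (Real.tanh (p + y)) 1)) :
    gegenbauerCcut lam α (Real.tanh p) * gegenbauerCcut lam α (Real.tanh y) =
      Cf lam α / (((1 - Real.tanh p ^ 2 : ℝ) : ℂ) ^ (α / 2 - 1 / 4) *
        ((1 - Real.tanh y ^ 2 : ℝ) : ℂ) ^ (α / 2 - 1 / 4)) * ∫ x in Ioo (Real.tanh (p + y)) 1, F x := by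
  set ν := lam + α - 1 / 2 with hν
  set μ := α - 1 / 2 with hμ
  obtain ⟨e1, e2⟩ := tanh_cov (p + y) F
  have gk : ∀ q, gegenbauerCcut lam α (Real.tanh q) =
      Kc lam α * (D * 2 ^ μ * (Real.cosh q : ℂ) ^ μ * Complex.exp (-μ' * q) * U q) := by
    intro q
    rw [← hrep q]; rfl
  set L := Kc lam α * D * 2 ^ μ * Complex.exp (-μ' * (p + y : ℝ)) with hL
  have two : (2 : ℂ) ^ μ ≠ 0 := by rw [Complex.cpow_ne_zero_iff]; left; norm_num
  have hL0 : L ≠ 0 := by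
    rw [hL]
    exact mul_ne_zero (mul_ne_zero (mul_ne_zero hK hD) two) (Complex.exp_ne_zero _)
  have key : ∀ τ : ℝ, ((1 / Real.cosh (p + y + τ) ^ 2 : ℝ) : ℂ) * F (Real.tanh (p + y + τ)) =
      L * F0 μ' ν U y p τ := by
    intro τ
    rw [hF, gk, sech_cpow]
    unfold F0 KK
    set q := p + y + τ with hq
    have cq : (Real.cosh q : ℂ) ≠ 0 := Complex.ofReal_ne_zero.2 (Real.cosh_pos q).ne'
    have ec : ((1 / Real.cosh q ^ 2 : ℝ) : ℂ) * ((Real.cosh q : ℂ) ^ μ * (Real.cosh q : ℂ) ^ (-2 * (α / 2 - 5 / 4))) = 1 := by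
      rw [← Complex.cpow_add _ _ cq, show μ + -2 * (α / 2 - 5 / 4) = (2 : ℕ) by rw [hμ]; push_cast; ring,
        Complex.cpow_natCast]
      rw [← Complex.ofReal_pow, ← Complex.ofReal_mul, one_div, inv_mul_cancel₀ (by
        have := Real.cosh_pos q; positivity), Complex.ofReal_one]
    have ee : Complex.exp (-μ' * q) = Complex.exp (-μ' * (p + y : ℝ)) * Complex.exp (-μ' * τ) := by
      rw [← Complex.exp_add]; congr 1; rw [hq]; push_cast; ring
    rw [ee, hL]
    linear_combination (Kc lam α * D * 2 ^ μ * (Complex.exp (-μ' * (p + y : ℝ)) * Complex.exp (-μ' * τ)) * U q * legendreP ν (bb y p q)) * ec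
  simp only [key] at e1 e2
  have i0 : IntegrableOn (F0 μ' ν U y p) (Ioi 0) := by
    have := (e1.1 hint).const_mul L⁻¹
    refine this.congr (Filter.Eventually.of_forall fun τ => ?_)
    simp only
    rw [← mul_assoc, inv_mul_cancel₀ hL0, one_mul]
  have h1 := nonint h2 hA hA0 y p i0
  obtain ⟨U1, sol⟩ := hsol h1
  have hm := sol.main hA hA0 y p
  have hc := hC h1
  rw [e2, integral_const_mul, gk, gk, sech_cpow, sech_cpow]
  change _ = _ * (L * Phi μ' ν U y p)
  have cp : (Real.cosh p : ℂ) ≠ 0 := Complex.ofReal_ne_zero.2 (Real.cosh_pos p).ne'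
  have cy : (Real.cosh y : ℂ) ≠ 0 := Complex.ofReal_ne_zero.2 (Real.cosh_pos y).ne'
  rw [show -2 * (α / 2 - 1 / 4) = -μ by rw [hμ]; ring, Complex.cpow_neg, Complex.cpow_neg, hL]
  have ee : Complex.exp (-μ' * (p + y : ℝ)) = Complex.exp (-μ' * p) * Complex.exp (-μ' * y) := by
    rw [← Complex.exp_add]; congr 1; push_cast; ring
  rw [ee]
  have cpm : (Real.cosh p : ℂ) ^ μ ≠ 0 := by rw [Complex.cpow_ne_zero_iff]; left; exact cp
  have cym : (Real.cosh y : ℂ) ^ μ ≠ 0 := by rw [Complex.cpow_ne_zero_iff]; left; exact cy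
  generalize (Real.cosh p : ℂ) ^ μ = X at *
  generalize (Real.cosh y : ℂ) ^ μ = Y at *
  generalize Complex.exp (-μ' * p) = E1 at *
  generalize Complex.exp (-μ' * y) = E2 at *
  generalize (2 : ℂ) ^ μ = T at *
  apply mul_right_cancel₀ hA0
  rw [show Cf lam α / (X⁻¹ * Y⁻¹) = Cf lam α * X * Y by field_simp]
  linear_combination (Kc lam α * D * T * X * Y * E1 * E2 * U p * U y) * hc -
    Cf lam α * X * Y * Kc lam α * D * T * E1 * E2 * hm

lemma const_id {lam α : ℂ} (h0 : lam ≠ 0) (hg : Complex.Gamma (-lam / 2) ≠ 0) :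
    Kc lam α * (2 * Real.sqrt Real.pi) =
      Cf lam α * (Complex.Gamma (-lam / 2) * Complex.Gamma (lam / 2 + α)) := by
  have d := Complex.Gamma_mul_Gamma_add_half (lam / 2 + α)
  rw [show 2 * (lam / 2 + α) = lam + 2 * α by ring] at d
  have g1 : Complex.Gamma (1 - lam / 2) = -lam / 2 * Complex.Gamma (-lam / 2) := by
    rw [← Complex.Gamma_add_one _ (by simpa using h0)]; congr 1; ring
  have g2 := Complex.Gamma_add_one lam h0
  unfold Kc Cf
  have t1 : (2 : ℂ) ^ (1 - (lam + 2 * α)) * 2 ^ lam * 2 ^ (2 * α - 1) = 1 := by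
    rw [← Complex.cpow_add _ _ two_ne_zero, ← Complex.cpow_add _ _ two_ne_zero,
      show 1 - (lam + 2 * α) + lam + (2 * α - 1) = 0 by ring, Complex.cpow_zero]
  have t0 : (2 : ℂ) ^ (2 * α - 1) ≠ 0 := by rw [Complex.cpow_ne_zero_iff]; left; norm_num
  rw [g1, g2]
  by_cases ha : Complex.Gamma α = 0
  · simp [ha]
  by_cases hl : Complex.Gamma lam = 0
  · simp [hl]
  generalize Complex.Gamma (-lam / 2) = G at *
  generalize Complex.Gamma (lam / 2 + α) = G1 at *
  generalize Complex.Gamma (lam / 2 + α + 1 / 2) = G2 at *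
  generalize Complex.Gamma (lam + 2 * α) = G3 at *
  generalize Complex.Gamma α = G4 at *
  generalize Complex.Gamma lam = G5 at *
  generalize (2 : ℂ) ^ (1 - (lam + 2 * α)) = T1 at *
  generalize (2 : ℂ) ^ (2 * α - 1) = T2 at *
  generalize (2 : ℂ) ^ lam = T3 at *
  field_simp
  linear_combination (-T3 * T2) * d - (G3 * Real.sqrt Real.pi) * t1

lemma asc_add (n m : ℕ) (a : ℂ) : (ascPochhammer ℂ (n + m)).eval a =
    (ascPochhammer ℂ n).eval a * (ascPochhammer ℂ m).eval (a + n) := by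
  rw [← ascPochhammer_mul]
  simp

lemma hyp_exc (a b z : ℂ) (m : ℕ) (hz : ‖z‖ < 1) :
    hyp2F1reg a b (-m) z = (ascPochhammer ℂ (m + 1)).eval a * (ascPochhammer ℂ (m + 1)).eval b * z ^ (m + 1) *
      hyp2F1reg (a + (m + 1 : ℕ)) (b + (m + 1 : ℕ)) ((m + 1 : ℕ) + 1) z := by
  have hs := (hco_RS a b (-m)).summable hz
  have := hs.sum_add_tsum_nat_add (m + 1)
  rw [hyp_eq_ps, hyp_eq_ps]
  unfold ps
  rw [← this, ← tsum_mul_left]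
  have z1 : ∑ i ∈ Finset.range (m + 1), hco a b (-m) i * z ^ i = 0 := by
    refine Finset.sum_eq_zero fun i hi => ?_
    have hi' : i ≤ m := by have := Finset.mem_range.1 hi; omega
    have : (-(m : ℂ) + i) = -((m - i : ℕ) : ℂ) := by push_cast [hi']; ring
    unfold hco
    rw [this, Complex.Gamma_neg_nat_eq_zero]
    simp
  rw [z1, zero_add]
  congr 1
  ext n
  unfold hco
  have g1 : Complex.Gamma (-(m : ℂ) + ((n + (m + 1) : ℕ) : ℂ)) = n.factorial := by
    rw [← Complex.Gamma_nat_eq_factorial]; congr 1; push_cast; ring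
  have g2 : Complex.Gamma (((m + 1 : ℕ) : ℂ) + 1 + n) = (n + (m + 1)).factorial := by
    rw [← Complex.Gamma_nat_eq_factorial]; congr 1; push_cast; ring
  rw [g1, g2, add_comm n (m + 1), asc_add (m + 1) n a, asc_add (m + 1) n b, pow_add]
  have f1 : ((n.factorial : ℕ) : ℂ) ≠ 0 := by exact_mod_cast n.factorial_ne_zero
  have f2 : (((m + 1 + n).factorial : ℕ) : ℂ) ≠ 0 := by exact_mod_cast Nat.factorial_ne_zero _
  field_simp

lemma one_sub_zz (t : ℝ) : 1 - zz t = Real.exp t / (2 * Real.cosh t) := by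
  unfold zz
  rw [Real.cosh_eq, Real.exp_neg, show 2 * t = t + t by ring, Real.exp_add]
  have := Real.exp_pos t
  field_simp
  ring
lemma zz_eq (t : ℝ) : zz t = Real.exp (-t) / (2 * Real.cosh t) := by
  unfold zz
  rw [Real.cosh_eq, Real.exp_neg, show 2 * t = t + t by ring, Real.exp_add]
  have := Real.exp_pos t
  field_simp
  ring

lemma PP_id (μ : ℂ) (t : ℝ) :
    2 ^ μ * (Real.cosh t : ℂ) ^ μ * Complex.exp (-μ * t) * PP μ t = 1 := by
  have c := Real.cosh_pos t
  have e1 : (1 - (zz t : ℂ)) = ((Real.exp t / (2 * Real.cosh t) : ℝ) : ℂ) := by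
    rw [← one_sub_zz]; push_cast; rfl
  have e2 : Real.log (Real.exp t / (2 * Real.cosh t)) = t - (Real.log 2 + Real.log (Real.cosh t)) := by
    rw [Real.log_div (Real.exp_pos t).ne' (by positivity), Real.log_exp, Real.log_mul two_ne_zero c.ne']
  have p : 0 < Real.exp t / (2 * Real.cosh t) := by positivity
  unfold PP
  rw [e1, Complex.cpow_def_of_ne_zero (Complex.ofReal_ne_zero.2 p.ne'), ← Complex.ofReal_log p.le, e2,
    Complex.cpow_def_of_ne_zero (Complex.ofReal_ne_zero.2 c.ne'), ← Complex.ofReal_log c.le,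
    Complex.cpow_def_of_ne_zero two_ne_zero, show (2 : ℂ) = ((2 : ℝ) : ℂ) by norm_num, ← Complex.ofReal_log two_pos.le,
    ← Complex.exp_add, ← Complex.exp_add, ← Complex.exp_add, Complex.exp_eq_one_iff]
  exact ⟨0, by push_cast; ring⟩

lemma zz_pow_id (M : ℕ) (t : ℝ) :
    (zz t : ℂ) ^ M = 2 ^ (-(M : ℂ)) * (Real.cosh t : ℂ) ^ (-(M : ℂ)) * Complex.exp (-(M : ℂ) * t) := by
  have c := Real.cosh_pos t
  have c' : (Real.cosh t : ℂ) ≠ 0 := Complex.ofReal_ne_zero.2 c.ne'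
  rw [Complex.cpow_neg, Complex.cpow_neg, Complex.cpow_natCast, Complex.cpow_natCast, zz_eq,
    show -(M : ℂ) * t = (M : ℂ) * (-t) by ring, Complex.exp_nat_mul, Complex.ofReal_div, Complex.ofReal_mul,
    Complex.ofReal_exp, div_pow, mul_pow, Complex.ofReal_neg, Complex.ofReal_ofNat, ← mul_inv, mul_comm, div_eq_mul_inv, mul_comm]

lemma zz_arg (t : ℝ) : (1 - (Real.tanh t : ℂ)) / 2 = (zz t : ℂ) := by
  rw [zz_tanh]; push_cast; rfl

lemma re_half (w : ℂ) : (w / 2).re = w.re / 2 := by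
  rw [show w / 2 = w / ((2 : ℝ) : ℂ) by push_cast; rfl, Complex.div_ofReal_re]

lemma Gamma_ne_of_re {s : ℂ} (h : 0 < s.re) : Complex.Gamma s ≠ 0 := Complex.Gamma_ne_zero_of_re_pos h

lemma hco_zero (a b c : ℂ) : hco a b c 0 = 1 / Complex.Gamma c := by
  simp [hco]

lemma half_re : ((1 : ℂ) / 2).re = 1 / 2 := by rw [re_half]; simp

lemma final_gen {lam α : ℂ} (h1 : 0 < (lam + 2 * α).re) (hK : Kc lam α ≠ 0) (hex : ∀ m : ℕ, α + 1 / 2 ≠ -m)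
    (p y : ℝ) (F : ℝ → ℂ)
    (hF : ∀ q, F (Real.tanh q) = gegenbauerCcut lam α (Real.tanh q) *
        ((1 - Real.tanh q ^ 2 : ℝ) : ℂ) ^ (α / 2 - 5 / 4) * legendreP (lam + α - 1 / 2) (bb y p q))
    (hint : IntegrableOn F (Ioo (Real.tanh (p + y)) 1)) :
    gegenbauerCcut lam α (Real.tanh p) * gegenbauerCcut lam α (Real.tanh y) =
      Cf lam α / (((1 - Real.tanh p ^ 2 : ℝ) : ℂ) ^ (α / 2 - 1 / 4) *
        ((1 - Real.tanh y ^ 2 : ℝ) : ℂ) ^ (α / 2 - 1 / 4)) * ∫ x in Ioo (Real.tanh (p + y)) 1, F x := by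
  set ν := lam + α - 1 / 2 with hν
  set μ := α - 1 / 2 with hμ
  have gm : Complex.Gamma (μ + 1) ≠ 0 := Complex.Gamma_ne_zero fun m h => hex m (by rw [← h, hμ]; ring)
  have h2 : -1 - ν.re < μ.re := by
    have : (lam + 2 * α).re = ν.re + μ.re + 1 := by
      rw [show lam + 2 * α = ν + μ + 1 by rw [hν, hμ]; ring]; simp
    linarith
  have he : hco (-lam) (lam + 2 * α) (α + 1 / 2) = hco (μ - ν) (μ + ν + 1) (μ + 1) := by
    congr 1 <;> rw [hμ]
    · rw [hν]; ring
    · rw [hν]; ring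
    · ring
  refine core (μ' := μ) (D := 1) (A := 1 / Complex.Gamma (μ + 1))
    (U := Uc μ (hco (μ - ν) (μ + ν + 1) (μ + 1))) hK one_ne_zero ?_ (one_div_ne_zero gm) h2 ?_ ?_ ?_ p y F hF hint
  · have := Uc_lim μ (hco_RS (μ - ν) (μ + ν + 1) (μ + 1))
    rwa [hco_zero] at this
  · intro h
    exact ⟨_, Uc_USol h h2 (by simp)⟩
  · intro h
    have hl : lam.re < 0 := by
      have : lam.re = ν.re - μ.re := by
        rw [show lam = ν - μ by rw [hν, hμ]; ring]; simp
      linarith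
    have l0 : lam ≠ 0 := by rintro rfl; simp at hl
    have hg : Complex.Gamma (-lam / 2) ≠ 0 := Gamma_ne_of_re (by rw [re_half, Complex.neg_re]; linarith)
    have c := const_id (α := α) l0 hg
    have d := Mel_dup ν h h2
    rw [show (μ - ν) / 2 = -lam / 2 by rw [hμ, hν]; ring,
      show (μ + ν + 1) / 2 = lam / 2 + α by rw [hμ, hν]; ring] at d
    have sp : (Real.sqrt Real.pi : ℂ) ≠ 0 := by
      rw [Complex.ofReal_ne_zero]; positivity
    have := mul_ne_zero two_ne_zero sp
    change Kc lam α * 2 ^ μ * 1 * (1 / Complex.Gamma (μ + 1)) = Cf lam α * Mel ν μ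
    have gg : 1 / Complex.Gamma (μ + 1) * Complex.Gamma (μ + 1) = 1 := one_div_mul_cancel gm
    apply mul_right_cancel₀ (mul_ne_zero this gm)
    linear_combination (2 : ℂ) ^ μ * c - Cf lam α * d + Kc lam α * 2 ^ μ * (2 * (Real.sqrt Real.pi : ℂ)) * gg
  · intro t
    rw [zz_arg, hyp_eq_ps, he]
    unfold Uc
    linear_combination (-ps (hco (μ - ν) (μ + ν + 1) (μ + 1)) (zz t)) * PP_id μ t

lemma final_exc {lam α : ℂ} (h1 : 0 < (lam + 2 * α).re) (h4 : lam.re < 4) (hK : Kc lam α ≠ 0)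
    (m : ℕ) (hm : α + 1 / 2 = -m)
    (p y : ℝ) (F : ℝ → ℂ)
    (hF : ∀ q, F (Real.tanh q) = gegenbauerCcut lam α (Real.tanh q) *
        ((1 - Real.tanh q ^ 2 : ℝ) : ℂ) ^ (α / 2 - 5 / 4) * legendreP (lam + α - 1 / 2) (bb y p q))
    (hint : IntegrableOn F (Ioo (Real.tanh (p + y)) 1)) :
    gegenbauerCcut lam α (Real.tanh p) * gegenbauerCcut lam α (Real.tanh y) =
      Cf lam α / (((1 - Real.tanh p ^ 2 : ℝ) : ℂ) ^ (α / 2 - 1 / 4) *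
        ((1 - Real.tanh y ^ 2 : ℝ) : ℂ) ^ (α / 2 - 1 / 4)) * ∫ x in Ioo (Real.tanh (p + y)) 1, F x := by
  have hα : α = -m - 1 / 2 := by rw [← hm]; ring
  set ν := lam + α - 1 / 2 with hν
  have hν' : ν = lam - (m + 1 : ℕ) := by rw [hν, hα]; push_cast; ring
  have hμ : α - 1 / 2 = -((m + 1 : ℕ) : ℂ) := by rw [hα]; push_cast; ring
  have hl : 1 + 2 * (m : ℝ) < lam.re := by
    have e : lam + 2 * α = lam - ((1 + 2 * (m : ℝ) : ℝ) : ℂ) := by rw [hα]; push_cast; ring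
    rw [e, Complex.sub_re, Complex.ofReal_re] at h1
    linarith
  have νre : ν.re = lam.re - (m + 1) := by
    rw [hν']; simp
  have h2 : -1 - ν.re < ((m + 1 : ℕ) : ℂ).re := by
    rw [νre, Complex.natCast_re]; push_cast; linarith
  have hm2 : m < 2 := by
    by_contra hh
    push Not at hh
    have : (2 : ℝ) ≤ m := by exact_mod_cast hh
    linarith
  set D := (ascPochhammer ℂ (m + 1)).eval (-lam) * (ascPochhammer ℂ (m + 1)).eval (lam + 2 * α) with hD
  have ne : ∀ r : ℝ, r < lam.re → lam - r ≠ 0 := by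
    intro r hr h
    have := congrArg Complex.re h
    simp at this
    linarith
  have n0 := ne 0
  have n1 := ne 1
  have n2 := ne 2
  have n3 := ne 3
  push_cast at n0 n1 n2 n3
  have m0 : (0 : ℝ) ≤ m := by positivity
  have l0 : lam ≠ 0 := by simpa using n0 (by linarith)
  have l1 := n1 (by linarith)
  have D0 : D ≠ 0 := by
    rw [hD, hα]
    interval_cases m
    · simp
      refine ⟨l0, ?_⟩
      convert l1 using 1; ring
    · simp [ascPochhammer_succ_eval]
      norm_num at hl
      refine ⟨⟨l0, ?_⟩, ?_, ?_⟩
      · contrapose l1; linear_combination -l1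
      · have := n3 (by linarith)
        contrapose this; linear_combination this
      · have := n2 (by linarith)
        contrapose this; linear_combination this
  have gm : Complex.Gamma (((m + 1 : ℕ) : ℂ) + 1) ≠ 0 := by
    rw [Complex.Gamma_nat_eq_factorial]; exact_mod_cast Nat.factorial_ne_zero _
  refine core (μ' := ((m + 1 : ℕ) : ℂ)) (D := D) (A := 1 / Complex.Gamma (((m + 1 : ℕ) : ℂ) + 1))
    (U := Uc 0 (hco (0 - ν) (0 + ν + 1) (((m + 1 : ℕ) : ℂ) + 1))) hK D0 ?_ (one_div_ne_zero gm) h2 ?_ ?_ ?_ p y F hF hint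
  · have := Uc_lim 0 (hco_RS (0 - ν) (0 + ν + 1) (((m + 1 : ℕ) : ℂ) + 1))
    rwa [hco_zero] at this
  · intro h
    exact ⟨_, Uc_USol h h2 (by simp)⟩
  · intro h
    have h' : ν.re < ((m + 1 : ℕ) : ℂ).re := h
    have d := Mel_dup ν h' h2
    rw [νre, Complex.natCast_re] at h'
    push_cast at h'
    have sp : (Real.sqrt Real.pi : ℂ) ≠ 0 := by
      rw [Complex.ofReal_ne_zero]; positivity
    have ng : ∀ k : ℕ, k < m + 1 → -lam / 2 + k ≠ 0 := by
      intro k hk h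
      have := congrArg Complex.re h
      rw [Complex.add_re, re_half] at this
      simp at this
      have hk : (k : ℝ) ≤ m := by exact_mod_cast Nat.lt_succ_iff.1 hk
      linarith
    have ng2 : ∀ k : ℕ, 0 < (lam / 2 + α + k).re := by
      intro k
      have e : lam / 2 + α + k = (lam - ((1 + 2 * (m : ℝ) : ℝ) : ℂ)) / 2 + k := by rw [hα]; push_cast; ring
      rw [e, Complex.add_re, re_half, Complex.sub_re, Complex.ofReal_re, Complex.natCast_re]
      have : (0 : ℝ) ≤ k := by positivity
      linarith
    have ng3 : ∀ k : ℕ, lam / 2 + α + k ≠ 0 := by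
      intro k hk
      have := ng2 k
      rw [hk] at this; simp at this
    have hg : Complex.Gamma (-lam / 2) ≠ 0 := by
      refine Complex.Gamma_ne_zero fun k hk => ?_
      have := congrArg Complex.re hk
      rw [re_half] at this
      simp at this
      have e : lam.re = 2 * k := by linarith
      have a1 : (m : ℝ) < k := by linarith
      have a2 : (k : ℝ) < m + 1 := by linarith
      norm_cast at a1 a2
      omega
    have c := const_id (α := α) l0 hg
    rw [show (((m + 1 : ℕ) : ℂ) - ν) / 2 = -lam / 2 + (m + 1) by rw [hν']; push_cast; ring,
      show (((m + 1 : ℕ) : ℂ) + ν + 1) / 2 = lam / 2 + α + (m + 1) by rw [hν', hα]; push_cast; ring] at d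
    change Kc lam α * 2 ^ (α - 1 / 2) * D * (1 / Complex.Gamma (((m + 1 : ℕ) : ℂ) + 1)) = Cf lam α * Mel ν ((m + 1 : ℕ) : ℂ)
    rw [hμ, Complex.cpow_neg, Complex.cpow_natCast]
    rw [Complex.cpow_natCast] at d
    have := mul_ne_zero two_ne_zero sp
    have key : D * (Complex.Gamma (-lam / 2) * Complex.Gamma (lam / 2 + α)) =
        4 ^ (m + 1) * (Complex.Gamma (-lam / 2 + (m + 1)) * Complex.Gamma (lam / 2 + α + (m + 1))) := by
      have a0 := ng 0 (by omega)
      have b0 := ng3 0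
      have a0' := Complex.Gamma_add_one _ a0
      have b0' := Complex.Gamma_add_one _ b0
      simp only [Nat.cast_zero, add_zero] at a0' b0'
      rw [hD]
      interval_cases m
      · simp only [Nat.cast_zero, zero_add]
        rw [a0', b0', hα]
        simp
        ring
      · have a1' := Complex.Gamma_add_one _ (ng 1 (by omega))
        have b1' := Complex.Gamma_add_one _ (ng3 1)
        simp only [Nat.cast_one] at a1' b1' ⊢
        rw [← add_assoc, ← add_assoc, a1', b1', a0', b0']
        simp [ascPochhammer_succ_eval]
        rw [show α = -3 / 2 by rw [hα]; push_cast; ring]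
        ring
    have p4 : (4 : ℂ) ^ (m + 1) = 2 ^ (m + 1) * 2 ^ (m + 1) := by rw [← mul_pow]; norm_num
    rw [p4] at key
    have p2 : (2 : ℂ) ^ (m + 1) ≠ 0 := pow_ne_zero _ two_ne_zero
    have gg := one_div_mul_cancel gm
    have gt := inv_mul_cancel₀ p2
    apply mul_right_cancel₀ (mul_ne_zero (mul_ne_zero this gm) p2)
    generalize Complex.Gamma (-lam / 2 + (m + 1)) = G3 at *
    generalize Complex.Gamma (lam / 2 + α + (m + 1)) = G4 at *
    generalize 1 / Complex.Gamma (((m + 1 : ℕ) : ℂ) + 1) = Gi at *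
    generalize Complex.Gamma (((m + 1 : ℕ) : ℂ) + 1) = G at *
    generalize Mel ν ((m + 1 : ℕ) : ℂ) = Me at *
    generalize ((2 : ℂ) ^ (m + 1))⁻¹ = Ti at *
    generalize (2 : ℂ) ^ (m + 1) = T at *
    linear_combination D * c + Cf lam α * key - Cf lam α * T * d + Kc lam α * D * (2 * (Real.sqrt Real.pi : ℂ)) * (Ti * T * gg + gt)
  · intro t
    rw [zz_arg, hm, hyp_exc _ _ _ _ (zzc_norm t), ← hD, zz_pow_id, hμ, hyp_eq_ps]
    unfold Uc PP
    rw [Complex.cpow_zero, show -lam + ((m + 1 : ℕ) : ℂ) = 0 - ν by rw [hν']; ring,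
      show lam + 2 * α + ((m + 1 : ℕ) : ℂ) = 0 + ν + 1 by rw [hν', hα]; push_cast; ring]
    ring

/-- Kernel-form product formula for two Gegenbauer functions of the
first kind in the trigonometric context. -/
theorem gegenbauerCCcut_kernel_product
    (lam α : ℂ) (h1 : 0 < (lam + 2 * α).re) (h2 : lam.re < 4)
    (x₁ x₂ : ℝ) (hx₁ : -1 < x₁) (hx₁' : x₁ < 1) (hx₂ : -1 < x₂) (hx₂' : x₂ < 1)
    (B : ℝ → ℝ)
    (hB : ∀ x₃, B x₃ = (2 - x₁ ^ 2 - x₂ ^ 2 - x₃ ^ 2 + x₁ ^ 2 * x₂ ^ 2 * x₃ ^ 2) /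
        (2 * Real.sqrt ((1 - x₁ ^ 2) * (1 - x₂ ^ 2) * (1 - x₃ ^ 2))))
    (F : ℝ → ℂ)
    (hF : ∀ x₃, F x₃ = gegenbauerCcut lam α x₃ *
        ((1 - x₃ ^ 2 : ℝ) : ℂ) ^ (α / 2 - 5 / 4) * legendreP (lam + α - 1 / 2) (B x₃))
    (hint : IntegrableOn F (Ioo ((x₁ + x₂) / (1 + x₁ * x₂)) 1)) :
    gegenbauerCcut lam α x₁ * gegenbauerCcut lam α x₂ =
      -(2 : ℂ) ^ lam * (Real.sqrt Real.pi : ℂ) * Complex.Gamma (lam / 2 + α + 1 / 2) /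
        (Complex.Gamma lam * Complex.Gamma α * Complex.Gamma (1 - lam / 2) *
          ((1 - x₁ ^ 2 : ℝ) : ℂ) ^ (α / 2 - 1 / 4) * ((1 - x₂ ^ 2 : ℝ) : ℂ) ^ (α / 2 - 1 / 4)) *
        ∫ x₃ in Ioo ((x₁ + x₂) / (1 + x₁ * x₂)) 1, F x₃ := by
  by_cases hK : Kc lam α = 0
  · have hg : ∀ x, gegenbauerCcut lam α x = 0 := by
      intro x
      change Kc lam α * _ = 0
      rw [hK, zero_mul]
    have hF0 : ∀ x, F x = 0 := by
      intro x
      rw [hF, hg, zero_mul, zero_mul]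
    simp only [hF0, hg]
    simp
  obtain ⟨p, rfl⟩ : ∃ p, x₁ = Real.tanh p := ⟨Real.artanh x₁, (Real.tanh_artanh ⟨hx₁, hx₁'⟩).symm⟩
  obtain ⟨y, rfl⟩ : ∃ y, x₂ = Real.tanh y := ⟨Real.artanh x₂, (Real.tanh_artanh ⟨hx₂, hx₂'⟩).symm⟩
  rw [← tanh_add'] at hint ⊢
  have hF' : ∀ q, F (Real.tanh q) = gegenbauerCcut lam α (Real.tanh q) *
        ((1 - Real.tanh q ^ 2 : ℝ) : ℂ) ^ (α / 2 - 5 / 4) * legendreP (lam + α - 1 / 2) (bb y p q) := by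
    intro q
    rw [hF, hB, bb_tanh p y q]
  have main : gegenbauerCcut lam α (Real.tanh p) * gegenbauerCcut lam α (Real.tanh y) =
      Cf lam α / (((1 - Real.tanh p ^ 2 : ℝ) : ℂ) ^ (α / 2 - 1 / 4) *
        ((1 - Real.tanh y ^ 2 : ℝ) : ℂ) ^ (α / 2 - 1 / 4)) * ∫ x in Ioo (Real.tanh (p + y)) 1, F x := by
    by_cases hm : ∃ m : ℕ, α + 1 / 2 = -m
    · obtain ⟨m, hm⟩ := hm
      exact final_exc h1 h2 hK m hm p y F hF' hint
    · push Not at hm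
      exact final_gen h1 hK hm p y F hF' hint
  rw [main]
  congr 1
  unfold Cf
  rw [div_div, ← mul_assoc]
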